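/- For every n ≥ 3, the rational group cohomology of SL_n(ℤ) vanishes in codimension one below its virtual cohomological dimension: H^{n(n−1)/2 − 1}(SL_n(ℤ); ℚ) = 0. (Church–Putman) -/

import Mathlib

set_option linter.unusedSectionVars false
set_option linter.unusedVariables false

namespace SLCoh

open Finset Equiv Topology

/-! ### Alternating even cochains on tuples -/

section Cochains

variable {V : Type*} [AddCommGroup V]

/-- The simplicial coboundary. -/
def del {s : ℕ} : ((Fin s → V) → ℚ) →ₗ[ℚ] ((Fin (s + 1) → V) → ℚ) where
  toFun f x := ∑ i : Fin (s + 1), (-1) ^ (i : ℕ) * f (i.removeNth x)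
  map_add' f g := by
    ext x
    simp [mul_add, Finset.sum_add_distrib]
  map_smul' c f := by
    ext x
    simp only [Pi.smul_apply, smul_eq_mul, RingHom.id_apply, Finset.mul_sum]
    exact Finset.sum_congr rfl fun i _ => by ring

theorem del_apply {s : ℕ} (f : (Fin s → V) → ℚ) (x : Fin (s + 1) → V) :
    del f x = ∑ i : Fin (s + 1), (-1) ^ (i : ℕ) * f (i.removeNth x) := rfl

/-- Restriction of a cochain to tuples with a fixed first entry. -/
def link {s : ℕ} (v : V) (f : (Fin (s + 1) → V) → ℚ) : (Fin s → V) → ℚ :=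
  fun x => f (Fin.cons v x)

theorem removeNth_succ_cons {s : ℕ} (v : V) (x : Fin (s + 1) → V) (i : Fin (s + 1)) :
    (i.succ).removeNth (Fin.cons v x : Fin (s + 2) → V) = Fin.cons v (i.removeNth x) := by
  ext j
  refine Fin.cases ?_ (fun j => ?_) j
  · simp [Fin.removeNth]
  · simp [Fin.removeNth]

theorem removeNth_zero_cons {s : ℕ} (v : V) (x : Fin s → V) :
    (0 : Fin (s + 1)).removeNth (Fin.cons v x : Fin (s + 1) → V) = x := by
  ext j; simp [Fin.removeNth]

theorem del_cons {s : ℕ} (f : (Fin (s + 1) → V) → ℚ) (v : V) (x : Fin (s + 1) → V) :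
    del f (Fin.cons v x) = f x - del (link v f) x := by
  rw [del_apply, Fin.sum_univ_succ, removeNth_zero_cons, del_apply, sub_eq_add_neg,
    ← Finset.sum_neg_distrib]
  congr 1
  · simp
  · refine Finset.sum_congr rfl fun i _ => ?_
    rw [removeNth_succ_cons, Fin.val_succ, pow_succ, link]
    ring

theorem del_zero_apply (f : (Fin 0 → V) → ℚ) (x : Fin 1 → V) (y : Fin 0 → V) :
    del f x = f y := by
  rw [del_apply, Fin.sum_univ_one]
  simp [Subsingleton.elim _ y]

theorem del_cons_zero (f : (Fin 0 → V) → ℚ) (v : V) (x : Fin 0 → V) :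
    del f (Fin.cons v x) = f x := del_zero_apply f _ _

theorem link_del {s : ℕ} (f : (Fin (s + 1) → V) → ℚ) (v : V) :
    link v (del f) = f - del (link v f) := by
  ext x; exact del_cons f v x

theorem del_del {s : ℕ} (f : (Fin s → V) → ℚ) : del (del f) = 0 := by
  induction s with
  | zero =>
    ext x
    obtain ⟨v, y, rfl⟩ : ∃ v y, x = Fin.cons v y := ⟨x 0, Fin.tail x, (Fin.cons_self_tail x).symm⟩
    rw [del_cons, del_zero_apply f y default, del_zero_apply _ y default, link,
      del_zero_apply f _ default]
    simp
  | succ s ih =>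
    ext x
    obtain ⟨v, y, rfl⟩ : ∃ v y, x = Fin.cons v y := ⟨x 0, Fin.tail x, (Fin.cons_self_tail x).symm⟩
    rw [del_cons, link_del, map_sub, ih]
    simp

/-- Alternating cochains, invariant under sign changes of the entries. -/
structure AE {s : ℕ} (f : (Fin s → V) → ℚ) : Prop where
  alt : ∀ (σ : Perm (Fin s)) (x : Fin s → V), f (x ∘ σ) = ((Perm.sign σ : ℤ) : ℚ) * f x
  even : ∀ x y : Fin s → V, (∀ i, y i = x i ∨ y i = -x i) → f y = f x

variable {s : ℕ}

theorem AE.zero : AE (0 : (Fin s → V) → ℚ) := ⟨by simp, by simp⟩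

theorem AE.add {f g : (Fin s → V) → ℚ} (hf : AE f) (hg : AE g) : AE (f + g) :=
  ⟨fun σ x => by simp [hf.alt, hg.alt, mul_add],
    fun x y h => by simp [hf.even x y h, hg.even x y h]⟩

theorem AE.smul {f : (Fin s → V) → ℚ} (c : ℚ) (hf : AE f) : AE (c • f) :=
  ⟨fun σ x => by simp [hf.alt, mul_left_comm], fun x y h => by simp [hf.even x y h]⟩

theorem AE.neg {f : (Fin s → V) → ℚ} (hf : AE f) : AE (-f) := by
  simpa using hf.smul (-1)

theorem AE.sub {f g : (Fin s → V) → ℚ} (hf : AE f) (hg : AE g) : AE (f - g) := by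
  simpa [sub_eq_add_neg] using hf.add hg.neg

theorem AE.of_size_zero (f : (Fin 0 → V) → ℚ) : AE f :=
  ⟨fun σ x => by rw [Subsingleton.elim (x ∘ σ) x, Subsingleton.elim σ 1]; simp,
    fun x y _ => by rw [Subsingleton.elim x y]⟩

theorem AE.link {f : (Fin (s + 1) → V) → ℚ} (hf : AE f) (v : V) : AE (link v f) := by
  refine ⟨fun σ x => ?_, fun x y h => ?_⟩
  · have := hf.alt (Equiv.Perm.decomposeFin.symm (0, σ)) (Fin.cons v x)
    rw [Equiv.Perm.decomposeFin.symm_sign] at this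
    simp only [if_true, one_mul] at this
    rw [SLCoh.link, SLCoh.link, ← this]
    congr 1
    ext j
    refine Fin.cases ?_ (fun j => ?_) j
    · simp
    · simp
  · refine hf.even _ _ fun i => ?_
    refine Fin.cases ?_ (fun j => ?_) i
    · simp
    · simpa using h j

/-- It suffices to check alternation on adjacent transpositions. -/
theorem alt_of_adjacent {f : (Fin (s + 1) → V) → ℚ}
    (h : ∀ (i : Fin s) (x : Fin (s + 1) → V), f (x ∘ swap i.castSucc i.succ) = -f x) :
    ∀ (σ : Perm (Fin (s + 1))) x, f (x ∘ σ) = ((Perm.sign σ : ℤ) : ℚ) * f x := by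
  intro σ
  have hσ : σ ∈ Submonoid.closure (Set.range fun i : Fin s => swap i.castSucc i.succ) := by
    rw [Equiv.Perm.mclosure_swap_castSucc_succ]; trivial
  induction hσ using Submonoid.closure_induction with
  | mem σ hσ =>
    obtain ⟨i, rfl⟩ := hσ
    intro x
    simp only
    rw [h, Perm.sign_swap (Fin.castSucc_lt_succ).ne]
    simp
  | one => intro x; simp
  | mul σ τ _ _ h1 h2 =>
    intro x
    rw [Perm.coe_mul, ← Function.comp_assoc, h2, h1]
    simp; ring

theorem comp_swap_eq_cons (x : Fin (s + 2) → V) (j : Fin s) :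
    x ∘ swap (j.succ).castSucc (j.succ).succ =
      Fin.cons (x 0) (Fin.tail x ∘ swap j.castSucc j.succ) := by
  ext k
  refine Fin.cases ?_ (fun k => ?_) k
  · simp only [Function.comp_apply, Fin.cons_zero]
    rw [swap_apply_of_ne_of_ne]
    · simp [Fin.ext_iff]
    · simp [Fin.ext_iff]
  · simp only [Function.comp_apply, Fin.cons_succ, Fin.tail]
    congr 1
    rw [← Fin.succ_castSucc]
    exact (Function.Injective.swap_apply (Fin.succ_injective _) _ _ _)

theorem AE.adjacent {f : (Fin (s + 1) → V) → ℚ} (hf : AE f) (i : Fin s) (x : Fin (s + 1) → V) :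
    f (x ∘ swap i.castSucc i.succ) = -f x := by
  rw [hf.alt, Perm.sign_swap (Fin.castSucc_lt_succ).ne]; simp

theorem del_adjacent {s : ℕ} : ∀ {f : (Fin s → V) → ℚ}, AE f → ∀ (i : Fin s)
    (x : Fin (s + 1) → V), del f (x ∘ swap i.castSucc i.succ) = -del f x := by
  induction s with
  | zero => intro f _ i; exact i.elim0
  | succ s ih =>
    intro f hf i x
    refine Fin.cases ?_ (fun j => ?_) i
    · obtain ⟨a, y, rfl⟩ : ∃ v y, x = Fin.cons v y :=
        ⟨x 0, Fin.tail x, (Fin.cons_self_tail x).symm⟩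
      obtain ⟨b, y, rfl⟩ : ∃ v z, y = Fin.cons v z :=
        ⟨y 0, Fin.tail y, (Fin.cons_self_tail y).symm⟩
      have e : (Fin.cons a (Fin.cons b y) : Fin (s + 2) → V) ∘
          swap (0 : Fin (s + 1)).castSucc (0 : Fin (s + 1)).succ = Fin.cons b (Fin.cons a y) := by
        ext k
        refine Fin.cases ?_ (fun k => Fin.cases ?_ (fun k => ?_) k) k
        · simp
        · simp
        · have : swap (0 : Fin (s + 1)).castSucc (0 : Fin (s + 1)).succ k.succ.succ
              = k.succ.succ := by
            apply swap_apply_of_ne_of_ne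
            · exact Fin.succ_ne_zero _
            · simp [Fin.ext_iff]
          rw [Function.comp_apply, this]
          simp
      rw [e]
      cases s with
      | zero =>
        rw [del_cons, del_cons, del_cons_zero, del_cons_zero]
        simp [SLCoh.link]
      | succ s =>
        rw [del_cons, del_cons, del_cons, del_cons]
        have : SLCoh.link a (SLCoh.link b f) = - SLCoh.link b (SLCoh.link a f) := by
          ext z
          have h := hf.adjacent 0 (Fin.cons a (Fin.cons b z))
          have e : (Fin.cons a (Fin.cons b z) : Fin (s + 3 - 1) → V) ∘
              swap (0 : Fin (s + 1)).castSucc (0 : Fin (s + 1)).succ =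
              Fin.cons b (Fin.cons a z) := by
            ext k
            refine Fin.cases ?_ (fun k => Fin.cases ?_ (fun k => ?_) k) k
            · simp
            · simp
            · have : swap (0 : Fin (s + 1)).castSucc (0 : Fin (s + 1)).succ k.succ.succ
                  = k.succ.succ := by
                apply swap_apply_of_ne_of_ne
                · exact Fin.succ_ne_zero _
                · simp [Fin.ext_iff]
              rw [Function.comp_apply, this]
              simp
          rw [e] at h
          simp only [SLCoh.link, Pi.neg_apply]
          rw [h]
        rw [this, map_neg]
        simp [SLCoh.link]
        ring
    · rw [comp_swap_eq_cons, ← Fin.cons_self_tail x, del_cons, del_cons]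
      simp only [Fin.cons_zero, Fin.tail_cons]
      rw [hf.adjacent, ih (hf.link _)]
      ring

theorem AE.del {f : (Fin s → V) → ℚ} (hf : AE f) : AE (del f) := by
  refine ⟨alt_of_adjacent (del_adjacent hf), fun x y h => ?_⟩
  simp only [del_apply]
  refine Finset.sum_congr rfl fun i _ => ?_
  rw [hf.even (i.removeNth x) (i.removeNth y)]
  intro j; exact h _

theorem AE.eq_zero_of_dup {f : (Fin s → V) → ℚ} (hf : AE f) {x : Fin s → V} {i j : Fin s}
    (hij : i ≠ j) (h : x i = x j ∨ x i = -x j) : f x = 0 := by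
  have h1 := hf.alt (swap i j) x
  rw [Perm.sign_swap hij] at h1
  have h2 : f (x ∘ swap i j) = f x := by
    refine hf.even _ _ fun k => ?_
    simp only [Function.comp_apply]
    rcases eq_or_ne k i with rfl | hki
    · rw [swap_apply_left]
      rcases h with h | h
      · exact Or.inl h.symm
      · right; rw [h, neg_neg]
    · rcases eq_or_ne k j with rfl | hkj
      · rw [swap_apply_right]; exact h
      · rw [swap_apply_of_ne_of_ne hki hkj]; simp
  rw [h2] at h1
  push_cast at h1
  linarith

/-- Cone construction. -/
theorem eq_del_link {f : (Fin (s + 1) → V) → ℚ} {v : V} {x : Fin (s + 1) → V}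
    (h : del f (Fin.cons v x) = 0) : f x = del (link v f) x := by
  rw [del_cons] at h; linarith

/-! ### Complexes of tuples -/

variable (V) in
/-- A family of sets of tuples closed under passing to tuples whose entries are, up to sign,
among the entries of the given one. -/
structure Cpx where
  car : ∀ s, Set (Fin s → V)
  closed : ∀ {s t : ℕ} {x : Fin s → V} {y : Fin t → V}, x ∈ car s →
    (∀ j, ∃ i, y j = x i ∨ y j = -x i) → y ∈ car t

theorem Cpx.face (Y : Cpx V) {x : Fin (s + 1) → V} (hx : x ∈ Y.car (s + 1)) (i : Fin (s + 1)) :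
    i.removeNth x ∈ Y.car s := Y.closed hx fun j => ⟨i.succAbove j, Or.inl rfl⟩

theorem Cpx.perm (Y : Cpx V) {x : Fin s → V} (σ : Perm (Fin s)) :
    x ∘ σ ∈ Y.car s ↔ x ∈ Y.car s :=
  ⟨fun h => Y.closed h fun j => ⟨σ.symm j, by simp⟩, fun h => Y.closed h fun j => ⟨σ j, by simp⟩⟩

theorem Cpx.sign (Y : Cpx V) {x y : Fin s → V} (h : ∀ i, y i = x i ∨ y i = -x i) :
    y ∈ Y.car s ↔ x ∈ Y.car s :=
  ⟨fun hy => Y.closed hy fun j => ⟨j, (h j).imp Eq.symm fun e => by rw [e, neg_neg]⟩,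
    fun hx => Y.closed hx fun j => ⟨j, h j⟩⟩

/-- Two cochains agreeing on a complex have the same coboundary there. -/
theorem Cpx.del_congr (Y : Cpx V) {f g : (Fin s → V) → ℚ} (h : ∀ x ∈ Y.car s, f x = g x)
    {x : Fin (s + 1) → V} (hx : x ∈ Y.car (s + 1)) : del f x = del g x := by
  simp only [del_apply]
  exact Finset.sum_congr rfl fun i _ => by rw [h _ (Y.face hx i)]

theorem Cpx.del_eq_zero (Y : Cpx V) {f : (Fin s → V) → ℚ} (h : ∀ x ∈ Y.car s, f x = 0)
    {x : Fin (s + 1) → V} (hx : x ∈ Y.car (s + 1)) : del f x = 0 := by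
  rw [Y.del_congr (g := 0) (by simpa using h) hx]; simp

open Classical in
/-- Pasting of two cochains along a condition. -/
noncomputable def paste (S : Set (Fin s → V)) (f g : (Fin s → V) → ℚ) : (Fin s → V) → ℚ :=
  fun x => if x ∈ S then f x else g x

theorem paste_of_mem {S : Set (Fin s → V)} {f g : (Fin s → V) → ℚ} {x} (h : x ∈ S) :
    paste S f g x = f x := by simp [paste, h]

theorem paste_of_notMem {S : Set (Fin s → V)} {f g : (Fin s → V) → ℚ} {x} (h : x ∉ S) :
    paste S f g x = g x := by simp [paste, h]

theorem AE.paste (Y : Cpx V) {f g : (Fin s → V) → ℚ} (hf : AE f) (hg : AE g) :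
    AE (paste (Y.car s) f g) := by
  refine ⟨fun σ x => ?_, fun x y h => ?_⟩
  · by_cases hx : x ∈ Y.car s
    · rw [paste_of_mem hx, paste_of_mem ((Y.perm σ).2 hx), hf.alt]
    · rw [paste_of_notMem hx, paste_of_notMem (fun h => hx ((Y.perm σ).1 h)), hg.alt]
  · by_cases hx : x ∈ Y.car s
    · rw [paste_of_mem hx, paste_of_mem ((Y.sign h).2 hx), hf.even x y h]
    · rw [paste_of_notMem hx, paste_of_notMem (fun h' => hx ((Y.sign h).1 h')), hg.even x y h]

/-- Being a coboundary on a complex. -/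
def IsCob (Y : Cpx V) : ∀ {s : ℕ}, ((Fin s → V) → ℚ) → Prop
  | 0, f => ∀ x ∈ Y.car 0, f x = 0
  | s + 1, f => ∃ g : (Fin s → V) → ℚ, AE g ∧ ∀ x ∈ Y.car (s + 1), f x = del g x

/-- Vanishing of the cohomology of a complex at tuples of size `s`. -/
def Acyc (Y : Cpx V) (s : ℕ) : Prop :=
  ∀ f : (Fin s → V) → ℚ, AE f → (∀ x ∈ Y.car (s + 1), del f x = 0) → IsCob Y f

theorem isCob_congr (Y : Cpx V) : ∀ {s : ℕ} {f g : (Fin s → V) → ℚ}, 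
    (∀ x ∈ Y.car s, f x = g x) → IsCob Y f → IsCob Y g
  | 0, f, g, h, hf => fun x hx => by rw [← h x hx, hf x hx]
  | s + 1, f, g, h, ⟨p, hp, e⟩ => ⟨p, hp, fun x hx => by rw [← h x hx, e x hx]⟩

theorem isCob_of_zero (Y : Cpx V) : ∀ {s : ℕ} {f : (Fin s → V) → ℚ},
    (∀ x ∈ Y.car s, f x = 0) → IsCob Y f
  | 0, _, h => h
  | _ + 1, _, h => ⟨0, AE.zero, fun x hx => by rw [h x hx]; simp⟩

theorem IsCob.mono {Y Z : Cpx V} : ∀ {s : ℕ} {f : (Fin s → V) → ℚ},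
    (∀ x ∈ Y.car s, x ∈ Z.car s) → IsCob Z f → IsCob Y f
  | 0, _, h, hf => fun x hx => hf x (h x hx)
  | _ + 1, _, h, ⟨p, hp, e⟩ => ⟨p, hp, fun x hx => e x (h x hx)⟩

theorem acyc_of_cone (Y : Cpx V) (v : V) (hv : ∀ s, ∀ x ∈ Y.car s, Fin.cons v x ∈ Y.car (s + 1))
    (s : ℕ) : Acyc Y s := by
  intro f hf h
  cases s with
  | zero =>
    intro x hx
    rw [← del_zero_apply f (Fin.cons v x) x]
    exact h _ (hv _ _ hx)
  | succ s => exact ⟨link v f, hf.link v, fun x hx => eq_del_link (h _ (hv _ _ hx))⟩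

theorem acyc_of_isEmpty (Y : Cpx V) (hY : ∀ s, Y.car s = ∅) (s : ℕ) : Acyc Y s := fun f _ _ =>
  isCob_of_zero Y (by simp [hY])

instance : LE (Cpx V) := ⟨fun A B => ∀ s, A.car s ⊆ B.car s⟩

instance : Min (Cpx V) := ⟨fun A B => ⟨fun s => A.car s ∩ B.car s, fun hx h =>
  ⟨A.closed hx.1 h, B.closed hx.2 h⟩⟩⟩

instance : Max (Cpx V) := ⟨fun A B => ⟨fun s => A.car s ∪ B.car s, fun hx h =>
  hx.imp (fun hx => A.closed hx h) (fun hx => B.closed hx h)⟩⟩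

theorem Cpx.mem_inf {A B : Cpx V} {x : Fin s → V} :
    x ∈ (A ⊓ B).car s ↔ x ∈ A.car s ∧ x ∈ B.car s := Iff.rfl

theorem Cpx.mem_sup {A B : Cpx V} {x : Fin s → V} :
    x ∈ (A ⊔ B).car s ↔ x ∈ A.car s ∨ x ∈ B.car s := Iff.rfl

@[ext] theorem Cpx.ext {A B : Cpx V} (h : ∀ s (x : Fin s → V), x ∈ A.car s ↔ x ∈ B.car s) :
    A = B := by
  cases A; cases B
  congr
  ext s x; exact h s x

/-- Relative vanishing. -/
theorem rel_acyc {A B : Cpx V} (hBA : B ≤ A) {t : ℕ} (hA : Acyc A (t + 1)) (hB : Acyc B t)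
    {f : (Fin (t + 1) → V) → ℚ} (hf : AE f) (hfB : ∀ x ∈ B.car (t + 1), f x = 0)
    (hfA : ∀ x ∈ A.car (t + 2), del f x = 0) :
    ∃ g : (Fin t → V) → ℚ, AE g ∧ (∀ x ∈ B.car t, g x = 0) ∧
      ∀ x ∈ A.car (t + 1), f x = del g x := by
  obtain ⟨g, hg, e⟩ := hA f hf hfA
  have hgB : ∀ x ∈ B.car (t + 1), del g x = 0 := fun x hx => by
    rw [← e x (hBA _ hx), hfB x hx]
  have := hB g hg hgB
  cases t with
  | zero => exact ⟨g, hg, this, e⟩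
  | succ t =>
    obtain ⟨p, hp, e'⟩ := this
    refine ⟨g - del p, hg.sub hp.del, fun x hx => by simp [e' x hx], fun x hx => ?_⟩
    rw [map_sub, del_del, e x hx]; simp

theorem glue {A B : Cpx V} {f : (Fin s → V) → ℚ} (hA : IsCob A f) (hB : IsCob B f)
    (hAB : ∀ t, t + 1 = s → Acyc (A ⊓ B) t) : IsCob (A ⊔ B) f := by
  cases s with
  | zero => rintro x (hx | hx); exacts [hA x hx, hB x hx]
  | succ t =>
    obtain ⟨g, hg, eg⟩ := hA
    obtain ⟨k, hk, ek⟩ := hB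
    have h1 := hAB t rfl (g - k) (hg.sub hk) (by
      rintro x ⟨hx, hx'⟩
      rw [map_sub, Pi.sub_apply, ← eg x hx, ← ek x hx', sub_self])
    obtain ⟨k', hk', ek', hgk⟩ : ∃ k' : (Fin t → V) → ℚ, AE k' ∧
        (∀ x ∈ B.car (t + 1), f x = del k' x) ∧
        ∀ x ∈ (A ⊓ B).car t, g x = k' x := by
      cases t with
      | zero => exact ⟨k, hk, ek, fun x hx => by have := h1 x hx; simp at this; linarith⟩
      | succ t =>
        obtain ⟨p, hp, ep⟩ := h1
        refine ⟨k + del p, hk.add hp.del, fun x hx => ?_, fun x hx => ?_⟩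
        · rw [map_add, del_del, add_zero, ek x hx]
        · have := ep x hx
          simp at this ⊢
          linarith
    refine ⟨paste (A.car t) g k', AE.paste A hg hk', ?_⟩
    rintro x (hx | hx)
    · rw [eg x hx]
      exact A.del_congr (fun y hy => (paste_of_mem hy).symm) hx
    · rw [ek' x hx]
      refine B.del_congr (fun y hy => ?_) hx
      by_cases hyA : y ∈ A.car t
      · rw [paste_of_mem hyA, hgk y ⟨hyA, hy⟩]
      · rw [paste_of_notMem hyA]

/-- Increasing unions of acyclic complexes are acyclic. -/
theorem acyc_iUnion (Y : ℕ → Cpx V) (hY : ∀ k, Y k ≤ Y (k + 1)) (Z : Cpx V)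
    (hZ : ∀ s (x : Fin s → V), x ∈ Z.car s ↔ ∃ k, x ∈ (Y k).car s)
    (h : ∀ k s, Acyc (Y k) s) (s : ℕ) : Acyc Z s := by
  intro f hf hd
  have mono : ∀ {s} {x : Fin s → V} {k l}, k ≤ l → x ∈ (Y k).car s → x ∈ (Y l).car s := by
    intro s x k l hkl hx
    induction l, hkl using Nat.le_induction with
    | base => exact hx
    | succ l _ ih => exact hY l _ ih
  have hk : ∀ k, IsCob (Y k) f := fun k => h k s f hf fun x hx => hd x ((hZ _ _).2 ⟨k, hx⟩)
  cases s with
  | zero => intro x hx; obtain ⟨k, hx⟩ := (hZ _ _).1 hx; exact hk k x hx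
  | succ t =>
    have step : ∀ k (g : {g : (Fin t → V) → ℚ // AE g ∧ ∀ x ∈ (Y k).car (t + 1), f x = del g x}),
        ∃ g' : {g : (Fin t → V) → ℚ // AE g ∧ ∀ x ∈ (Y (k + 1)).car (t + 1), f x = del g x},
          ∀ x ∈ (Y k).car t, g'.1 x = g.1 x := by
      rintro k ⟨g, hg, eg⟩
      obtain ⟨g', hg', eg'⟩ := hk (k + 1)
      have h1 := h k t (g' - g) (hg'.sub hg) (fun x hx => by
        rw [map_sub, Pi.sub_apply, ← eg x hx, ← eg' x (hY k _ hx), sub_self])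
      cases t with
      | zero =>
        exact ⟨⟨g', hg', eg'⟩, fun x hx => by have := h1 x hx; simp at this; simp; linarith⟩
      | succ t =>
        obtain ⟨p, hp, ep⟩ := h1
        refine ⟨⟨g' - del p, hg'.sub hp.del, fun x hx => ?_⟩, fun x hx => ?_⟩
        · rw [map_sub, del_del, sub_zero, eg' x hx]
        · have := ep x hx
          simp at this ⊢
          linarith
    choose nx hnx using step
    let G : ∀ k, {g : (Fin t → V) → ℚ // AE g ∧ ∀ x ∈ (Y k).car (t + 1), f x = del g x} :=
      fun k => Nat.rec ⟨(hk 0).choose, (hk 0).choose_spec⟩ (fun k g => nx k g) k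
    have hG : ∀ k, ∀ x ∈ (Y k).car t, (G (k + 1)).1 x = (G k).1 x := fun k => hnx k (G k)
    have hG' : ∀ k l, k ≤ l → ∀ x ∈ (Y k).car t, (G l).1 x = (G k).1 x := by
      intro k l hkl x hx
      induction l, hkl using Nat.le_induction with
      | base => rfl
      | succ l hl ih => rw [hG l x (mono hl hx), ih]
    classical
    let g : (Fin t → V) → ℚ := fun x =>
      if hx : ∃ k, x ∈ (Y k).car t then (G hx.choose).1 x else 0
    have hgk : ∀ k, ∀ x ∈ (Y k).car t, g x = (G k).1 x := by
      intro k x hx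
      have hx' : ∃ k, x ∈ (Y k).car t := ⟨k, hx⟩
      simp only [g, dif_pos hx']
      rcases le_total hx'.choose k with h1 | h1
      · exact (hG' _ _ h1 x hx'.choose_spec).symm
      · exact hG' _ _ h1 x hx
    refine ⟨g, ⟨fun σ x => ?_, fun x y hxy => ?_⟩, fun x hx => ?_⟩
    · by_cases hx : ∃ k, x ∈ (Y k).car t
      · obtain ⟨k, hx⟩ := hx
        rw [hgk k x hx, hgk k _ (((Y k).perm σ).2 hx), (G k).2.1.alt]
      · have hx2 : ¬ ∃ k, x ∘ σ ∈ (Y k).car t := by simpa only [Cpx.perm] using hx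
        simp only [g, dif_neg hx, dif_neg hx2, mul_zero]
    · by_cases hx : ∃ k, x ∈ (Y k).car t
      · obtain ⟨k, hx⟩ := hx
        rw [hgk k x hx, hgk k _ (((Y k).sign hxy).2 hx), (G k).2.1.even x y hxy]
      · have hx2 : ¬ ∃ k, y ∈ (Y k).car t := by simpa only [Cpx.sign _ hxy] using hx
        simp only [g, dif_neg hx, dif_neg hx2]
    · obtain ⟨k, hx⟩ := (hZ _ _).1 hx
      rw [(G k).2.2 x hx]
      exact (Y k).del_congr (fun y hy => (hgk k y hy).symm) hx

end Cochains

/-! ### Nerves of closed covers -/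

section Nerve

variable {V E ι : Type*} [AddCommGroup V]

/-- The nerve of the family `U` restricted to `W`. -/
def nerve (U : V → Set E) (hU : ∀ v, U (-v) = U v) (W : Set E) : Cpx V where
  car s := {x | ∃ q ∈ W, ∀ i, q ∈ U (x i)}
  closed := by
    rintro s t x y ⟨q, hq, h⟩ hxy
    refine ⟨q, hq, fun j => ?_⟩
    obtain ⟨i, e | e⟩ := hxy j
    · rw [e]; exact h i
    · rw [e, hU]; exact h i

variable {U : V → Set E} {hU : ∀ v, U (-v) = U v}

theorem mem_nerve {W : Set E} {s : ℕ} {x : Fin s → V} :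
    x ∈ (nerve U hU W).car s ↔ ∃ q ∈ W, ∀ i, q ∈ U (x i) := Iff.rfl

theorem nerve_mono {W W' : Set E} (h : W ⊆ W') : nerve U hU W ≤ nerve U hU W' :=
  fun _ _ ⟨q, hq, hx⟩ => ⟨q, h hq, hx⟩

theorem nerve_union (W W' : Set E) :
    nerve U hU (W ∪ W') = nerve U hU W ⊔ nerve U hU W' := by
  ext s x
  simp only [Cpx.mem_sup, mem_nerve, Set.mem_union, or_and_right, exists_or]

/-- Region cut out by bounds on a family of functions. -/
def hbox (h : ι → E → ℝ) (l u : ι → ℝ) : Set E := {q | ∀ i, l i ≤ h i q ∧ h i q ≤ u i}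

/-- A compact set with a closed cover and a coordinate system in which all the intersections of
members of the cover with boxes have the intermediate value property. -/
structure GoodCover [TopologicalSpace E] (U : V → Set E) (h : ι → E → ℝ) (Z : Set E) : Prop where
  compact : IsCompact Z
  cont : ∀ i, ContinuousOn (h i) Z
  inj : ∀ q ∈ Z, ∀ q' ∈ Z, (∀ i, h i q = h i q') → q = q'
  closed : ∀ v, IsClosed (U v)
  fin : {v | (U v ∩ Z).Nonempty}.Finite
  cover : ∀ q ∈ Z, ∃ v, q ∈ U v
  ivt : ∀ (s : ℕ) (x : Fin s → V) (l u : ι → ℝ) (i : ι) (a : ℝ) (q₁ q₂ : E),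
    q₁ ∈ Z → q₂ ∈ Z → (∀ j, q₁ ∈ U (x j)) → (∀ j, q₂ ∈ U (x j)) → q₁ ∈ hbox h l u →
    q₂ ∈ hbox h l u → h i q₁ ≤ a → a ≤ h i q₂ →
    ∃ q ∈ Z, (∀ j, q ∈ U (x j)) ∧ q ∈ hbox h l u ∧ h i q = a

variable [TopologicalSpace E] [T2Space E] {h : ι → E → ℝ} {Z : Set E}

theorem hbox_inter (l u l' u' : ι → ℝ) :
    hbox h l u ∩ hbox h l' u' = hbox h (l ⊔ l') (u ⊓ u') := by
  ext q
  simp only [hbox, Set.mem_inter_iff, Set.mem_ofPred_eq, Pi.sup_apply, Pi.inf_apply, sup_le_iff,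
    le_inf_iff]
  exact ⟨fun H i => ⟨⟨(H.1 i).1, (H.2 i).1⟩, (H.1 i).2, (H.2 i).2⟩,
    fun H => ⟨fun i => ⟨(H i).1.1, (H i).2.1⟩, fun i => ⟨(H i).1.2, (H i).2.2⟩⟩⟩

theorem GoodCover.continuousOn [Fintype ι] (G : GoodCover U h Z) :
    ContinuousOn (fun q i => h i q) Z := continuousOn_pi.2 G.cont

theorem hbox_eq_preimage (l u : ι → ℝ) : hbox h l u = (fun q i => h i q) ⁻¹' Set.Icc l u := by
  ext q; simp [hbox, Pi.le_def, forall_and]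

theorem GoodCover.inter [Fintype ι] (G : GoodCover U h Z) (l u : ι → ℝ) :
    GoodCover U h (Z ∩ hbox h l u) where
  compact := by
    rw [hbox_eq_preimage]
    exact G.compact.of_isClosed_subset
      (G.continuousOn.preimage_isClosed_of_isClosed G.compact.isClosed isClosed_Icc)
      Set.inter_subset_left
  cont i := (G.cont i).mono Set.inter_subset_left
  inj q hq q' hq' := G.inj q hq.1 q' hq'.1
  closed := G.closed
  fin := G.fin.subset fun v ⟨q, hq⟩ => ⟨q, hq.1, hq.2.1⟩
  cover q hq := G.cover q hq.1
  ivt s x l' u' i a q₁ q₂ h1 h2 hx1 hx2 hb1 hb2 ha1 ha2 := by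
    obtain ⟨q, hq, hx, hb, e⟩ := G.ivt s x (l ⊔ l') (u ⊓ u') i a q₁ q₂ h1.1 h2.1 hx1 hx2
      (by rw [← hbox_inter]; exact ⟨h1.2, hb1⟩) (by rw [← hbox_inter]; exact ⟨h2.2, hb2⟩) ha1 ha2
    rw [← hbox_inter] at hb
    exact ⟨q, ⟨hq, hb.1⟩, hx, hb.2, e⟩

theorem GoodCover.glue [Fintype ι] [DecidableEq ι] (G : GoodCover U h Z) {s : ℕ}
    {f : (Fin s → V) → ℚ}
    (hs : ∀ t, t + 1 = s → ∀ l u, Acyc (nerve U hU (Z ∩ hbox h l u)) t) {l u : ι → ℝ} {i : ι}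
    {a : ℝ} (hla : l i ≤ a) (hau : a ≤ u i)
    (h1 : IsCob (nerve U hU (Z ∩ hbox h l (Function.update u i a))) f)
    (h2 : IsCob (nerve U hU (Z ∩ hbox h (Function.update l i a) u)) f) :
    IsCob (nerve U hU (Z ∩ hbox h l u)) f := by
  have e1 : ∀ q, q ∈ hbox h l (Function.update u i a) ↔ q ∈ hbox h l u ∧ h i q ≤ a := by
    intro q
    simp only [hbox, Set.mem_ofPred_eq]
    constructor
    · intro H
      have hi := (H i).2
      rw [Function.update_self] at hi
      refine ⟨fun j => ⟨(H j).1, ?_⟩, hi⟩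
      have := (H j).2
      rcases eq_or_ne j i with rfl | hj
      · linarith
      · rwa [Function.update_of_ne hj] at this
    · rintro ⟨H, ha⟩ j
      refine ⟨(H j).1, ?_⟩
      rcases eq_or_ne j i with rfl | hj
      · rwa [Function.update_self]
      · rw [Function.update_of_ne hj]; exact (H j).2
  have e2 : ∀ q, q ∈ hbox h (Function.update l i a) u ↔ q ∈ hbox h l u ∧ a ≤ h i q := by
    intro q
    simp only [hbox, Set.mem_ofPred_eq]
    constructor
    · intro H
      have hi := (H i).1
      rw [Function.update_self] at hi
      refine ⟨fun j => ⟨?_, (H j).2⟩, hi⟩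
      have := (H j).1
      rcases eq_or_ne j i with rfl | hj
      · linarith
      · rwa [Function.update_of_ne hj] at this
    · rintro ⟨H, ha⟩ j
      refine ⟨?_, (H j).2⟩
      rcases eq_or_ne j i with rfl | hj
      · rwa [Function.update_self]
      · rw [Function.update_of_ne hj]; exact (H j).1
  have e3 : Z ∩ hbox h l u =
      (Z ∩ hbox h l (Function.update u i a)) ∪ (Z ∩ hbox h (Function.update l i a) u) := by
    ext q
    simp only [Set.mem_union, Set.mem_inter_iff, e1, e2, ← and_or_left, le_total, and_true]
  rw [e3, nerve_union]
  refine SLCoh.glue h1 h2 fun t ht => ?_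
  have e4 : nerve U hU (Z ∩ hbox h l (Function.update u i a)) ⊓
      nerve U hU (Z ∩ hbox h (Function.update l i a) u) =
      nerve U hU (Z ∩ (hbox h l (Function.update u i a) ∩ hbox h (Function.update l i a) u)) := by
    ext s x
    simp only [Cpx.mem_inf, mem_nerve, Set.mem_inter_iff, e1, e2]
    constructor
    · rintro ⟨⟨q₁, ⟨hz1, hb1, ha1⟩, hx1⟩, q₂, ⟨hz2, hb2, ha2⟩, hx2⟩
      obtain ⟨q, hq, hx, hb, e⟩ := G.ivt s x l u i a q₁ q₂ hz1 hz2 hx1 hx2 hb1 hb2 ha1 ha2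
      exact ⟨q, ⟨hq, ⟨hb, e.le⟩, hb, e.ge⟩, hx⟩
    · rintro ⟨q, ⟨hq, h1, h2⟩, hx⟩
      exact ⟨⟨q, ⟨hq, h1⟩, hx⟩, q, ⟨hq, h2⟩, hx⟩
  rw [e4, hbox_inter]
  exact hs t ht _ _

theorem GoodCover.isCob_split [Fintype ι] [DecidableEq ι] (G : GoodCover U h Z) {s : ℕ}
    {f : (Fin s → V) → ℚ}
    (hs : ∀ t, t + 1 = s → ∀ l u, Acyc (nerve U hU (Z ∩ hbox h l u)) t) {a c b : ι → ℝ}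
    (hac : ∀ i, a i < c i) (hcb : ∀ i, c i < b i)
    (H : ∀ S : Set ι, ∀ l u : ι → ℝ, (∀ i ∈ S, l i = c i ∧ u i = b i) →
      (∀ i ∉ S, l i = a i ∧ u i = c i) → IsCob (nerve U hU (Z ∩ hbox h l u)) f)
    (T : Finset ι) : ∀ l u : ι → ℝ, (∀ i ∈ T, l i = a i ∧ u i = b i) →
      (∀ i ∉ T, (l i = c i ∧ u i = b i) ∨ (l i = a i ∧ u i = c i)) →
      IsCob (nerve U hU (Z ∩ hbox h l u)) f := by
  induction T using Finset.induction_on with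
  | empty =>
    intro l u _ h2
    refine H {i | l i = c i} l u (fun i hi => ?_) (fun i hi => ?_)
    · rcases h2 i (by simp) with h | h
      · exact h
      · have := hac i
        simp only [Set.mem_ofPred_eq] at hi
        exfalso; linarith [h.1]
    · exact (h2 i (by simp)).resolve_left fun h => hi h.1
  | insert i T hi ih =>
    intro l u h1 h2
    have hi' := h1 i (Finset.mem_insert_self _ _)
    refine G.glue hs (i := i) (a := c i) (by rw [hi'.1]; exact (hac i).le)
      (by rw [hi'.2]; exact (hcb i).le) (ih _ _ ?_ ?_) (ih _ _ ?_ ?_)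
    · intro j hj
      have hji : j ≠ i := by rintro rfl; exact hi hj
      rw [Function.update_of_ne hji]
      exact h1 j (Finset.mem_insert_of_mem hj)
    · intro j hj
      rcases eq_or_ne j i with rfl | hji
      · right; simp [hi'.1]
      · rw [Function.update_of_ne hji]
        exact h2 j (by simp [hji, hj])
    · intro j hj
      have hji : j ≠ i := by rintro rfl; exact hi hj
      rw [Function.update_of_ne hji]
      exact h1 j (Finset.mem_insert_of_mem hj)
    · intro j hj
      rcases eq_or_ne j i with rfl | hji
      · left; simp [hi'.2]
      · rw [Function.update_of_ne hji]
        exact h2 j (by simp [hji, hj])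

theorem GoodCover.local_cone [Fintype ι] (G : GoodCover U h Z) (z : ι → ℝ) :
    ∃ W ∈ 𝓝 z, ∀ l u : ι → ℝ, z ∈ Set.Icc l u → Set.Icc l u ⊆ W → ∀ s,
      Acyc (nerve U hU (Z ∩ hbox h l u)) s := by
  set Φ : E → ι → ℝ := fun q i => h i q with hΦ
  by_cases hz : z ∈ Φ '' Z
  · obtain ⟨q₀, hq₀, rfl⟩ := hz
    have hc : ∀ v, IsClosed (Φ '' (Z ∩ U v)) := fun v =>
      ((G.compact.inter_right (G.closed v)).image_of_continuousOn
        (G.continuousOn.mono Set.inter_subset_left)).isClosed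
    refine ⟨⋂ v ∈ {v | (U v ∩ Z).Nonempty} ∩ {v | q₀ ∉ U v}, (Φ '' (Z ∩ U v))ᶜ, ?_, ?_⟩
    · rw [Filter.biInter_mem (G.fin.inter_of_left _)]
      rintro v ⟨-, hv⟩
      refine (hc v).isOpen_compl.mem_nhds ?_
      rintro ⟨q, ⟨hq, hqv⟩, e⟩
      have := G.inj q hq q₀ hq₀ (fun i => congrFun e i)
      exact hv (this ▸ hqv)
    · intro l u hzlu hW s
      obtain ⟨v₀, hv₀⟩ := G.cover q₀ hq₀
      refine acyc_of_cone _ v₀ (fun s x hx => ?_) s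
      obtain ⟨q, ⟨hq, hqb⟩, hx⟩ := hx
      refine ⟨q₀, ⟨hq₀, by rw [hbox_eq_preimage]; exact hzlu⟩, fun i => ?_⟩
      refine Fin.cases (by simpa using hv₀) (fun i => ?_) i
      rw [Fin.cons_succ]
      by_contra hcon
      rw [hbox_eq_preimage] at hqb
      have := hW hqb
      simp only [Set.mem_iInter] at this
      exact this (x i) ⟨⟨q, hx i, hq⟩, hcon⟩ ⟨q, ⟨hq, hx i⟩, rfl⟩
  · refine ⟨(Φ '' Z)ᶜ, (G.compact.image_of_continuousOn
      G.continuousOn).isClosed.isOpen_compl.mem_nhds hz, fun l u _ hW s => ?_⟩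
    refine acyc_of_isEmpty _ (fun s => ?_) s
    rw [Set.eq_empty_iff_forall_notMem]
    rintro x ⟨q, ⟨hq, hqb⟩, -⟩
    rw [hbox_eq_preimage] at hqb
    exact hW hqb ⟨q, hq, rfl⟩

/-- The nerve of a good cover is acyclic. -/
theorem GoodCover.acyc [Finite ι] (G : GoodCover U h Z) (s : ℕ) : Acyc (nerve U hU Z) s := by
  classical
  have := Fintype.ofFinite ι
  induction s using Nat.strong_induction_on generalizing Z with
  | _ s ihs =>
  intro f hf hd
  have hs : ∀ t, t + 1 = s → ∀ l u, Acyc (nerve U hU (Z ∩ hbox h l u)) t := fun t ht l u =>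
    ihs t (by omega) (G.inter l u)
  obtain ⟨R, hR, hZR⟩ : ∃ R : ℝ, 0 < R ∧ ∀ q ∈ Z, ∀ i, |h i q| ≤ R := by
    obtain ⟨R, hR⟩ := (G.compact.image_of_continuousOn G.continuousOn).isBounded.exists_norm_le
    refine ⟨max R 1, by positivity, fun q hq i => ?_⟩
    have h1 := hR _ ⟨q, hq, rfl⟩
    have h2 := norm_le_pi_norm (fun i => h i q) i
    rw [Real.norm_eq_abs] at h2
    exact le_trans h2 (le_trans h1 (le_max_left _ _))
  let I : BoxIntegral.Box ι := ⟨fun _ => -R, fun _ => R, fun _ => by linarith⟩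
  have key : IsCob (nerve U hU (Z ∩ hbox h I.lower I.upper)) f := by
    refine BoxIntegral.Box.subbox_induction_on'
      (p := fun J => IsCob (nerve U hU (Z ∩ hbox h J.lower J.upper)) f) I ?_ ?_
    · intro J _ hJ
      refine G.isCob_split hs (a := J.lower) (b := J.upper)
        (c := fun i => (J.lower i + J.upper i) / 2)
        (fun i => by have := J.lower_lt_upper i; linarith)
        (fun i => by have := J.lower_lt_upper i; linarith) ?_ Finset.univ _ _
        (fun i _ => ⟨rfl, rfl⟩) (fun i hi => absurd (Finset.mem_univ i) hi)
      intro S l u h1 h2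
      convert hJ S using 3
      congr 1
      · ext i
        by_cases hi : i ∈ S
        · simp [BoxIntegral.Box.splitCenterBox, h1 i hi, Set.piecewise, hi]
        · simp [BoxIntegral.Box.splitCenterBox, h2 i hi, Set.piecewise, hi]
      · ext i
        by_cases hi : i ∈ S
        · simp [BoxIntegral.Box.splitCenterBox, h1 i hi, Set.piecewise, hi]
        · simp [BoxIntegral.Box.splitCenterBox, h2 i hi, Set.piecewise, hi]
    · intro z _
      obtain ⟨W, hW, hc⟩ := G.local_cone (hU := hU) z
      refine ⟨W, mem_nhdsWithin_of_mem_nhds hW, fun J _ _ hzJ hJW _ => ?_⟩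
      refine hc _ _ hzJ hJW s f hf fun x hx => hd x ?_
      exact nerve_mono Set.inter_subset_left _ hx
  convert key using 2
  refine (Set.inter_eq_left.2 fun q hq i => ?_).symm
  exact abs_le.1 (hZR q hq i)

end Nerve

/-! ### Quadratic forms on integer vectors -/

section Forms

variable {n : ℕ}

/-- Integer vectors. -/
abbrev Vec (n : ℕ) := Fin n → ℤ

/-- Real quadratic forms, by their coefficients. -/
abbrev Form (n : ℕ) := Sym2 (Fin n) → ℝ

/-- Polar form. -/
def qb (q : Form n) (v w : Vec n) : ℝ := ∑ i, ∑ j, q s(i, j) * (v i * w j)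

/-- Value of a form. -/
def qv (q : Form n) (v : Vec n) : ℝ := ∑ i, ∑ j, q s(i, j) * (v i * v j)

/-- Trace of a form. -/
def tr (q : Form n) : ℝ := ∑ i, q s(i, i)

theorem qb_self (q : Form n) (v : Vec n) : qb q v v = qv q v := rfl

theorem qv_add (q q' : Form n) (v : Vec n) : qv (q + q') v = qv q v + qv q' v := by
  simp [qv, add_mul, Finset.sum_add_distrib]

theorem qv_smul (c : ℝ) (q : Form n) (v : Vec n) : qv (c • q) v = c * qv q v := by
  simp [qv, Finset.mul_sum, mul_assoc]

theorem qv_zero_form (v : Vec n) : qv (0 : Form n) v = 0 := by simp [qv]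

theorem qv_sum {ι : Type*} (S : Finset ι) (q : ι → Form n) (v : Vec n) :
    qv (∑ k ∈ S, q k) v = ∑ k ∈ S, qv (q k) v := by
  classical
  induction S using Finset.induction_on with
  | empty => simp [qv_zero_form]
  | insert a S ha ih => rw [Finset.sum_insert ha, Finset.sum_insert ha, qv_add, ih]

theorem tr_add (q q' : Form n) : tr (q + q') = tr q + tr q' := by
  simp [tr, Finset.sum_add_distrib]

theorem tr_smul (c : ℝ) (q : Form n) : tr (c • q) = c * tr q := by
  simp [tr, Finset.mul_sum]

theorem qv_zsmul (q : Form n) (k : ℤ) (v : Vec n) : qv q (k • v) = k ^ 2 * qv q v := by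
  simp only [qv, Finset.mul_sum, Pi.smul_apply, smul_eq_mul]
  refine Finset.sum_congr rfl fun i _ => Finset.sum_congr rfl fun j _ => ?_
  push_cast; ring

theorem qv_zero (q : Form n) : qv q 0 = 0 := by simp [qv]

theorem qv_neg (q : Form n) (v : Vec n) : qv q (-v) = qv q v := by simp [qv]

theorem qv_parallelogram (q : Form n) (v w : Vec n) :
    qv q (v + w) + qv q (v - w) = 2 * qv q v + 2 * qv q w := by
  simp only [qv, Finset.mul_sum, ← Finset.sum_add_distrib, Pi.add_apply, Pi.sub_apply]
  refine Finset.sum_congr rfl fun i _ => Finset.sum_congr rfl fun j _ => ?_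
  push_cast; ring

theorem qv_single (q : Form n) (i : Fin n) : qv q (Pi.single i 1) = q s(i, i) := by
  simp only [qv]
  rw [Finset.sum_eq_single i (by intro b _ hb; simp [hb]) (by simp),
    Finset.sum_eq_single i (by intro b _ hb; simp [hb]) (by simp)]
  simp

theorem qb_comm (q : Form n) (v w : Vec n) : qb q v w = qb q w v := by
  rw [qb, qb, Finset.sum_comm]
  refine Finset.sum_congr rfl fun i _ => Finset.sum_congr rfl fun j _ => ?_
  rw [Sym2.eq_swap, mul_comm (v j : ℝ)]

theorem qb_single (q : Form n) (i j : Fin n) :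
    qb q (Pi.single i 1) (Pi.single j 1) = q s(i, j) := by
  simp only [qb]
  rw [Finset.sum_eq_single i (by intro b _ hb; simp [hb]) (by simp),
    Finset.sum_eq_single j (by intro b _ hb; simp [hb]) (by simp)]
  simp

theorem qb_add_right (q : Form n) (v w w' : Vec n) : qb q v (w + w') = qb q v w + qb q v w' := by
  simp only [qb, ← Finset.sum_add_distrib, Pi.add_apply]
  refine Finset.sum_congr rfl fun i _ => Finset.sum_congr rfl fun j _ => ?_
  push_cast; ring

theorem qb_zsmul_right (q : Form n) (k : ℤ) (v w : Vec n) : qb q v (k • w) = k * qb q v w := by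
  simp only [qb, Finset.mul_sum, Pi.smul_apply, smul_eq_mul]
  refine Finset.sum_congr rfl fun i _ => Finset.sum_congr rfl fun j _ => ?_
  push_cast; ring

theorem qb_sum_right {ι : Type*} (S : Finset ι) (q : Form n) (v : Vec n) (w : ι → Vec n) :
    qb q v (∑ k ∈ S, w k) = ∑ k ∈ S, qb q v (w k) := by
  classical
  induction S using Finset.induction_on with
  | empty => simp [qb]
  | insert a S ha ih => rw [Finset.sum_insert ha, Finset.sum_insert ha, qb_add_right, ih]

theorem qv_add_vec (q : Form n) (v w : Vec n) :
    qv q (v + w) = qv q v + 2 * qb q v w + qv q w := by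
  have h1 : qb q (v + w) (v + w) = qb q (v + w) v + qb q (v + w) w := qb_add_right _ _ _ _
  have h2 := qb_comm q (v + w) v
  have h3 := qb_comm q (v + w) w
  have h4 := qb_add_right q v v w
  have h5 := qb_add_right q w v w
  have h6 := qb_comm q w v
  rw [← qb_self, ← qb_self, ← qb_self]
  linarith

/-- Square of a linear functional. -/
def sqf (ξ : Vec n) : Form n := Sym2.lift ⟨fun i j => (ξ i : ℝ) * ξ j, fun i j => mul_comm _ _⟩

theorem qv_sqf (ξ v : Vec n) : qv (sqf ξ) v = ((∑ i, ξ i * v i : ℤ) : ℝ) ^ 2 := by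
  push_cast
  rw [sq, Finset.sum_mul_sum]
  simp only [qv, sqf, Sym2.lift_mk]
  refine Finset.sum_congr rfl fun i _ => Finset.sum_congr rfl fun j _ => ?_
  ring

theorem tr_sqf (ξ : Vec n) : tr (sqf ξ) = ∑ i, (ξ i : ℝ) ^ 2 := by
  simp only [tr, sqf, Sym2.lift_mk]
  exact Finset.sum_congr rfl fun i _ => (sq _).symm

/-- Pullback of a form under an integer matrix. -/
def pullback (A : Matrix (Fin n) (Fin n) ℤ) (q : Form n) : Form n :=
  Sym2.lift ⟨fun i j => qb q (fun k => A k i) (fun k => A k j), fun i j => qb_comm _ _ _⟩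

theorem qv_pullback (A : Matrix (Fin n) (Fin n) ℤ) (q : Form n) (v : Vec n) :
    qv (pullback A q) v = qv q (A.mulVec v) := by
  have e : A.mulVec v = ∑ j, v j • (fun k => A k j) := by
    ext k; simp [Matrix.mulVec, dotProduct, mul_comm]
  rw [← qb_self q, e, qb_sum_right]
  simp only [qb_zsmul_right]
  rw [qv]
  rw [Finset.sum_comm]
  refine Finset.sum_congr rfl fun i _ => ?_
  rw [qb_comm, qb_sum_right, Finset.mul_sum]
  refine Finset.sum_congr rfl fun j _ => ?_
  rw [qb_zsmul_right, pullback, Sym2.lift_mk]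
  simp only
  rw [qb_comm q (fun k => A k i)]
  ring

theorem continuous_qv (v : Vec n) : Continuous fun q : Form n => qv q v := by
  unfold qv; fun_prop

theorem continuous_tr : Continuous fun q : Form n => tr q := by
  unfold tr; fun_prop

theorem sum_sq_single_ne (u : Vec n) (hu : u ≠ 0) : (1 : ℝ) ≤ ∑ i, (u i : ℝ) ^ 2 := by
  obtain ⟨i, hi⟩ := Function.ne_iff.1 hu
  have h1 : (1 : ℝ) ≤ (u i : ℝ) ^ 2 := by
    have : (1 : ℤ) ≤ (u i) ^ 2 := by
      have := sq_nonneg (u i); have h3 : (u i) ^ 2 ≠ 0 := pow_ne_zero _ hi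
      omega
    exact_mod_cast this
  exact h1.trans (Finset.single_le_sum (f := fun i => (u i : ℝ) ^ 2) (fun _ _ => sq_nonneg _)
    (Finset.mem_univ i))

/-- Trace one forms bounded below by `ε` on nonzero integer vectors. -/
def GE (n : ℕ) (ε : ℝ) : Set (Form n) := {q | tr q = 1 ∧ ∀ u : Vec n, u ≠ 0 → ε ≤ qv q u}

/-- Trace one forms bounded below on nonzero integer vectors. -/
def X1 (n : ℕ) : Set (Form n) := {q | ∃ ε > 0, q ∈ GE n ε}

theorem GE_anti {ε ε' : ℝ} (h : ε ≤ ε') : GE n ε' ⊆ GE n ε :=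
  fun _ hq => ⟨hq.1, fun u hu => h.trans (hq.2 u hu)⟩

theorem GE_subset_X1 {ε : ℝ} (h : 0 < ε) : GE n ε ⊆ X1 n := fun _ hq => ⟨ε, h, hq⟩

theorem isClosed_GE (ε : ℝ) : IsClosed (GE n ε) := by
  have : GE n ε = {q | tr q = 1} ∩ ⋂ u : Vec n, ⋂ _ : u ≠ 0, {q | ε ≤ qv q u} := by
    ext q; simp [GE]
  rw [this]
  refine (isClosed_eq continuous_tr continuous_const).inter ?_
  exact isClosed_iInter fun u => isClosed_iInter fun _ =>
    isClosed_le continuous_const (continuous_qv u)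

theorem X1.pos {q : Form n} (hq : q ∈ X1 n) {u : Vec n} (hu : u ≠ 0) : 0 < qv q u := by
  obtain ⟨ε, hε, h⟩ := hq
  exact hε.trans_le (h.2 u hu)

theorem X1.nonneg {q : Form n} (hq : q ∈ X1 n) (u : Vec n) : 0 ≤ qv q u := by
  rcases eq_or_ne u 0 with rfl | hu
  · rw [qv_zero]
  · exact (X1.pos hq hu).le

theorem X1.qv_add_le {q : Form n} (hq : q ∈ X1 n) (u v : Vec n) :
    qv q (u + v) ≤ 2 * qv q u + 2 * qv q v := by
  have := qv_parallelogram q u v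
  linarith [X1.nonneg hq (u - v)]

theorem X1.qv_sum_le {q : Form n} (hq : q ∈ X1 n) {ι : Type*} (S : Finset ι) (y : ι → Vec n) :
    qv q (∑ k ∈ S, y k) ≤ 2 ^ S.card * ∑ k ∈ S, qv q (y k) := by
  classical
  induction S using Finset.induction_on with
  | empty => simp [qv_zero]
  | insert a S ha ih =>
    rw [Finset.sum_insert ha, Finset.sum_insert ha, Finset.card_insert_of_notMem ha, pow_succ]
    have h1 := X1.qv_add_le hq (y a) (∑ k ∈ S, y k)
    have h2 : (1 : ℝ) ≤ 2 ^ S.card := one_le_pow₀ (by norm_num)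
    have h3 := X1.nonneg hq (y a)
    have h4 : qv q (y a) ≤ 2 ^ S.card * qv q (y a) := by nlinarith
    linarith

theorem X1.diag_le {q : Form n} (hq : q ∈ X1 n) (i : Fin n) : q s(i, i) ≤ 1 := by
  obtain ⟨ε, hε, h⟩ := hq
  rw [← h.1, tr]
  refine Finset.single_le_sum (f := fun i => q s(i, i)) (fun j _ => ?_) (Finset.mem_univ i)
  rw [← qv_single q j]
  exact X1.nonneg ⟨ε, hε, h⟩ _

theorem X1.entry_le {q : Form n} (hq : q ∈ X1 n) (z : Sym2 (Fin n)) : |q z| ≤ 1 := by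
  induction z using Sym2.ind with
  | _ i j =>
  have h1 := qv_add_vec q (Pi.single i 1) (Pi.single j 1)
  have h2 := qv_parallelogram q (Pi.single i 1) (Pi.single j 1)
  have h3 := X1.nonneg hq (Pi.single i 1 + Pi.single j 1)
  have h4 := X1.nonneg hq (Pi.single i 1 - Pi.single j 1)
  rw [qb_single, qv_single, qv_single] at h1
  rw [qv_single, qv_single] at h2
  have h5 := X1.diag_le hq i
  have h6 := X1.diag_le hq j
  rw [abs_le]
  constructor <;> linarith

theorem isCompact_GE {ε : ℝ} (hε : 0 < ε) : IsCompact (GE n ε) := by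
  refine (isCompact_closedBall (0 : Form n) 1).of_isClosed_subset (isClosed_GE ε) fun q hq => ?_
  rw [mem_closedBall_zero_iff, pi_norm_le_iff_of_nonneg zero_le_one]
  exact fun z => X1.entry_le ⟨ε, hε, hq⟩ z

theorem convex_GE (ε : ℝ) : Convex ℝ (GE n ε) := by
  intro q hq q' hq' a b ha hb hab
  refine ⟨by rw [tr_add, tr_smul, tr_smul, hq.1, hq'.1]; linarith, fun u hu => ?_⟩
  rw [qv_add, qv_smul, qv_smul]
  have h1 := hq.2 u hu
  have h2 := hq'.2 u hu
  have e : ε = a * ε + b * ε := by rw [← add_mul, hab, one_mul]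
  rw [e]
  gcongr

theorem X1.qv_le {q : Form n} (hq : q ∈ X1 n) (v : Vec n) (R : ℝ) (hR : ∀ i, |(v i : ℝ)| ≤ R) :
    qv q v ≤ n ^ 2 * R ^ 2 := by
  have h1 : ∀ i j : Fin n, q s(i, j) * (v i * v j) ≤ R ^ 2 := fun i j => by
    have hR0 : 0 ≤ R := (abs_nonneg _).trans (hR i)
    calc q s(i, j) * (v i * v j) ≤ |q s(i, j) * (v i * v j)| := le_abs_self _
      _ = |q s(i, j)| * (|(v i : ℝ)| * |(v j : ℝ)|) := by rw [abs_mul, abs_mul]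
      _ ≤ 1 * (R * R) := by
        gcongr
        · exact X1.entry_le hq _
        · exact hR i
        · exact hR j
      _ = R ^ 2 := by ring
  calc qv q v ≤ ∑ i : Fin n, ∑ j : Fin n, R ^ 2 :=
        Finset.sum_le_sum fun i _ => Finset.sum_le_sum fun j _ => h1 i j
    _ = n ^ 2 * R ^ 2 := by simp; ring

/-- Forms bounded below on nonzero integer vectors are uniformly positive definite. -/
theorem exists_pos_lower_bound (n : ℕ) {ε : ℝ} (hε : 0 < ε) :
    ∃ δ > 0, ∀ q ∈ GE n ε, ∀ (u : Vec n) (i : Fin n), δ * (u i : ℝ) ^ 2 ≤ qv q u := by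
  obtain ⟨Q, hQ⟩ := exists_nat_gt (2 * n ^ 2 * 2 / ε + 1)
  have hQ1 : (1 : ℝ) < Q := lt_of_le_of_lt (by have : 0 ≤ 2 * (n : ℝ) ^ 2 * 2 / ε := by positivity
                                               linarith) hQ
  have hQ0 : (0 : ℝ) < Q := by linarith
  have hQn : 0 < Q := by exact_mod_cast hQ0
  set N : ℕ := Q ^ n with hN
  have hN0 : (0 : ℝ) < N := by rw [hN]; positivity
  refine ⟨ε / (4 * N ^ 2), by positivity, fun q hq u i₁ => ?_⟩
  have hqX : q ∈ X1 n := ⟨ε, hε, hq⟩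
  obtain ⟨i₀, -, hi₀⟩ := Finset.exists_max_image Finset.univ (fun i => |u i|)
    ⟨i₁, Finset.mem_univ _⟩
  set H : ℤ := |u i₀| with hH
  have hHu : ∀ i, |u i| ≤ H := fun i => hi₀ i (Finset.mem_univ i)
  rcases (abs_nonneg (u i₀)).eq_or_lt with h0 | hHpos
  · have : u i₁ = 0 := by
      have := hHu i₁
      rw [hH, ← h0] at this
      exact abs_nonpos_iff.1 this
    rw [this]; simp [X1.nonneg hqX u]
  rw [← hH] at hHpos
  have hHR : (0 : ℝ) < H := by exact_mod_cast hHpos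
  -- pigeonhole on the multiples of `u` modulo `H`
  have hbound : ∀ (k : ℕ) (i : Fin n), ((Q : ℤ) * ((k * u i) % H) / H).toNat < Q := by
    intro k i
    have h1 := Int.emod_nonneg (k * u i) hHpos.ne'
    have h2 := Int.emod_lt_of_pos (k * u i) hHpos
    have h3 : (Q : ℤ) * ((k * u i) % H) / H < Q := by
      apply Int.ediv_lt_of_lt_mul hHpos
      have : (0 : ℤ) < Q := by exact_mod_cast hQn
      exact mul_lt_mul_of_pos_left h2 this
    omega
  let φ : Fin (N + 1) → (Fin n → Fin Q) := fun k i => ⟨_, hbound k i⟩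
  obtain ⟨k, k', hkk, hφ⟩ := Fintype.exists_ne_map_eq_of_card_lt φ (by simp [hN])
  wlog hlt : k < k' generalizing k k'
  · exact this k' k hkk.symm hφ.symm (lt_of_le_of_ne (not_lt.1 hlt) hkk.symm)
  set d : ℤ := (k' : ℕ) - (k : ℕ) with hd
  have hd0 : 0 < d := by have : (k : ℕ) < k' := hlt; omega
  have hdN : d ≤ N := by have := k'.2; omega
  set w : Vec n := fun i => (k' : ℕ) * u i % H - (k : ℕ) * u i % H with hw
  set b : Vec n := fun i => (k' : ℕ) * u i / H - (k : ℕ) * u i / H with hb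
  have hdu : ∀ i, d * u i = w i + H * b i := by
    intro i
    have h1 := Int.emod_add_mul_ediv ((k' : ℕ) * u i) H
    have h2 := Int.emod_add_mul_ediv ((k : ℕ) * u i) H
    simp only [hw, hb, hd]
    linear_combination h2 - h1
  have hwb : ∀ i, |(w i : ℝ)| ≤ H / Q := by
    intro i
    have e : ((Q : ℤ) * (((k : ℕ) * u i) % H) / H).toNat =
        ((Q : ℤ) * (((k' : ℕ) * u i) % H) / H).toNat := congrArg Fin.val (congrFun hφ i)
    have n1 : 0 ≤ (Q : ℤ) * (((k : ℕ) * u i) % H) / H := Int.ediv_nonneg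
      (mul_nonneg (by positivity) (Int.emod_nonneg _ hHpos.ne')) hHpos.le
    have n2 : 0 ≤ (Q : ℤ) * (((k' : ℕ) * u i) % H) / H := Int.ediv_nonneg
      (mul_nonneg (by positivity) (Int.emod_nonneg _ hHpos.ne')) hHpos.le
    have e' : (Q : ℤ) * (((k : ℕ) * u i) % H) / H = (Q : ℤ) * (((k' : ℕ) * u i) % H) / H := by
      omega
    have a1 := Int.emod_add_mul_ediv ((Q : ℤ) * (((k : ℕ) * u i) % H)) H
    have a2 := Int.emod_add_mul_ediv ((Q : ℤ) * (((k' : ℕ) * u i) % H)) H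
    rw [e'] at a1
    have b1 := Int.emod_nonneg ((Q : ℤ) * (((k : ℕ) * u i) % H)) hHpos.ne'
    have b2 := Int.emod_nonneg ((Q : ℤ) * (((k' : ℕ) * u i) % H)) hHpos.ne'
    have c1 := Int.emod_lt_of_pos ((Q : ℤ) * (((k : ℕ) * u i) % H)) hHpos
    have c2 := Int.emod_lt_of_pos ((Q : ℤ) * (((k' : ℕ) * u i) % H)) hHpos
    have : |(Q : ℤ) * w i| ≤ H := by
      have : (Q : ℤ) * w i =
          (Q : ℤ) * (((k' : ℕ) * u i) % H) - (Q : ℤ) * (((k : ℕ) * u i) % H) := by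
        simp only [hw]; ring
      rw [this, abs_le]; constructor <;> linarith
    rw [abs_mul, Nat.abs_cast] at this
    rw [le_div_iff₀ hQ0]
    have h3 : ((Q : ℝ) * |(w i : ℝ)|) ≤ H := by exact_mod_cast this
    linarith
  have hb0 : b ≠ 0 := by
    intro hb0
    have h1 := hdu i₀
    rw [hb0] at h1
    have h2 := hwb i₀
    have h3 : |d * u i₀| = d * H := by rw [abs_mul, abs_of_pos hd0]
    have h4 : |(w i₀ : ℝ)| = d * H := by
      have : w i₀ = d * u i₀ := by rw [h1]; simp
      rw [this]; exact_mod_cast h3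
    rw [h4, le_div_iff₀ hQ0] at h2
    have h5 : (1 : ℝ) ≤ d := by exact_mod_cast hd0
    nlinarith [mul_pos hHR hQ0, mul_le_mul_of_nonneg_right h5 (mul_pos hHR hQ0).le,
      mul_lt_mul_of_pos_left hQ1 hHR]
  have hHb : H • b = d • u + (-w) := by
    ext i; have := hdu i; simp; linarith
  have h1 := X1.qv_add_le hqX (d • u) (-w)
  rw [← hHb, qv_zsmul, qv_zsmul, qv_neg] at h1
  have h2 := X1.qv_le hqX w _ hwb
  have h3 := hq.2 b hb0
  have h4 : (n : ℝ) ^ 2 * (H / Q) ^ 2 ≤ ε / 4 * H ^ 2 := by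
    rw [div_pow, mul_div_assoc', div_le_iff₀ (by positivity)]
    have h5 : 2 * (n : ℝ) ^ 2 * 2 ≤ ε * Q := by
      have : 2 * (n : ℝ) ^ 2 * 2 / ε < Q := by linarith
      rw [div_lt_iff₀ hε] at this
      linarith
    have h6 : ε * Q ≤ ε * Q ^ 2 := by nlinarith
    have h7 : (0 : ℝ) ≤ (H : ℝ) ^ 2 := by positivity
    nlinarith
  have h5 : (d : ℝ) ^ 2 ≤ N ^ 2 := by
    have a : (d : ℝ) ≤ N := by exact_mod_cast hdN
    have b : (0 : ℝ) < d := by exact_mod_cast hd0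
    nlinarith
  have h6 : (H : ℝ) ^ 2 * ε ≤ H ^ 2 * qv q b := by gcongr
  have h7 : (d : ℝ) ^ 2 * qv q u ≤ N ^ 2 * qv q u := by
    have := X1.nonneg hqX u; gcongr
  have h8 : (u i₁ : ℝ) ^ 2 ≤ H ^ 2 := by
    rw [← sq_abs]
    have : |(u i₁ : ℝ)| ≤ H := by exact_mod_cast hHu i₁
    gcongr
  have h9 : ε * H ^ 2 ≤ 4 * N ^ 2 * qv q u := by nlinarith
  calc ε / (4 * N ^ 2) * (u i₁ : ℝ) ^ 2 ≤ ε / (4 * N ^ 2) * H ^ 2 := by gcongr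
    _ ≤ qv q u := by rw [div_mul_eq_mul_div, div_le_iff₀ (by positivity)]; linarith

theorem finite_of_bounded (R : ℝ) : {v : Vec n | ∀ i, (v i : ℝ) ^ 2 ≤ R}.Finite := by
  obtain ⟨M, hM⟩ := exists_nat_gt (max R 1)
  refine (Set.finite_Icc (fun _ : Fin n => -(M : ℤ)) (fun _ => (M : ℤ))).subset fun v hv => ?_
  have h : ∀ i, |v i| ≤ M := by
    intro i
    have h1 := hv i
    have h2 : R < M := (le_max_left _ _).trans_lt hM
    have h3 : (1 : ℝ) < M := (le_max_right _ _).trans_lt hM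
    by_contra hc
    push Not at hc
    have h4 : (M : ℝ) < |(v i : ℝ)| := by exact_mod_cast hc
    rw [← sq_abs] at h1
    nlinarith
  exact ⟨fun i => (abs_le.1 (h i)).1, fun i => (abs_le.1 (h i)).2⟩

theorem finite_qv_le {ε : ℝ} (hε : 0 < ε) (C : ℝ) :
    {v : Vec n | ∃ q ∈ GE n ε, qv q v ≤ C}.Finite := by
  obtain ⟨δ, hδ, h⟩ := exists_pos_lower_bound n hε
  refine (finite_of_bounded (C / δ)).subset ?_
  rintro v ⟨q, hq, hv⟩ i
  rw [le_div_iff₀ hδ]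
  linarith [h q hq v i]

end Forms

/-! ### Minimal vectors -/

section Minimal

variable {n : ℕ}

/-- The rational vector of an integer vector. -/
def toQ (v : Vec n) : Fin n → ℚ := fun i => v i

theorem toQ_neg (v : Vec n) : toQ (-v) = -toQ v := by ext i; simp [toQ]

theorem toQ_smul (k : ℤ) (v : Vec n) : toQ (k • v) = (k : ℚ) • toQ v := by ext i; simp [toQ]

theorem toQ_sum {ι : Type*} (S : Finset ι) (v : ι → Vec n) :
    toQ (∑ k ∈ S, v k) = ∑ k ∈ S, toQ (v k) := by ext i; simp [toQ]

theorem toQ_injective : Function.Injective (toQ : Vec n → Fin n → ℚ) := fun v w h => by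
  ext i; have := congrFun h i; simpa [toQ] using this

theorem toQ_eq_zero {v : Vec n} : toQ v = 0 ↔ v = 0 :=
  ⟨fun h => toQ_injective (by rw [h]; ext i; simp [toQ]), fun h => by rw [h]; ext i; simp [toQ]⟩

theorem toQ_zero : toQ (0 : Vec n) = 0 := toQ_eq_zero.2 rfl

theorem exists_common_denom {ι : Type*} [Finite ι] (c : ι → ℚ) :
    ∃ d : ℤ, 0 < d ∧ ∃ a : ι → ℤ, ∀ i, (a i : ℚ) = d * c i := by
  classical
  have := Fintype.ofFinite ι
  refine ⟨∏ i, ((c i).den : ℤ), Finset.prod_pos fun i _ => by exact_mod_cast (c i).den_pos,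
    fun i => (c i).num * ∏ j ∈ Finset.univ.erase i, ((c j).den : ℤ), fun i => ?_⟩
  rw [← Finset.mul_prod_erase _ _ (Finset.mem_univ i)]
  push_cast
  have := Rat.mul_den_eq_num (c i)
  rw [← this]; ring

theorem exists_int_vec (y : Fin n → ℚ) : ∃ d : ℤ, 0 < d ∧ ∃ v : Vec n, toQ v = (d : ℚ) • y := by
  obtain ⟨d, hd, a, ha⟩ := exists_common_denom y
  exact ⟨d, hd, a, by ext i; simp [toQ, ha]⟩

variable (L : Submodule ℚ (Fin n → ℚ))

/-- The forms for which `v` is a minimal vector among nonzero integer vectors in `L`. -/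
def Um (v : Vec n) : Set (Form n) :=
  {q | v ≠ 0 ∧ toQ v ∈ L ∧ ∀ u : Vec n, u ≠ 0 → toQ u ∈ L → qv q v ≤ qv q u}

theorem Um_neg (v : Vec n) : Um L (-v) = Um L v := by
  ext q
  simp only [Um, Set.mem_ofPred_eq, qv_neg, toQ_neg, neg_ne_zero, neg_mem_iff]

theorem isClosed_Um (v : Vec n) : IsClosed (Um L v) := by
  have : Um L v = {q | v ≠ 0 ∧ toQ v ∈ L} ∩ ⋂ u : Vec n, ⋂ _ : u ≠ 0, ⋂ _ : toQ u ∈ L,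
      {q | qv q v ≤ qv q u} := by
    ext q; simp [Um, and_assoc]
  rw [this]
  refine isClosed_const.inter ?_
  exact isClosed_iInter fun u => isClosed_iInter fun _ => isClosed_iInter fun _ =>
    isClosed_le (continuous_qv v) (continuous_qv u)

theorem convex_Um (v : Vec n) : Convex ℝ (Um L v) := by
  intro q hq q' hq' a b ha hb _
  refine ⟨hq.1, hq.2.1, fun u hu huL => ?_⟩
  rw [qv_add, qv_smul, qv_smul, qv_add, qv_smul, qv_smul]
  have h1 := hq.2.2 u hu huL
  have h2 := hq'.2.2 u hu huL
  gcongr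

theorem Um_smul {v : Vec n} {q : Form n} (hq : q ∈ Um L v) {c : ℝ} (hc : 0 ≤ c) :
    c • q ∈ Um L v := by
  refine ⟨hq.1, hq.2.1, fun u hu huL => ?_⟩
  rw [qv_smul, qv_smul]
  have := hq.2.2 u hu huL
  gcongr

variable {L}

theorem exists_mem_Um (hL : ∃ u : Vec n, u ≠ 0 ∧ toQ u ∈ L) {q : Form n} (hq : q ∈ X1 n) :
    ∃ v, q ∈ Um L v := by
  obtain ⟨u₀, hu₀, hu₀L⟩ := hL
  obtain ⟨ε, hε, hq⟩ := hq
  have hfin : {v : Vec n | (v ≠ 0 ∧ toQ v ∈ L) ∧ qv q v ≤ qv q u₀}.Finite :=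
    (finite_qv_le (n := n) hε (qv q u₀)).subset fun v hv => ⟨q, hq, hv.2⟩
  obtain ⟨v, hv, hmin⟩ := Set.exists_min_image _ (fun v => qv q v) hfin ⟨u₀, ⟨hu₀, hu₀L⟩, le_rfl⟩
  refine ⟨v, hv.1.1, hv.1.2, fun u hu huL => ?_⟩
  rcases le_total (qv q u) (qv q u₀) with h | h
  · exact hmin u ⟨⟨hu, huL⟩, h⟩
  · exact hv.2.trans h

theorem finite_Um_inter {ε : ℝ} (hε : 0 < ε) : {v | (Um L v ∩ GE n ε).Nonempty}.Finite := by
  by_cases hL : ∃ u : Vec n, u ≠ 0 ∧ toQ u ∈ L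
  · obtain ⟨u₀, hu₀, hu₀L⟩ := hL
    obtain ⟨R, hR⟩ := (Set.finite_range fun i => |(u₀ i : ℝ)|).bddAbove
    refine (finite_qv_le hε (n ^ 2 * R ^ 2)).subset ?_
    rintro v ⟨q, hqv, hq⟩
    exact ⟨q, hq, (hqv.2.2 u₀ hu₀ hu₀L).trans
      (X1.qv_le ⟨ε, hε, hq⟩ u₀ R fun i => hR ⟨i, rfl⟩)⟩
  · convert Set.finite_empty
    ext v
    simp only [Set.mem_ofPred_eq, Set.mem_empty_iff_false, iff_false]
    rintro ⟨q, hqv, -⟩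
    exact hL ⟨v, hqv.1, hqv.2.1⟩

theorem convex_hbox_eval (l u : Sym2 (Fin n) → ℝ) :
    Convex ℝ (hbox (fun z (q : Form n) => q z) l u) := by
  have : hbox (fun z (q : Form n) => q z) l u = Set.Icc l u := by
    ext q; simp [hbox, Pi.le_def, forall_and]
  rw [this]; exact convex_Icc l u

theorem goodCover_GE (hL : ∃ u : Vec n, u ≠ 0 ∧ toQ u ∈ L) {ε : ℝ} (hε : 0 < ε) :
    GoodCover (Um L) (fun z (q : Form n) => q z) (GE n ε) where
  compact := isCompact_GE hε
  cont z := (continuous_apply z).continuousOn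
  inj q _ q' _ h := funext h
  closed := isClosed_Um L
  fin := finite_Um_inter hε
  cover q hq := exists_mem_Um hL ⟨ε, hε, hq⟩
  ivt s x l u z a q₁ q₂ h1 h2 hx1 hx2 hb1 hb2 ha1 ha2 := by
    have hc : Convex ℝ (GE n ε ∩ (⋂ j, Um L (x j)) ∩ hbox (fun z (q : Form n) => q z) l u) :=
      ((convex_GE ε).inter (convex_iInter fun j => convex_Um L (x j))).inter (convex_hbox_eval l u)
    obtain ⟨q, ⟨⟨hq, hx⟩, hb⟩, e⟩ := hc.isPreconnected.intermediate_value
      (f := fun q : Form n => q z)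
      ⟨⟨h1, Set.mem_iInter.2 hx1⟩, hb1⟩ ⟨⟨h2, Set.mem_iInter.2 hx2⟩, hb2⟩
      (continuous_apply z).continuousOn ⟨ha1, ha2⟩
    exact ⟨q, hq, Set.mem_iInter.1 hx, hb, e⟩

variable (L) in
/-- Tuples of vectors which are simultaneously minimal in `L` for some form. -/
def KL : Cpx (Vec n) := nerve (Um L) (Um_neg L) (X1 n)

theorem acyc_nerve_GE (hL : ∃ u : Vec n, u ≠ 0 ∧ toQ u ∈ L) {ε : ℝ} (hε : 0 < ε) (s : ℕ) :
    Acyc (nerve (Um L) (Um_neg L) (GE n ε)) s := (goodCover_GE hL hε).acyc s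

theorem acyc_KL (hL : ∃ u : Vec n, u ≠ 0 ∧ toQ u ∈ L) (s : ℕ) : Acyc (KL L) s := by
  refine acyc_iUnion (fun k => nerve (Um L) (Um_neg L) (GE n (1 / (k + 1)))) (fun k => ?_) _
    (fun s x => ?_) (fun k s => acyc_nerve_GE hL (by positivity) s) s
  · refine nerve_mono (GE_anti ?_)
    push_cast
    gcongr
    linarith
  · constructor
    · rintro ⟨q, ⟨ε, hε, hq⟩, hx⟩
      obtain ⟨k, hk⟩ := exists_nat_one_div_lt hε
      exact ⟨k, q, GE_anti hk.le hq, hx⟩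
    · rintro ⟨k, q, hq, hx⟩
      exact ⟨q, GE_subset_X1 (by positivity) hq, hx⟩

theorem normalize [NeZero n] {q : Form n} {ε : ℝ} (hε : 0 < ε)
    (h : ∀ u : Vec n, u ≠ 0 → ε ≤ qv q u) : 0 < tr q ∧ (tr q)⁻¹ • q ∈ X1 n := by
  have h1 : 0 < tr q := by
    refine Finset.sum_pos (fun i _ => ?_) ⟨0, Finset.mem_univ _⟩
    rw [← qv_single q]
    exact hε.trans_le (h _ (by simp))
  refine ⟨h1, (tr q)⁻¹ * ε, by positivity, by rw [tr_smul, inv_mul_cancel₀ h1.ne'], fun u hu => ?_⟩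
  rw [qv_smul]
  have := h u hu
  gcongr

/-- A rational subspace is cut out by an integer matrix. -/
theorem exists_int_matrix_ker (L : Submodule ℚ (Fin n → ℚ)) :
    ∃ ξ : Fin n → Vec n, ∀ u : Vec n, toQ u ∈ L ↔ ∀ k, ∑ i, ξ k i * u i = 0 := by
  obtain ⟨L', hL'⟩ := Submodule.exists_isCompl L
  obtain ⟨f, hf⟩ : ∃ f : (Fin n → ℚ) →ₗ[ℚ] (Fin n → ℚ), LinearMap.ker f = L := by
    refine ⟨L'.subtype ∘ₗ L'.projectionOnto L hL'.symm, ?_⟩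
    rw [LinearMap.ker_comp, Submodule.ker_subtype]
    exact Submodule.ker_projectionOnto _
  obtain ⟨d, hd, a, ha⟩ := exists_common_denom
    (fun p : Fin n × Fin n => f (Pi.single p.2 1) p.1)
  refine ⟨fun k i => a (k, i), fun u => ?_⟩
  have key : ∀ k, ((∑ i, a (k, i) * u i : ℤ) : ℚ) = d * f (toQ u) k := by
    intro k
    have : toQ u = ∑ i, (u i : ℚ) • (Pi.single i 1 : Fin n → ℚ) := by
      ext j; simp [toQ, Finset.sum_apply, Pi.single_apply]
    rw [this, map_sum]
    push_cast
    rw [Finset.sum_apply, Finset.mul_sum]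
    refine Finset.sum_congr rfl fun i _ => ?_
    rw [ha, map_smul]; simp; ring
  have hd' : (d : ℚ) ≠ 0 := by exact_mod_cast hd.ne'
  rw [← hf, LinearMap.mem_ker]
  constructor
  · intro h k
    have := key k
    rw [h] at this
    simp only [Pi.zero_apply, mul_zero] at this
    exact_mod_cast this
  · intro h
    ext k
    have := key k
    rw [h k] at this
    simp only [Int.cast_zero] at this
    simpa [hd'] using this.symm

theorem mem_KL_iff [NeZero n] {s : ℕ} {x : Fin s → Vec n} :
    x ∈ (KL L).car s ↔ x ∈ (KL (⊤ : Submodule ℚ (Fin n → ℚ))).car s ∧ ∀ i, toQ (x i) ∈ L := by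
  constructor
  · rintro ⟨q, hqX, hx⟩
    refine ⟨?_, fun i => (hx i).2.1⟩
    rcases Nat.eq_zero_or_pos s with rfl | hs
    · exact ⟨q, hqX, fun i => i.elim0⟩
    obtain ⟨ξ, hξ⟩ := exists_int_matrix_ker L
    obtain ⟨ε, hε, hq⟩ := id hqX
    set t : ℝ := qv q (x ⟨0, hs⟩) with ht
    have ht0 : 0 ≤ t := X1.nonneg hqX _
    have htx : ∀ i, qv q (x i) = t := fun i =>
      le_antisymm ((hx i).2.2 _ (hx _).1 (hx _).2.1) ((hx _).2.2 _ (hx i).1 (hx i).2.1)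
    set q' : Form n := q + t • ∑ k, sqf (ξ k) with hq'
    have hq'v : ∀ u, qv q' u = qv q u + t * ∑ k, ((∑ i, ξ k i * u i : ℤ) : ℝ) ^ 2 := by
      intro u
      rw [hq', qv_add, qv_smul, qv_sum]
      simp only [qv_sqf]
    have hin : ∀ u, toQ u ∈ L → qv q' u = qv q u := by
      intro u hu
      rw [hq'v]
      simp [(hξ u).1 hu]
    have hout : ∀ u, toQ u ∉ L → t ≤ qv q' u := by
      intro u hu
      rw [hξ] at hu
      push Not at hu
      obtain ⟨k, hk⟩ := hu
      have h1 : (1 : ℝ) ≤ ((∑ i, ξ k i * u i : ℤ) : ℝ) ^ 2 := by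
        have h1 : (1 : ℤ) ≤ (∑ i, ξ k i * u i) ^ 2 := by
          have := sq_nonneg (∑ i, ξ k i * u i)
          have := pow_ne_zero 2 hk
          omega
        exact_mod_cast h1
      have h2 := Finset.single_le_sum (f := fun k => ((∑ i, ξ k i * u i : ℤ) : ℝ) ^ 2)
        (fun k _ => sq_nonneg _) (Finset.mem_univ k)
      have h3 := X1.nonneg hqX u
      rw [hq'v]
      have h4 : (1 : ℝ) ≤ ∑ k, ((∑ i, ξ k i * u i : ℤ) : ℝ) ^ 2 := h1.trans h2
      nlinarith
    have hge : ∀ u, u ≠ 0 → ε ≤ qv q' u := by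
      intro u hu
      rw [hq'v]
      have h1 := hq.2 u hu
      have h2 : 0 ≤ t * ∑ k, ((∑ i, ξ k i * u i : ℤ) : ℝ) ^ 2 := by positivity
      linarith
    obtain ⟨h1, h2⟩ := normalize hε hge
    refine ⟨_, h2, fun i => Um_smul _ (v := x i) ⟨(hx i).1, Submodule.mem_top, fun u hu _ => ?_⟩
      (by positivity)⟩
    rw [hin _ (hx i).2.1]
    by_cases huL : toQ u ∈ L
    · rw [hin u huL]; exact (hx i).2.2 u hu huL
    · rw [htx]; exact hout u huL
  · rintro ⟨⟨q, hqX, hx⟩, hL⟩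
    exact ⟨q, hqX, fun i => ⟨(hx i).1, hL i, fun u hu _ => (hx i).2.2 u hu trivial⟩⟩

end Minimal

/-! ### The minimum of a form -/

section Mu

variable {n : ℕ}

/-- The minimum of a form on nonzero integer vectors. -/
noncomputable def mu (q : Form n) : ℝ := ⨅ u : {u : Vec n // u ≠ 0}, qv q u.1

/-- Minimal vectors of a form. -/
abbrev U (v : Vec n) : Set (Form n) := Um ⊤ v

abbrev U_neg (v : Vec n) : U (-v) = U v := Um_neg ⊤ v

theorem U_le {q : Form n} {v : Vec n} (h : q ∈ U v) {u : Vec n} (hu : u ≠ 0) :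
    qv q v ≤ qv q u := h.2.2 u hu Submodule.mem_top

theorem mem_U {q : Form n} {v : Vec n} (hv : v ≠ 0) (h : ∀ u, u ≠ 0 → qv q v ≤ qv q u) :
    q ∈ U v := ⟨hv, Submodule.mem_top, fun u hu _ => h u hu⟩

theorem mu_eq {q : Form n} {v : Vec n} (h : q ∈ U v) : mu q = qv q v := by
  have : Nonempty {u : Vec n // u ≠ 0} := ⟨⟨v, h.1⟩⟩
  refine le_antisymm (ciInf_le (f := fun u : {u : Vec n // u ≠ 0} => qv q u.1)
    ⟨qv q v, ?_⟩ ⟨v, h.1⟩) (le_ciInf fun u => U_le h u.2)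
  rintro _ ⟨u, rfl⟩
  exact U_le h u.2

theorem top_nontriv [NeZero n] : ∃ u : Vec n, u ≠ 0 ∧ toQ u ∈ (⊤ : Submodule ℚ (Fin n → ℚ)) :=
  ⟨Pi.single 0 1, by simp, Submodule.mem_top⟩

theorem exists_mem_U [NeZero n] {q : Form n} (hq : q ∈ X1 n) : ∃ v, q ∈ U v :=
  exists_mem_Um top_nontriv hq

theorem mu_le [NeZero n] {q : Form n} (hq : q ∈ X1 n) {u : Vec n} (hu : u ≠ 0) :
    mu q ≤ qv q u := by
  obtain ⟨v, hv⟩ := exists_mem_U hq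
  rw [mu_eq hv]; exact U_le hv hu

theorem le_mu [NeZero n] {q : Form n} {c : ℝ} (h : ∀ u : Vec n, u ≠ 0 → c ≤ qv q u) : c ≤ mu q := by
  have : Nonempty {u : Vec n // u ≠ 0} := ⟨⟨Pi.single 0 1, by simp⟩⟩
  exact le_ciInf fun u => h u.1 u.2

theorem mu_pos [NeZero n] {q : Form n} (hq : q ∈ X1 n) : 0 < mu q := by
  obtain ⟨v, hv⟩ := exists_mem_U hq
  rw [mu_eq hv]; exact X1.pos hq hv.1

theorem mem_GE_mu [NeZero n] {q : Form n} (hq : q ∈ X1 n) : q ∈ GE n (mu q) := by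
  obtain ⟨ε, _, h⟩ := id hq
  exact ⟨h.1, fun u hu => mu_le hq hu⟩

theorem mem_GE_iff [NeZero n] {ε : ℝ} (hε : 0 < ε) {q : Form n} :
    q ∈ GE n ε ↔ q ∈ X1 n ∧ ε ≤ mu q :=
  ⟨fun h => ⟨⟨ε, hε, h⟩, le_mu h.2⟩, fun h => GE_anti h.2 (mem_GE_mu h.1)⟩

theorem mu_le_inv [NeZero n] {q : Form n} (hq : q ∈ X1 n) : mu q ≤ 1 / n := by
  have hn : (0 : ℝ) < n := by exact_mod_cast NeZero.pos n
  rw [le_div_iff₀ hn]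
  obtain ⟨ε, _, h⟩ := id hq
  rw [← h.1, tr]
  have : ∀ i : Fin n, mu q ≤ q s(i, i) := fun i => by
    rw [← qv_single q]; exact mu_le hq (by simp)
  calc mu q * n = ∑ i : Fin n, mu q := by simp [mul_comm]
    _ ≤ _ := Finset.sum_le_sum fun i _ => this i

theorem continuousOn_mu [NeZero n] {ε : ℝ} (hε : 0 < ε) : ContinuousOn (mu (n := n)) (GE n ε) := by
  have hfin : {v : Vec n | v ≠ 0 ∧ ∃ q ∈ GE n ε, qv q v ≤ 1}.Finite :=
    (finite_qv_le hε 1).subset fun v hv => hv.2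
  by_cases hne : (GE n ε).Nonempty
  swap
  · rw [Set.not_nonempty_iff_eq_empty.1 hne]; exact continuousOn_empty _
  have hbd : ∀ q ∈ GE n ε, ∀ v, q ∈ U v → v ∈ hfin.toFinset := fun q hq v hv => by
    rw [Set.Finite.mem_toFinset]
    refine ⟨hv.1, q, hq, (U_le hv (u := Pi.single 0 1) (by simp)).trans ?_⟩
    rw [qv_single]
    exact X1.diag_le ⟨ε, hε, hq⟩ 0
  have hFne : hfin.toFinset.Nonempty := by
    obtain ⟨q, hq⟩ := hne
    obtain ⟨v, hv⟩ := exists_mem_U ⟨ε, hε, hq⟩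
    exact ⟨v, hbd q hq v hv⟩
  have hc : Continuous fun q : Form n => hfin.toFinset.inf' hFne fun v => qv q v :=
    Continuous.finset_inf'_apply hFne fun v _ => continuous_qv v
  refine hc.continuousOn.congr fun q hq => ?_
  have hqX : q ∈ X1 n := ⟨ε, hε, hq⟩
  refine le_antisymm (Finset.le_inf' _ _ fun v hv => mu_le hqX ?_) ?_
  · rw [Set.Finite.mem_toFinset] at hv; exact hv.1
  · obtain ⟨v, hv⟩ := exists_mem_U hqX
    rw [mu_eq hv]
    exact Finset.inf'_le _ (hbd q hq v hv)

theorem convex_X1 : Convex ℝ (X1 n) := by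
  rintro q ⟨ε, hε, hq⟩ q' ⟨ε', hε', hq'⟩
  have h : StarConvex ℝ q (GE n (min ε ε')) :=
    (convex_GE _).starConvex (GE_anti (min_le_left _ _) hq)
  intro a b ha hb hab
  exact ⟨_, lt_min hε hε', h (GE_anti (min_le_right _ _) hq') ha hb hab⟩

theorem mu_concave [NeZero n] {q q' : Form n} (hq : q ∈ X1 n) (hq' : q' ∈ X1 n) {a b : ℝ}
    (ha : 0 ≤ a) (hb : 0 ≤ b) : a * mu q + b * mu q' ≤ mu (a • q + b • q') := by
  refine le_mu fun u hu => ?_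
  rw [qv_add, qv_smul, qv_smul]
  have h1 := mu_le hq hu
  have h2 := mu_le hq' hu
  gcongr

theorem mu_combo {q q' : Form n} {v : Vec n} (h : q ∈ U v) (h' : q' ∈ U v) {a b : ℝ}
    (ha : 0 ≤ a) (hb : 0 ≤ b) (hab : a + b = 1) :
    mu (a • q + b • q') = a * mu q + b * mu q' := by
  rw [mu_eq (convex_Um ⊤ v h h' ha hb hab), qv_add, qv_smul, qv_smul, mu_eq h, mu_eq h']

/-! ### Spans -/

/-- Rational span of a tuple of integer vectors. -/
def qspan {s : ℕ} (x : Fin s → Vec n) : Submodule ℚ (Fin n → ℚ) :=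
  Submodule.span ℚ (Set.range fun i => toQ (x i))

theorem qspan_le_iff {s : ℕ} {x : Fin s → Vec n} {L : Submodule ℚ (Fin n → ℚ)} :
    qspan x ≤ L ↔ ∀ i, toQ (x i) ∈ L := by
  rw [qspan, Submodule.span_le]
  exact ⟨fun h i => h ⟨i, rfl⟩, fun h => by rintro _ ⟨i, rfl⟩; exact h i⟩

theorem mem_qspan {s : ℕ} (x : Fin s → Vec n) (i : Fin s) : toQ (x i) ∈ qspan x :=
  qspan_le_iff.1 le_rfl i

theorem qspan_mono {s t : ℕ} {x : Fin s → Vec n} {y : Fin t → Vec n}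
    (h : ∀ j, ∃ i, y j = x i ∨ y j = -x i) : qspan y ≤ qspan x := by
  rw [qspan_le_iff]
  intro j
  obtain ⟨i, e | e⟩ := h j
  · rw [e]; exact mem_qspan x i
  · rw [e, toQ_neg]; exact neg_mem (mem_qspan x i)

theorem exists_functional {L : Submodule ℚ (Fin n → ℚ)} (hL : L ≠ ⊤) :
    ∃ ξ : Vec n, ξ ≠ 0 ∧ ∀ u : Vec n, toQ u ∈ L → ∑ i, ξ i * u i = 0 := by
  obtain ⟨ξ, hξ⟩ := exists_int_matrix_ker L
  by_contra hc
  push Not at hc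
  apply hL
  rw [eq_top_iff]
  have h0 : ∀ u : Vec n, toQ u ∈ L := by
    intro u
    rw [hξ]
    intro k
    have : ξ k = 0 := by
      by_contra h
      obtain ⟨u, hu, hu'⟩ := hc _ h
      exact hu' ((hξ u).1 hu k)
    simp [this]
  intro y _
  obtain ⟨d, hd, v, hv⟩ := exists_int_vec y
  have h1 := h0 v
  rw [hv] at h1
  exact (Submodule.smul_mem_iff _ (by exact_mod_cast hd.ne')).1 h1

theorem int_combo_of_mem_qspan {s : ℕ} {x : Fin s → Vec n} {v : Vec n} (h : toQ v ∈ qspan x) :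
    ∃ d : ℤ, 0 < d ∧ ∃ a : Fin s → ℤ, d • v = ∑ i, a i • x i := by
  obtain ⟨c, hc⟩ := (Submodule.mem_span_range_iff_exists_fun ℚ).1 h
  obtain ⟨d, hd, a, ha⟩ := exists_common_denom c
  refine ⟨d, hd, a, toQ_injective ?_⟩
  rw [toQ_smul, toQ_sum, ← hc, Finset.smul_sum]
  refine Finset.sum_congr rfl fun i _ => ?_
  rw [toQ_smul, ha, smul_smul]

/-- The minimum is bounded below on forms with a given spanning set of minimal vectors. -/
theorem exists_lower_bound_of_spanning [NeZero n] {s : ℕ} {x : Fin s → Vec n} (hx : qspan x = ⊤) :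
    ∃ ε > 0, ∀ q ∈ X1 n, (∀ i, q ∈ U (x i)) → ε < mu q := by
  have h : ∀ k : Fin n, ∃ d : ℤ, 0 < d ∧ ∃ a : Fin s → ℤ,
      d • (Pi.single k 1 : Vec n) = ∑ i, a i • x i := fun k =>
    int_combo_of_mem_qspan (by rw [hx]; exact Submodule.mem_top)
  choose d hd a ha using h
  set C : ℝ := ∑ k : Fin n, 2 ^ s * ∑ i, (a k i : ℝ) ^ 2 with hC
  have hC0 : 0 ≤ C := by positivity
  refine ⟨1 / (C + 1), by positivity, fun q hq hqx => ?_⟩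
  have h1 : ∀ k, q s(k, k) ≤ 2 ^ s * (∑ i, (a k i : ℝ) ^ 2) * mu q := by
    intro k
    have h2 := X1.qv_sum_le hq Finset.univ (fun i => a k i • x i)
    rw [← ha k, qv_zsmul, qv_single, Finset.card_univ, Fintype.card_fin] at h2
    have h3 : ∀ i, qv q (a k i • x i) = (a k i : ℝ) ^ 2 * mu q := fun i => by
      rw [qv_zsmul, mu_eq (hqx i)]
    simp only [h3] at h2
    rw [← Finset.sum_mul, ← mul_assoc] at h2
    refine le_trans ?_ h2
    have h4 : (1 : ℝ) ≤ (d k : ℝ) ^ 2 := by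
      have : (1 : ℝ) ≤ d k := by exact_mod_cast hd k
      nlinarith
    have h5 : 0 ≤ q s(k, k) := by rw [← qv_single q]; exact X1.nonneg hq _
    nlinarith
  have h2 : 1 ≤ C * mu q := by
    obtain ⟨ε, _, h⟩ := id hq
    rw [← h.1, tr, hC, Finset.sum_mul]
    exact Finset.sum_le_sum fun k _ => h1 k
  have h3 := mu_pos hq
  rw [div_lt_iff₀ (by positivity)]
  linarith

theorem exists_level_of_nonspanning_aux [NeZero n] {s : ℕ} (hs : 0 < s) {x : Fin s → Vec n}
    (hx : qspan x ≠ ⊤) {q : Form n} (hq : q ∈ X1 n) (hqx : ∀ i, q ∈ U (x i)) {ε : ℝ} (hε : 0 < ε)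
    (hεq : ε ≤ mu q) : ∃ q' ∈ X1 n, (∀ i, q' ∈ U (x i)) ∧ mu q' = ε := by
  obtain ⟨ξ, hξ0, hξ⟩ := exists_functional hx
  have hT : 0 < tr (sqf ξ) := by
    rw [tr_sqf]; linarith [sum_sq_single_ne ξ hξ0]
  set t : ℝ := (mu q / ε - 1) / tr (sqf ξ) with ht
  have ht0 : 0 ≤ t := by
    apply div_nonneg _ hT.le
    rw [sub_nonneg, le_div_iff₀ hε]; linarith
  have htT : 1 + t * tr (sqf ξ) = mu q / ε := by rw [ht]; field_simp; ring
  have hm := mu_pos hq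
  have hc : 0 < mu q / ε := by positivity
  have hsq : ∀ u, 0 ≤ qv (sqf ξ) u := fun u => by rw [qv_sqf]; positivity
  have hsx : ∀ i, qv (sqf ξ) (x i) = 0 := fun i => by
    rw [qv_sqf, hξ _ (mem_qspan x i)]; simp
  obtain ⟨δ, hδ, h1, h2⟩ := id hq
  set q' : Form n := (mu q / ε)⁻¹ • (q + t • sqf ξ) with hq'
  have hqv : ∀ u, qv q' u = (mu q / ε)⁻¹ * (qv q u + t * qv (sqf ξ) u) := fun u => by
    rw [hq', qv_smul, qv_add, qv_smul]
  have hX : q' ∈ X1 n := by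
    refine ⟨(mu q / ε)⁻¹ * δ, by positivity, ?_, fun u hu => ?_⟩
    · rw [hq', tr_smul, tr_add, tr_smul, h1, htT, inv_mul_cancel₀ hc.ne']
    · rw [hqv]
      have := h2 u hu
      have := mul_nonneg ht0 (hsq u)
      gcongr; linarith
  have hU : ∀ i, q' ∈ U (x i) := fun i => by
    refine mem_U (hqx i).1 fun u hu => ?_
    rw [hqv, hqv, hsx]
    have := U_le (hqx i) hu
    have := mul_nonneg ht0 (hsq u)
    exact mul_le_mul_of_nonneg_left (by linarith) (by positivity)
  refine ⟨q', hX, hU, ?_⟩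
  rw [mu_eq (hU ⟨0, hs⟩), hqv, hsx, mu_eq (hqx ⟨0, hs⟩)]
  have : qv q (x ⟨0, hs⟩) ≠ 0 := by rw [← mu_eq (hqx ⟨0, hs⟩)]; exact hm.ne'
  field_simp; simp

/-- A nonspanning tuple of minimal vectors has forms with any smaller minimum. -/
theorem exists_level_of_nonspanning [NeZero n] (hn : 2 ≤ n) {s : ℕ} {x : Fin s → Vec n}
    (hx : qspan x ≠ ⊤) {q : Form n} (hq : q ∈ X1 n) (hqx : ∀ i, q ∈ U (x i)) {ε : ℝ} (hε : 0 < ε)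
    (hεq : ε ≤ mu q) : ∃ q' ∈ X1 n, (∀ i, q' ∈ U (x i)) ∧ mu q' = ε := by
  rcases Nat.eq_zero_or_pos s with rfl | hs
  · obtain ⟨v, hv⟩ := exists_mem_U hq
    have hv1 : qspan (fun _ : Fin 1 => v) ≠ ⊤ := by
      intro h
      have h1 : Module.finrank ℚ (qspan (fun _ : Fin 1 => v)) ≤ 1 := by
        refine (finrank_range_le_card (R := ℚ) fun _ : Fin 1 => toQ v).trans (by simp)
      rw [h, finrank_top, Module.finrank_fin_fun] at h1
      omega
    obtain ⟨q', h1, _, h3⟩ := exists_level_of_nonspanning_aux one_pos hv1 hq (fun _ => hv) hε hεq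
    exact ⟨q', h1, fun i => i.elim0, h3⟩
  · exact exists_level_of_nonspanning_aux hs hx hq hqx hε hεq

end Mu

section Action

variable {n : ℕ}

/-- Long simultaneously minimal tuples repeat a vector up to sign. -/
theorem exists_dup_of_mem_KL [NeZero n] {s : ℕ} (hs : 2 ^ n < s) {x : Fin s → Vec n}
    (hx : x ∈ (KL (⊤ : Submodule ℚ (Fin n → ℚ))).car s) :
    ∃ i j, i ≠ j ∧ (x i = x j ∨ x i = -x j) := by
  obtain ⟨q, hq, h⟩ := hx
  obtain ⟨i, j, hij, he⟩ := Fintype.exists_ne_map_eq_of_card_lt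
    (fun (i : Fin s) (k : Fin n) => ((x i k : ℤ) : ZMod 2)) (by simpa using hs)
  refine ⟨i, j, hij, ?_⟩
  by_contra hc
  push Not at hc
  have h2 : ∀ k, ∃ u : ℤ, x i k - x j k = 2 * u := fun k => by
    have := congrFun he k
    rw [← sub_eq_zero, ← Int.cast_sub, ZMod.intCast_zmod_eq_zero_iff_dvd] at this
    exact this
  choose w hw using h2
  have e1 : x i = (w + x j) + w := by ext k; have := hw k; simp; linarith
  have e2 : x j = (w + x j) - w := by ext k; simp
  have hw0 : w ≠ 0 := by rintro rfl; exact hc.1 (by simpa using e1)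
  have hu0 : w + x j ≠ 0 := by
    intro h0; rw [h0] at e1 e2; apply hc.2; rw [e1, e2]; simp
  have := qv_parallelogram q (w + x j) w
  rw [← e1, ← e2, ← mu_eq (h i), ← mu_eq (h j)] at this
  linarith [mu_pos hq, mu_le hq hw0, mu_le hq hu0]

theorem AE.eq_zero_of_large [NeZero n] {s : ℕ} (hs : 2 ^ n < s) {f : (Fin s → Vec n) → ℚ}
    (hf : AE f) {x : Fin s → Vec n} (hx : x ∈ (KL (⊤ : Submodule ℚ (Fin n → ℚ))).car s) :
    f x = 0 := by
  obtain ⟨i, j, hij, h⟩ := exists_dup_of_mem_KL hs hx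
  exact hf.eq_zero_of_dup hij h

/-- The group `SL_n(ℤ)`. -/
abbrev Γ (n : ℕ) := Matrix.SpecialLinearGroup (Fin n) ℤ

/-- The action on tuples of vectors. -/
def act (γ : Γ n) {s : ℕ} (x : Fin s → Vec n) : Fin s → Vec n :=
  fun i => (γ : Matrix (Fin n) (Fin n) ℤ).mulVec (x i)

theorem act_apply (γ : Γ n) {s : ℕ} (x : Fin s → Vec n) (i : Fin s) :
    act γ x i = (γ : Matrix (Fin n) (Fin n) ℤ).mulVec (x i) := rfl

theorem act_one {s : ℕ} (x : Fin s → Vec n) : act 1 x = x := by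
  ext i; simp [act]

theorem act_mul (γ δ : Γ n) {s : ℕ} (x : Fin s → Vec n) : act (γ * δ) x = act γ (act δ x) := by
  ext i; simp [act]

theorem act_inv_act (γ : Γ n) {s : ℕ} (x : Fin s → Vec n) : act γ⁻¹ (act γ x) = x := by
  rw [← act_mul, inv_mul_cancel, act_one]

theorem act_act_inv (γ : Γ n) {s : ℕ} (x : Fin s → Vec n) : act γ (act γ⁻¹ x) = x := by
  rw [← act_mul, mul_inv_cancel, act_one]

theorem act_removeNth (γ : Γ n) {s : ℕ} (x : Fin (s + 1) → Vec n) (i : Fin (s + 1)) :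
    i.removeNth (act γ x) = act γ (i.removeNth x) := rfl

theorem act_comp (γ : Γ n) {s t : ℕ} (x : Fin s → Vec n) (σ : Fin t → Fin s) :
    act γ x ∘ σ = act γ (x ∘ σ) := rfl

theorem act_cons (γ : Γ n) {s : ℕ} (v : Vec n) (x : Fin s → Vec n) :
    act γ (Fin.cons v x : Fin (s + 1) → Vec n) =
      Fin.cons ((γ : Matrix (Fin n) (Fin n) ℤ).mulVec v) (act γ x) := by
  funext i; refine Fin.cases ?_ (fun j => ?_) i <;> simp [act]

theorem mulVec_inv_mulVec (γ : Γ n) (v : Vec n) :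
    ((γ⁻¹ : Γ n) : Matrix (Fin n) (Fin n) ℤ).mulVec
      ((γ : Matrix (Fin n) (Fin n) ℤ).mulVec v) = v :=
  congrFun (act_inv_act γ (fun _ : Fin 1 => v)) 0

theorem mulVec_mulVec_inv (γ : Γ n) (v : Vec n) :
    (γ : Matrix (Fin n) (Fin n) ℤ).mulVec
      (((γ⁻¹ : Γ n) : Matrix (Fin n) (Fin n) ℤ).mulVec v) = v :=
  congrFun (act_act_inv γ (fun _ : Fin 1 => v)) 0

theorem mulVec_ne_zero (γ : Γ n) {v : Vec n} (hv : v ≠ 0) :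
    (γ : Matrix (Fin n) (Fin n) ℤ).mulVec v ≠ 0 := fun h => hv <| by
  rw [← mulVec_inv_mulVec γ v, h, Matrix.mulVec_zero]

theorem act_ne_zero (γ : Γ n) {s : ℕ} {x : Fin s → Vec n} (hx : ∀ i, x i ≠ 0) :
    ∀ i, act γ x i ≠ 0 := fun i => mulVec_ne_zero γ (hx i)

theorem act_neg_of (γ : Γ n) {s : ℕ} {x y : Fin s → Vec n} (h : ∀ i, y i = x i ∨ y i = -x i) :
    ∀ i, act γ y i = act γ x i ∨ act γ y i = -act γ x i := fun i =>
  (h i).imp (fun h => by simp [act, h]) (fun h => by simp [act, h, Matrix.mulVec_neg])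

theorem act_mem_KL [NeZero n] (γ : Γ n) {s : ℕ} {x : Fin s → Vec n}
    (hx : x ∈ (KL (⊤ : Submodule ℚ (Fin n → ℚ))).car s) :
    act γ x ∈ (KL (⊤ : Submodule ℚ (Fin n → ℚ))).car s := by
  obtain ⟨q, hq, h⟩ := hx
  set q' := pullback ((γ⁻¹ : Γ n) : Matrix (Fin n) (Fin n) ℤ) q with hq'
  obtain ⟨ε, hε, h1, h2⟩ := id hq
  obtain ⟨ht, hX⟩ := normalize (q := q') hε fun u hu => by
    rw [hq', qv_pullback]; exact h2 _ (mulVec_ne_zero _ hu)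
  refine ⟨_, hX, fun i => Um_smul _ (mem_U (mulVec_ne_zero γ (h i).1) fun u hu => ?_)
    (by positivity)⟩
  rw [hq', qv_pullback, qv_pullback, mulVec_inv_mulVec]
  exact U_le (h i) (mulVec_ne_zero _ hu)

theorem act_mem_KL_iff [NeZero n] (γ : Γ n) {s : ℕ} {x : Fin s → Vec n} :
    act γ x ∈ (KL (⊤ : Submodule ℚ (Fin n → ℚ))).car s ↔
      x ∈ (KL (⊤ : Submodule ℚ (Fin n → ℚ))).car s :=
  ⟨fun h => by simpa [act_inv_act] using act_mem_KL γ⁻¹ h, act_mem_KL γ⟩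

theorem qspan_eq_top_iff {s : ℕ} {x : Fin s → Vec n} :
    qspan x = ⊤ ↔ ∀ v : Vec n, ∃ d : ℤ, 0 < d ∧ ∃ a : Fin s → ℤ, d • v = ∑ i, a i • x i := by
  constructor
  · intro h v
    exact int_combo_of_mem_qspan (by rw [h]; exact Submodule.mem_top)
  · intro h
    rw [eq_top_iff]
    intro y _
    obtain ⟨d, hd, v, hv⟩ := exists_int_vec y
    obtain ⟨e, he, a, ha⟩ := h v
    have h1 : (e : ℚ) • (d : ℚ) • y ∈ qspan x := by
      rw [← hv, ← toQ_smul, ha, toQ_sum]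
      exact Submodule.sum_mem _ fun i _ => by
        rw [toQ_smul]; exact Submodule.smul_mem _ _ (mem_qspan x i)
    rwa [Submodule.smul_mem_iff _ (by exact_mod_cast he.ne'),
      Submodule.smul_mem_iff _ (by exact_mod_cast hd.ne')] at h1

theorem qspan_act (γ : Γ n) {s : ℕ} {x : Fin s → Vec n} (h : qspan x = ⊤) :
    qspan (act γ x) = ⊤ := by
  rw [qspan_eq_top_iff] at h ⊢
  intro v
  obtain ⟨d, hd, a, ha⟩ := h (((γ⁻¹ : Γ n) : Matrix (Fin n) (Fin n) ℤ).mulVec v)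
  refine ⟨d, hd, a, ?_⟩
  have := congrArg (γ : Matrix (Fin n) (Fin n) ℤ).mulVec ha
  rw [Matrix.mulVec_smul, mulVec_mulVec_inv, Matrix.mulVec_sum] at this
  rw [this]
  exact Finset.sum_congr rfl fun i _ => by rw [Matrix.mulVec_smul, act_apply]

theorem qspan_act_iff (γ : Γ n) {s : ℕ} {x : Fin s → Vec n} :
    qspan (act γ x) = ⊤ ↔ qspan x = ⊤ :=
  ⟨fun h => by simpa [act_inv_act] using qspan_act γ⁻¹ h, qspan_act γ⟩

theorem act_free {γ : Γ n} {s : ℕ} {x : Fin s → Vec n} (h : qspan x = ⊤) (hγ : act γ x = x) :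
    γ = 1 := by
  have : ∀ v : Vec n, (γ : Matrix (Fin n) (Fin n) ℤ).mulVec v = v := by
    intro v
    obtain ⟨d, hd, a, ha⟩ := qspan_eq_top_iff.1 h v
    have h1 := congrArg (γ : Matrix (Fin n) (Fin n) ℤ).mulVec ha
    rw [Matrix.mulVec_smul, Matrix.mulVec_sum] at h1
    have h2 : ∑ i, (γ : Matrix (Fin n) (Fin n) ℤ).mulVec (a i • x i) = ∑ i, a i • x i :=
      Finset.sum_congr rfl fun i _ => by rw [Matrix.mulVec_smul, ← act_apply γ x i, hγ]
    rw [h2, ← ha] at h1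
    exact smul_right_injective _ hd.ne' h1
  apply Subtype.ext
  apply Matrix.ext_of_mulVec_single
  intro i
  rw [this]; simp only [Matrix.SpecialLinearGroup.coe_one, Matrix.one_mulVec]

/-- The determinant of a tuple of `n` vectors. -/
def dt (x : Fin n → Vec n) : ℤ := (Matrix.of fun i j => x j i).det

theorem cols_act (γ : Γ n) (x : Fin n → Vec n) :
    (Matrix.of fun i j => act γ x j i) =
      (γ : Matrix (Fin n) (Fin n) ℤ) * (Matrix.of fun i j => x j i) := by
  ext i j; simp [act, Matrix.mul_apply, Matrix.mulVec, dotProduct]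

theorem dt_act (γ : Γ n) (x : Fin n → Vec n) : dt (act γ x) = dt x := by
  rw [dt, cols_act, Matrix.det_mul, γ.2, one_mul, dt]

theorem exists_act_of_modEq {x y : Fin n → Vec n} (hx : dt x ≠ 0) (hd : dt y = dt x)
    (h : ∀ i j, dt x ∣ y i j - x i j) : ∃ γ : Γ n, act γ x = y := by
  set X : Matrix (Fin n) (Fin n) ℤ := Matrix.of fun i j => x j i with hX
  set Y : Matrix (Fin n) (Fin n) ℤ := Matrix.of fun i j => y j i with hY
  have h1 : ∀ i j, ∃ c, (Y * X.adjugate) i j = dt x * c := by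
    intro i j
    have e : Y * X.adjugate = (Y - X) * X.adjugate + dt x • 1 := by
      rw [sub_mul, Matrix.mul_adjugate]; simp [dt, hX]
    change dt x ∣ _
    rw [e, Matrix.add_apply, Matrix.mul_apply]
    refine dvd_add (Finset.dvd_sum fun k _ => Dvd.dvd.mul_right (h k i) _) ?_
    simp [Matrix.smul_apply]
  choose C hC using h1
  have hCX : dt x • (Matrix.of C * X) = dt x • Y := by
    have : dt x • Matrix.of C = Y * X.adjugate := by
      ext i j; rw [hC]; simp
    rw [← smul_mul_assoc, this, mul_assoc, Matrix.adjugate_mul, mul_smul_comm, mul_one]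
    rfl
  have hCX' : Matrix.of C * X = Y := smul_right_injective _ hx hCX
  have hdet : (Matrix.of C).det = 1 := by
    have := congrArg Matrix.det hCX'
    rw [Matrix.det_mul] at this
    change _ * dt x = dt y at this
    rw [hd] at this
    exact mul_right_cancel₀ hx (by rw [this, one_mul])
  refine ⟨⟨Matrix.of C, hdet⟩, ?_⟩
  have := cols_act ⟨Matrix.of C, hdet⟩ x
  rw [← hX] at this
  funext i; funext j
  have h2 := congrFun (congrFun this j) i
  rw [show ((⟨Matrix.of C, hdet⟩ : Γ n) : Matrix (Fin n) (Fin n) ℤ) * X = Y from hCX'] at h2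
  simpa [hY] using h2

theorem qspan_eq_top_iff_dt {x : Fin n → Vec n} : qspan x = ⊤ ↔ dt x ≠ 0 := by
  rw [qspan_eq_top_iff]
  set X : Matrix (Fin n) (Fin n) ℤ := Matrix.of fun i j => x j i with hX
  have hmul : ∀ (a : Fin n → ℤ), ∑ i, a i • x i = X.mulVec a := fun a => by
    ext k; simp [hX, Matrix.mulVec, dotProduct, mul_comm]
  constructor
  · intro h
    choose d hd a ha using fun k : Fin n => h (Pi.single k 1)
    have e : X * (Matrix.of fun i k => a k i) = Matrix.diagonal d := by
      ext i k
      have := congrFun ((ha k).trans (hmul _)) i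
      simp only [Pi.smul_apply, smul_eq_mul] at this
      rw [Matrix.mul_apply]
      simp only [Matrix.mulVec, dotProduct] at this
      simp only [Matrix.of_apply]
      rw [← this, Matrix.diagonal_apply, Pi.single_apply]
      by_cases hik : i = k <;> simp [hik]
    have h2 := congrArg Matrix.det e
    rw [Matrix.det_mul, Matrix.det_diagonal] at h2
    intro h0
    change X.det = 0 at h0
    rw [h0, zero_mul] at h2
    exact (Finset.prod_ne_zero_iff.2 fun i _ => (hd i).ne') h2.symm
  · intro h v
    refine ⟨dt x ^ 2, by positivity, dt x • X.adjugate.mulVec v, ?_⟩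
    rw [hmul, Matrix.mulVec_smul, Matrix.mulVec_mulVec, Matrix.mul_adjugate, Matrix.smul_mulVec,
      Matrix.one_mulVec]
    change _ = dt x • dt x • v
    rw [smul_smul, sq]

theorem abs_qb_le [NeZero n] {q : Form n} (hq : q ∈ X1 n) {v w : Vec n} (hv : q ∈ U v)
    (hw : q ∈ U w) : |qb q v w| ≤ mu q := by
  have h1 := X1.nonneg hq (v + w)
  have h2 := X1.nonneg hq (v + (-1 : ℤ) • w)
  rw [qv_add_vec] at h1 h2
  rw [qb_zsmul_right, qv_zsmul] at h2
  rw [← mu_eq hv, ← mu_eq hw] at h1 h2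
  push_cast at h2
  rw [abs_le]; constructor <;> linarith

theorem qv_combo_le [NeZero n] {q : Form n} (hq : q ∈ X1 n) {s : ℕ} {x : Fin s → Vec n}
    (h : ∀ i, q ∈ U (x i)) (a : Fin s → ℤ) :
    qv q (∑ i, a i • x i) ≤ (∑ i, |(a i : ℝ)|) ^ 2 * mu q := by
  rw [← qb_self, qb_sum_right, sq, Finset.sum_mul_sum, Finset.sum_mul]
  refine Finset.sum_le_sum fun i _ => ?_
  rw [qb_comm, qb_sum_right, Finset.sum_mul]
  refine Finset.sum_le_sum fun j _ => ?_
  rw [qb_zsmul_right, qb_comm, qb_zsmul_right]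
  calc _ ≤ |(a j : ℝ) * (a i * qb q (x j) (x i))| := le_abs_self _
    _ = |(a i : ℝ)| * |(a j : ℝ)| * |qb q (x j) (x i)| := by rw [abs_mul, abs_mul]; ring
    _ ≤ _ := mul_le_mul_of_nonneg_left (abs_qb_le hq (h j) (h i)) (by positivity)

theorem exists_bounded_multiple [NeZero n] {x : Fin n → Vec n}
    (hx : x ∈ (KL (⊤ : Submodule ℚ (Fin n → ℚ))).car n) (hs : qspan x = ⊤) (v : Vec n) :
    ∃ k : ℕ, 0 < k ∧ k ≤ n ^ n ∧ ∃ a : Fin n → ℤ, k • v = ∑ i, a i • x i := by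
  obtain ⟨q, hq, h⟩ := hx
  obtain ⟨d, hd, a, ha⟩ := qspan_eq_top_iff.1 hs v
  have hn : 0 < n := Nat.pos_of_ne_zero (NeZero.ne n)
  have hr0 : ∀ (j : ℕ) i, 0 ≤ (j * a i) % d := fun j i => Int.emod_nonneg _ hd.ne'
  have hr1 : ∀ (j : ℕ) i, (j * a i) % d < d := fun j i => Int.emod_lt_of_pos _ hd
  let box : Fin (n ^ n + 1) → Fin n → Fin n := fun j i =>
    ⟨(((j : ℕ) * a i) % d * n / d).toNat, by
      have h0 : 0 ≤ ((j : ℕ) * a i) % d * n / d :=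
        Int.ediv_nonneg (mul_nonneg (hr0 _ _) (by positivity)) hd.le
      have : ((j : ℕ) * a i) % d * n / d < n := by
        rw [Int.ediv_lt_iff_lt_mul hd, mul_comm]
        exact mul_lt_mul_of_pos_left (hr1 _ _) (by exact_mod_cast hn)
      omega⟩
  obtain ⟨j, j', hne, he⟩ := Fintype.exists_ne_map_eq_of_card_lt box (by simp)
  wlog hlt : j < j' generalizing j j'
  · exact this j' j hne.symm he.symm (lt_of_le_of_ne (not_lt.1 hlt) hne.symm)
  have hlt' : (j : ℕ) < j' := hlt
  have hdiff : ∀ i, |(j' * a i) % d - (j * a i) % d| * n < d := by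
    intro i
    have h1 := congrArg Fin.val (congrFun he i)
    simp only [box] at h1
    have n1 : 0 ≤ ((j : ℕ) * a i) % d * n / d :=
      Int.ediv_nonneg (mul_nonneg (hr0 _ _) (by positivity)) hd.le
    have n2 : 0 ≤ ((j' : ℕ) * a i) % d * n / d :=
      Int.ediv_nonneg (mul_nonneg (hr0 _ _) (by positivity)) hd.le
    have h2 : ((j : ℕ) * a i) % d * n / d = ((j' : ℕ) * a i) % d * n / d := by omega
    have e1 := Int.emod_add_mul_ediv (((j : ℕ) * a i) % d * n) d
    have e2 := Int.emod_add_mul_ediv (((j' : ℕ) * a i) % d * n) d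
    have l1 := Int.emod_nonneg (((j : ℕ) * a i) % d * n) hd.ne'
    have l2 := Int.emod_lt_of_pos (((j : ℕ) * a i) % d * n) hd
    have l3 := Int.emod_nonneg (((j' : ℕ) * a i) % d * n) hd.ne'
    have l4 := Int.emod_lt_of_pos (((j' : ℕ) * a i) % d * n) hd
    rw [h2] at e1
    have hn0 : (0 : ℤ) ≤ n := by positivity
    rw [← abs_of_nonneg hn0, ← abs_mul, abs_lt, sub_mul]
    constructor <;> linarith
  refine ⟨j' - j, by omega, by have := j'.2; omega, fun i => (j' * a i) / d - (j * a i) / d, ?_⟩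
  rw [← sub_eq_zero]
  set w : Vec n := ((j' : ℕ) - (j : ℕ)) • v - ∑ i, ((j' * a i) / d - (j * a i) / d) • x i with hw
  by_contra hw0
  have hdw : d • w = ∑ i, ((j' * a i) % d - (j * a i) % d) • x i := by
    rw [hw, smul_sub, ← natCast_zsmul, smul_comm, ha, Finset.smul_sum, Finset.smul_sum,
      ← Finset.sum_sub_distrib]
    refine Finset.sum_congr rfl fun i _ => ?_
    rw [smul_smul, smul_smul, ← sub_smul]
    congr 1
    have e1 := Int.emod_add_mul_ediv ((j : ℕ) * a i) d
    have e2 := Int.emod_add_mul_ediv ((j' : ℕ) * a i) d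
    rw [Nat.cast_sub hlt'.le]
    linarith
  have h1 := qv_combo_le hq h fun i => (j' * a i) % d - (j * a i) % d
  rw [← hdw, qv_zsmul] at h1
  have h2 := mu_le hq hw0
  have h3 := mu_pos hq
  have h4 : (∑ i, |(((j' * a i) % d - (j * a i) % d : ℤ) : ℝ)|) < d := by
    have : (∑ i, |(j' * a i) % d - (j * a i) % d|) * n < n * d := by
      rw [Finset.sum_mul]
      refine lt_of_lt_of_eq (Finset.sum_lt_sum_of_nonempty ⟨⟨0, hn⟩, Finset.mem_univ _⟩
        fun i _ => hdiff i) (by simp)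
    rw [mul_comm] at this
    have h5 := lt_of_mul_lt_mul_left this (by positivity)
    exact_mod_cast h5
  have h6 : (0 : ℝ) < d := by exact_mod_cast hd
  have h7 : (∑ i, |(((j' * a i) % d - (j * a i) % d : ℤ) : ℝ)|) ^ 2 < (d : ℝ) ^ 2 :=
    pow_lt_pow_left₀ h4 (by positivity) (by norm_num)
  have h8 : (d : ℝ) ^ 2 * mu q ≤ d ^ 2 * qv q w := mul_le_mul_of_nonneg_left h2 (by positivity)
  have h9 := mul_lt_mul_of_pos_right h7 h3
  linarith

theorem dt_dvd [NeZero n] {x : Fin n → Vec n}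
    (hx : x ∈ (KL (⊤ : Submodule ℚ (Fin n → ℚ))).car n) (hs : qspan x = ⊤) :
    dt x ∣ (((n ^ n).factorial : ℕ) : ℤ) ^ n := by
  have h : ∀ k : Fin n, ∃ a : Fin n → ℤ,
      (((n ^ n).factorial : ℕ) : ℤ) • (Pi.single k 1 : Vec n) = ∑ i, a i • x i := by
    intro k
    obtain ⟨m, hm, hmn, a, ha⟩ := exists_bounded_multiple hx hs (Pi.single k 1)
    obtain ⟨c, hc⟩ := Nat.dvd_factorial hm hmn
    refine ⟨(c : ℤ) • a, ?_⟩
    rw [hc, mul_comm, Nat.cast_mul, mul_smul, natCast_zsmul, natCast_zsmul, ha, Finset.smul_sum]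
    exact Finset.sum_congr rfl fun i _ => by simp [mul_smul]
  choose a ha using h
  have e : (Matrix.of fun i j => x j i) * (Matrix.of fun i k => a k i) =
      (((n ^ n).factorial : ℕ) : ℤ) • (1 : Matrix (Fin n) (Fin n) ℤ) := by
    ext i k
    have := congrFun (ha k) i
    rw [Finset.sum_apply] at this
    simp only [Matrix.mul_apply, Matrix.of_apply, Matrix.smul_apply, Matrix.one_apply]
    simp only [Pi.smul_apply, Pi.single_apply, smul_eq_mul] at this
    rw [smul_eq_mul, this]
    exact Finset.sum_congr rfl fun _ _ => mul_comm _ _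
  have := congrArg Matrix.det e
  rw [Matrix.det_mul, Matrix.det_smul, Matrix.det_one, mul_one, Fintype.card_fin] at this
  exact ⟨_, this.symm⟩

/-- There are finitely many orbits of spanning minimal `n`-tuples. -/
theorem exists_finite_reps (n : ℕ) [NeZero n] : ∃ R : Set (Fin n → Vec n), R.Finite ∧
    (∀ x ∈ (KL (⊤ : Submodule ℚ (Fin n → ℚ))).car n, qspan x = ⊤ → ∃ γ : Γ n, act γ x ∈ R) := by
  set M : ℤ := (((n ^ n).factorial : ℕ) : ℤ) ^ n with hM
  have hM0 : 0 < M := by positivity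
  let T := {x : Fin n → Vec n // x ∈ (KL (⊤ : Submodule ℚ (Fin n → ℚ))).car n ∧ qspan x = ⊤}
  let F : T → Set.Icc (-M) M × (Fin n → Fin n → ZMod M.toNat) := fun x =>
    (⟨dt x.1, by
      have h1 := Int.le_of_dvd hM0 (dt_dvd x.2.1 x.2.2)
      have h2 := Int.le_of_dvd hM0 (neg_dvd.2 (dt_dvd x.2.1 x.2.2))
      exact ⟨by linarith, h1⟩⟩, fun i j => (x.1 i j : ZMod _))
  have hne : NeZero M.toNat := ⟨by omega⟩
  have hfin : (Set.range F).Finite := Set.toFinite _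
  choose g hg using fun y : Set.range F => y.2
  have : Finite (Set.range F) := hfin
  refine ⟨Set.range fun y => (g y).1, Set.finite_range _, fun x hx hs => ?_⟩
  let y : Set.range F := ⟨F ⟨x, hx, hs⟩, ⟨_, rfl⟩⟩
  have e : F (g y) = F ⟨x, hx, hs⟩ := hg y
  obtain ⟨γ, hγ⟩ := exists_act_of_modEq (x := x) (y := (g y).1) (qspan_eq_top_iff_dt.1 hs)
    (congrArg (fun z => (z.1 : ℤ)) e) fun i j => by
      have h1 := congrFun (congrFun (congrArg Prod.snd e) i) j
      have h2 := (ZMod.intCast_eq_intCast_iff_dvd_sub _ _ _).1 h1.symm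
      refine dvd_trans ?_ h2
      rw [Int.toNat_of_nonneg hM0.le]
      exact dt_dvd hx hs
  exact ⟨γ, hγ ▸ ⟨y, rfl⟩⟩

end Action

section Rank

variable {n : ℕ}

/-- Tuples of nonzero vectors in `L`. -/
def DL (L : Submodule ℚ (Fin n → ℚ)) : Cpx (Vec n) where
  car s := {x | ∀ i, x i ≠ 0 ∧ toQ (x i) ∈ L}
  closed := by
    intro s t x y hx h j
    obtain ⟨i, h | h⟩ := h j
    · rw [h]; exact hx i
    · rw [h, toQ_neg]; exact ⟨neg_ne_zero.2 (hx i).1, L.neg_mem (hx i).2⟩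

theorem acyc_DL {L : Submodule ℚ (Fin n → ℚ)} (hL : ∃ u : Vec n, u ≠ 0 ∧ toQ u ∈ L) (s : ℕ) :
    Acyc (DL L) s := by
  obtain ⟨u, hu⟩ := hL
  refine acyc_of_cone (DL L) u (fun s x hx => ?_) s
  intro i
  refine Fin.cases ?_ (fun i => ?_) i
  · simpa using hu
  · simpa using hx i

/-- Tuples in `L` of rank at most `r`, together with the minimal tuples. -/
def ML (L : Submodule ℚ (Fin n → ℚ)) (r : ℕ) : Cpx (Vec n) where
  car s := {x | x ∈ (KL L).car s ∨ x ∈ (DL L).car s ∧ Module.finrank ℚ (qspan x) ≤ r}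
  closed := fun hx h => hx.imp (fun hx => (KL L).closed hx h) fun hx =>
    ⟨(DL L).closed hx.1 h, (Submodule.finrank_mono (qspan_mono h)).trans hx.2⟩

theorem KL_le_DL (L : Submodule ℚ (Fin n → ℚ)) : KL L ≤ DL L := by
  rintro s x ⟨q, _, hx⟩ i
  exact ⟨(hx i).1, (hx i).2.1⟩

theorem qspan_eq_of {s t : ℕ} {x : Fin s → Vec n} {y : Fin t → Vec n}
    (h : ∀ j, ∃ i, y j = x i ∨ y j = -x i) (h' : ∀ j, ∃ i, x j = y i ∨ x j = -y i) :
    qspan y = qspan x := le_antisymm (qspan_mono h) (qspan_mono h')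

theorem qspan_perm {s : ℕ} (x : Fin s → Vec n) (σ : Perm (Fin s)) : qspan (x ∘ σ) = qspan x :=
  qspan_eq_of (fun j => ⟨σ j, Or.inl rfl⟩) fun j => ⟨σ.symm j, Or.inl (by simp)⟩

theorem qspan_sign {s : ℕ} {x y : Fin s → Vec n} (h : ∀ i, y i = x i ∨ y i = -x i) :
    qspan y = qspan x :=
  qspan_eq_of (fun j => ⟨j, h j⟩) fun j => ⟨j, (h j).imp Eq.symm fun e => by rw [e, neg_neg]⟩

theorem qspan_removeNth_le {s : ℕ} (x : Fin (s + 1) → Vec n) (i : Fin (s + 1)) :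
    qspan (i.removeNth x) ≤ qspan x := qspan_mono fun j => ⟨i.succAbove j, Or.inl rfl⟩

theorem exists_int_of_finrank_pos {L : Submodule ℚ (Fin n → ℚ)} (h : 0 < Module.finrank ℚ L) :
    ∃ u : Vec n, u ≠ 0 ∧ toQ u ∈ L := by
  have : L ≠ ⊥ := by rintro rfl; simp at h
  obtain ⟨y, hy, hy0⟩ := Submodule.exists_mem_ne_zero_of_ne_bot this
  obtain ⟨d, hd, v, hv⟩ := exists_int_vec y
  refine ⟨v, ?_, hv ▸ L.smul_mem _ hy⟩
  rintro rfl
  rw [toQ_zero] at hv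
  have := hv.symm
  rw [smul_eq_zero] at this
  exact this.elim (fun h => by simp at h; omega) hy0

theorem mem_KL_of_le [NeZero n] {L L' : Submodule ℚ (Fin n → ℚ)} {s : ℕ} {x : Fin s → Vec n}
    (h : x ∈ (KL L).car s) (hL : qspan x ≤ L') : x ∈ (KL L').car s :=
  mem_KL_iff.2 ⟨(mem_KL_iff.1 h).1, qspan_le_iff.1 hL⟩

theorem ML_mono [NeZero n] {L L' : Submodule ℚ (Fin n → ℚ)} (h : L ≤ L') (r : ℕ) :
    ML L r ≤ ML L' r := by
  rintro s x (hx | hx)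
  · exact Or.inl (mem_KL_of_le hx ((qspan_le_iff.2 fun i => (KL_le_DL L s hx i).2).trans h))
  · exact Or.inr ⟨fun i => ⟨(hx.1 i).1, h (hx.1 i).2⟩, hx.2⟩

open Classical in
/-- Combines cochains on the subspaces of dimension `r` into one cochain. -/
noncomputable def spread (r : ℕ) {s : ℕ}
    (g : Submodule ℚ (Fin n → ℚ) → (Fin s → Vec n) → ℚ) : (Fin s → Vec n) → ℚ :=
  fun x => if Module.finrank ℚ (qspan x) = r then g (qspan x) x else 0

theorem AE.spread {r s : ℕ} {g : Submodule ℚ (Fin n → ℚ) → (Fin s → Vec n) → ℚ}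
    (hg : ∀ L, AE (g L)) : AE (spread r g) := by
  have key : ∀ {x y : Fin s → Vec n} (c : ℚ), qspan y = qspan x →
      (∀ L, g L y = c * g L x) → SLCoh.spread r g y = c * SLCoh.spread r g x := by
    intro x y c h h'
    by_cases hx : Module.finrank ℚ (qspan x) = r
    · rw [SLCoh.spread, if_pos (by rw [h, hx]), SLCoh.spread, if_pos hx, h, h']
    · rw [SLCoh.spread, if_neg (by rwa [h]), SLCoh.spread, if_neg hx, mul_zero]
  exact ⟨fun σ x => key _ (qspan_perm x σ) fun L => (hg L).alt σ x, fun x y h => by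
    simpa using key 1 (qspan_sign h) fun L => by rw [(hg L).even x y h, one_mul]⟩

theorem X1_nonempty (n : ℕ) [NeZero n] : (X1 n).Nonempty := by
  set q : Form n := fun z => Sym2.lift ⟨fun i j => if i = j then 1 else 0, fun i j => by
    simp [eq_comm]⟩ z with hq
  have : ∀ u, qv q u = ∑ i, (u i : ℝ) ^ 2 := fun u => by
    simp [qv, hq, sq]
  exact ⟨_, (normalize (q := q) one_pos fun u hu => by
    rw [this]; exact sum_sq_single_ne u hu).2⟩

theorem mem_KL_zero [NeZero n] (L : Submodule ℚ (Fin n → ℚ)) (x : Fin 0 → Vec n) :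
    x ∈ (KL L).car 0 := by
  obtain ⟨q, hq⟩ := X1_nonempty n
  exact ⟨q, hq, fun i => i.elim0⟩

theorem acyc_ML [NeZero n] (r : ℕ) : ∀ {L : Submodule ℚ (Fin n → ℚ)}
    (hL : ∃ u : Vec n, u ≠ 0 ∧ toQ u ∈ L) (s : ℕ), Acyc (ML L r) s := by
  induction r with
  | zero =>
    intro L hL s
    have : ML L 0 = KL L := by
      ext s x
      refine ⟨?_, Or.inl⟩
      rintro (hx | hx)
      · exact hx
      · rcases s with _ | s
        · exact mem_KL_zero L x
        · exfalso
          have h1 := Submodule.finrank_eq_zero.1 (Nat.le_zero.1 hx.2)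
          have h2 := mem_qspan x 0
          rw [h1, Submodule.mem_bot, toQ_eq_zero] at h2
          exact (hx.1 0).1 h2
    rw [this]
    exact acyc_KL hL s
  | succ r ih =>
    intro L hL s f hf hd
    have hle : ML L r ≤ ML L (r + 1) := by
      rintro s x (hx | hx)
      · exact Or.inl hx
      · exact Or.inr ⟨hx.1, hx.2.trans r.le_succ⟩
    have h0 := ih hL s f hf fun x hx => hd x (hle _ hx)
    cases s with
    | zero => exact fun x _ => h0 x (Or.inl (mem_KL_zero L x))
    | succ t =>
      obtain ⟨g, hg, hfg⟩ := h0
      set f1 := f - del g with hf1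
      have hf1AE : AE f1 := hf.sub hg.del
      have hf1z : ∀ x ∈ (ML L r).car (t + 1), f1 x = 0 := fun x hx => by
        rw [hf1, Pi.sub_apply, hfg x hx, sub_self]
      have hf1d : ∀ x ∈ (ML L (r + 1)).car (t + 2), del f1 x = 0 := fun x hx => by
        rw [hf1, map_sub, del_del, sub_zero]; exact hd x hx
      have key : ∀ L' : Submodule ℚ (Fin n → ℚ), ∃ g' : (Fin t → Vec n) → ℚ, AE g' ∧
          (L' ≤ L → Module.finrank ℚ L' = r + 1 → (∀ x ∈ (ML L' r).car t, g' x = 0) ∧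
            ∀ x ∈ (DL L').car (t + 1), f1 x = del g' x) := by
        intro L'
        by_cases h : L' ≤ L ∧ Module.finrank ℚ L' = r + 1
        · have hL' := exists_int_of_finrank_pos (L := L') (by omega)
          obtain ⟨g', h1, h2, h3⟩ := rel_acyc (A := DL L') (B := ML L' r) (by
              rintro s x (hx | hx)
              exacts [KL_le_DL _ _ hx, hx.1]) (acyc_DL hL' (t + 1)) (ih hL' t) hf1AE
            (fun x hx => hf1z x (ML_mono h.1 r _ hx))
            (fun x hx => hf1d x (ML_mono h.1 _ _ (Or.inr ⟨hx, h.2 ▸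
              Submodule.finrank_mono (qspan_le_iff.2 fun i => (hx i).2)⟩)))
          exact ⟨g', h1, fun _ _ => ⟨h2, h3⟩⟩
        · exact ⟨0, AE.zero, fun h1 h2 => absurd ⟨h1, h2⟩ h⟩
      choose G hG hG' using key
      refine ⟨g + spread (r + 1) G, hg.add (AE.spread hG), fun x hx => ?_⟩
      rw [map_add, Pi.add_apply, ← sub_eq_iff_eq_add']
      change f1 x = _
      by_cases hxr : x ∈ (ML L r).car (t + 1)
      · rw [hf1z x hxr, eq_comm, del_apply]
        refine Finset.sum_eq_zero fun i _ => ?_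
        have hy := (ML L r).face hxr i
        rw [spread]
        split_ifs with hrk
        · rcases hy with hy | hy
          · rw [(hG' _ (qspan_le_iff.2 fun j => (KL_le_DL L _ hy j).2) hrk).1 _
              (Or.inl (mem_KL_of_le hy le_rfl)), mul_zero]
          · have := hy.2; omega
        · simp
      · rcases hx with hx | ⟨hx, hrk⟩
        · exact absurd (Or.inl hx) hxr
        · have hrk' : Module.finrank ℚ (qspan x) = r + 1 := by
            by_contra hne
            exact hxr (Or.inr ⟨hx, by omega⟩)
          have hL' : qspan x ≤ L := qspan_le_iff.2 fun i => (hx i).2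
          obtain ⟨h1, h2⟩ := hG' _ hL' hrk'
          rw [h2 x fun i => ⟨(hx i).1, mem_qspan x i⟩, del_apply, del_apply]
          refine Finset.sum_congr rfl fun i _ => ?_
          congr 1
          rw [spread]
          have hle := qspan_removeNth_le x i
          split_ifs with h
          · rw [Submodule.eq_of_le_of_finrank_eq hle (h.trans hrk'.symm)]
          · refine h1 _ (Or.inr ⟨fun j => ⟨(hx _).1, mem_qspan x _⟩, ?_⟩)
            have := Submodule.finrank_mono hle
            omega

/-- Cocycles on tuples of nonzero vectors vanishing on minimal and on nonspanning tuples
are coboundaries of such cochains. -/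
theorem rel_acyc_nonspanning [NeZero n] {t : ℕ} {f : (Fin (t + 1) → Vec n) → ℚ} (hf : AE f)
    (hK : ∀ x ∈ (KL (⊤ : Submodule ℚ (Fin n → ℚ))).car (t + 1), f x = 0)
    (hN : ∀ x, (∀ i, x i ≠ 0) → qspan x ≠ ⊤ → f x = 0)
    (hd : ∀ x : Fin (t + 2) → Vec n, (∀ i, x i ≠ 0) → del f x = 0) :
    ∃ g : (Fin t → Vec n) → ℚ, AE g ∧
      (∀ x ∈ (KL (⊤ : Submodule ℚ (Fin n → ℚ))).car t, g x = 0) ∧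
      (∀ x, (∀ i, x i ≠ 0) → qspan x ≠ ⊤ → g x = 0) ∧
      ∀ x, (∀ i, x i ≠ 0) → f x = del g x := by
  have hrk : ∀ {s : ℕ} (x : Fin s → Vec n),
      Module.finrank ℚ (qspan x) ≤ n - 1 ↔ qspan x ≠ ⊤ := by
    intro s x
    have hn := Nat.pos_of_ne_zero (NeZero.ne n)
    have h1 := Submodule.finrank_le (qspan x)
    rw [Module.finrank_fin_fun] at h1
    constructor
    · intro h h2
      rw [h2, finrank_top, Module.finrank_fin_fun] at h; omega
    · intro h
      by_contra hc
      exact h (Submodule.eq_top_of_finrank_eq (by rw [Module.finrank_fin_fun]; omega))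
  have hmem : ∀ {s : ℕ} (x : Fin s → Vec n), (∀ i, x i ≠ 0) →
      x ∈ (DL (⊤ : Submodule ℚ (Fin n → ℚ))).car s := fun x hx i => ⟨hx i, Submodule.mem_top⟩
  obtain ⟨g, h1, h2, h3⟩ := rel_acyc (A := DL ⊤) (B := ML (⊤ : Submodule ℚ (Fin n → ℚ)) (n - 1))
    (by rintro s x (hx | hx)
        exacts [KL_le_DL _ _ hx, hx.1]) (acyc_DL top_nontriv (t + 1))
    (acyc_ML (n - 1) top_nontriv t) hf
    (by rintro x (hx | hx)
        exacts [hK x hx, hN x (fun i => (hx.1 i).1) ((hrk x).1 hx.2)])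
    (fun x hx => hd x fun i => (hx i).1)
  exact ⟨g, h1, fun x hx => h2 x (Or.inl hx),
    fun x hx hs => h2 x (Or.inr ⟨hmem x hx, (hrk x).2 hs⟩), fun x hx => h3 x (hmem x hx)⟩

end Rank

section Suspension

variable {V : Type*} [AddCommGroup V] {s : ℕ}

theorem glue_of_sub {A B : Cpx V} {f : (Fin (s + 1) → V) → ℚ} {a b : (Fin s → V) → ℚ}
    (ha : AE a) (hb : AE b) (hfa : ∀ x ∈ A.car (s + 1), f x = del a x)
    (hfb : ∀ x ∈ B.car (s + 1), f x = del b x) (h : IsCob (A ⊓ B) (a - b)) :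
    IsCob (A ⊔ B) f := by
  obtain ⟨b', hb', hfb', hab⟩ : ∃ b' : (Fin s → V) → ℚ, AE b' ∧
      (∀ x ∈ B.car (s + 1), f x = del b' x) ∧ ∀ x ∈ (A ⊓ B).car s, a x = b' x := by
    cases s with
    | zero => exact ⟨b, hb, hfb, fun x hx => by have := h x hx; simp at this; linarith⟩
    | succ t =>
      obtain ⟨p, hp, ep⟩ := h
      refine ⟨b + del p, hb.add hp.del, fun x hx => ?_, fun x hx => ?_⟩
      · rw [map_add, del_del, add_zero, hfb x hx]
      · have := ep x hx
        simp at this ⊢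
        linarith
  refine ⟨paste (A.car s) a b', AE.paste A ha hb', ?_⟩
  rintro x (hx | hx)
  · rw [hfa x hx]
    exact A.del_congr (fun y hy => (paste_of_mem hy).symm) hx
  · rw [hfb' x hx]
    refine B.del_congr (fun y hy => ?_) hx
    by_cases hyA : y ∈ A.car s
    · rw [paste_of_mem hyA, hab y ⟨hyA, hy⟩]
    · rw [paste_of_notMem hyA]

theorem acyc_sup_zero {A B : Cpx V} (hA : Acyc A 0) (hB : Acyc B 0) : Acyc (A ⊔ B) 0 := by
  intro f hf hd x hx
  rcases hx with hx | hx
  · exact hA f hf (fun y hy => hd y (Or.inl hy)) x hx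
  · exact hB f hf (fun y hy => hd y (Or.inr hy)) x hx

theorem acyc_sup_succ {A B : Cpx V} (hA : Acyc A (s + 1)) (hB : Acyc B (s + 1))
    (h : Acyc (A ⊓ B) s) : Acyc (A ⊔ B) (s + 1) := by
  intro f hf hd
  obtain ⟨a, ha, ea⟩ := hA f hf fun y hy => hd y (Or.inl hy)
  obtain ⟨b, hb, eb⟩ := hB f hf fun y hy => hd y (Or.inr hy)
  refine glue_of_sub ha hb ea eb (h _ (ha.sub hb) ?_)
  rintro x ⟨hx, hx'⟩
  rw [map_sub, Pi.sub_apply, ← ea x hx, ← eb x hx', sub_self]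

/-- The cohomology at tuples of size `s` is one-dimensional, generated by `ω`. -/
structure Gen (Y : Cpx V) (ω : (Fin s → V) → ℚ) : Prop where
  ae : AE ω
  closed : ∀ x ∈ Y.car (s + 1), del ω x = 0
  not_cob : ¬ IsCob Y ω
  gen : ∀ f : (Fin s → V) → ℚ, AE f → (∀ x ∈ Y.car (s + 1), del f x = 0) →
    ∃ c : ℚ, IsCob Y (f - c • ω)

theorem IsCob.add {Y : Cpx V} : ∀ {s : ℕ} {f g : (Fin s → V) → ℚ}, IsCob Y f → IsCob Y g →
    IsCob Y (f + g)
  | 0, f, g, hf, hg => fun x hx => by rw [Pi.add_apply, hf x hx, hg x hx, add_zero]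
  | s + 1, f, g, ⟨a, ha, ea⟩, ⟨b, hb, eb⟩ => ⟨a + b, ha.add hb, fun x hx => by
      rw [map_add, Pi.add_apply, Pi.add_apply, ea x hx, eb x hx]⟩

theorem Gen.susp {A B : Cpx V} {ω ω₁ : (Fin s → V) → ℚ} {ω' : (Fin (s + 1) → V) → ℚ}
    (hA : ∀ s, Acyc A s) (hB : ∀ s, Acyc B s) (G : Gen (A ⊓ B) ω) (h₁ : AE ω₁)
    (e₁ : ∀ x ∈ (A ⊓ B).car s, ω₁ x = ω x) (hω' : AE ω')
    (eA : ∀ x ∈ A.car (s + 1), ω' x = del ω₁ x) (eB : ∀ x ∈ B.car (s + 1), ω' x = 0) :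
    Gen (A ⊔ B) ω' where
  ae := hω'
  closed := by
    rintro x (hx | hx)
    · rw [A.del_congr eA hx, del_del]; rfl
    · exact B.del_eq_zero eB hx
  not_cob := by
    rintro ⟨p, hp, ep⟩
    have hpB : IsCob B p := hB s p hp fun x hx => by rw [← ep x (Or.inr hx), eB x hx]
    have hpA : IsCob A (ω₁ - p) := hA s _ (h₁.sub hp) fun x hx => by
      rw [map_sub, Pi.sub_apply, ← eA x hx, ← ep x (Or.inl hx), sub_self]
    refine G.not_cob (isCob_congr _ (fun x hx => ?_)
      (IsCob.add (IsCob.mono (fun x hx => hx.1) hpA) (IsCob.mono (fun x hx => hx.2) hpB)))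
    rw [← e₁ x hx]; simp
  gen f hf hd := by
    obtain ⟨a, ha, ea⟩ := hA (s + 1) f hf fun y hy => hd y (Or.inl hy)
    obtain ⟨b, hb, eb⟩ := hB (s + 1) f hf fun y hy => hd y (Or.inr hy)
    obtain ⟨c, hc⟩ := G.gen (a - b) (ha.sub hb) (by
      rintro x ⟨hx, hx'⟩
      rw [map_sub, Pi.sub_apply, ← ea x hx, ← eb x hx', sub_self])
    refine ⟨c, glue_of_sub (a := a - c • ω₁) (b := b) (ha.sub (h₁.smul c)) hb ?_ ?_ ?_⟩
    · intro x hx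
      rw [Pi.sub_apply, Pi.smul_apply, map_sub, map_smul, Pi.sub_apply, Pi.smul_apply, ea x hx,
        eA x hx]
    · intro x hx
      rw [Pi.sub_apply, Pi.smul_apply, eB x hx, smul_zero, sub_zero, eb x hx]
    · refine isCob_congr _ (fun x hx => ?_) hc
      simp [e₁ x hx]; ring

/-- Adjoins the empty tuple to a complex. -/
def withEmpty (Y : Cpx V) : Cpx V where
  car s := {x | s = 0 ∨ x ∈ Y.car s}
  closed := by
    rintro s t x y (rfl | hx) h
    · rcases t with _ | t
      · exact Or.inl rfl
      · obtain ⟨i, _⟩ := h 0; exact i.elim0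
    · exact Or.inr (Y.closed hx h)

theorem withEmpty_eq {Y : Cpx V} (h : ∃ x : Fin 0 → V, x ∈ Y.car 0) : withEmpty Y = Y := by
  ext s x
  refine ⟨?_, Or.inr⟩
  rintro (rfl | hx)
  · obtain ⟨y, hy⟩ := h
    rwa [Subsingleton.elim x y]
  · exact hx

end Suspension

section Cone

variable {n : ℕ}

open Classical in
/-- The round form of trace one. -/
noncomputable def cF (n : ℕ) : Form n := fun z => if z.IsDiag then 1 / (n : ℝ) else 0

theorem qv_cF (u : Vec n) : qv (cF n) u = 1 / n * ∑ i, (u i : ℝ) ^ 2 := by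
  simp only [qv, cF, Sym2.mk_isDiag_iff, ite_mul, zero_mul, Finset.sum_ite_eq,
    Finset.mem_univ, if_true, Finset.mul_sum, sq]

theorem tr_cF [NeZero n] : tr (cF n) = 1 := by
  have : (n : ℝ) ≠ 0 := NeZero.ne _
  simp [tr, cF, this]

theorem cF_mem [NeZero n] : cF n ∈ GE n (1 / n) := by
  refine ⟨tr_cF, fun u hu => ?_⟩
  rw [qv_cF]
  exact le_mul_of_one_le_right (by positivity) (sum_sq_single_ne u hu)

theorem inv_pos_n (n : ℕ) [NeZero n] : (0 : ℝ) < 1 / n := by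
  have : (0 : ℝ) < n := by exact_mod_cast NeZero.pos n
  positivity

theorem mu_cF [NeZero n] : mu (cF n) = 1 / n :=
  le_antisymm (mu_le_inv (GE_subset_X1 (inv_pos_n n) cF_mem)) (le_mu fun u hu => cF_mem.2 u hu)

theorem cF_mem_X1 [NeZero n] : cF n ∈ X1 n := GE_subset_X1 (inv_pos_n n) cF_mem

theorem abs_qv_le (d : Form n) {δ : ℝ} (hδ : 0 < δ) {u : Vec n} {m : ℝ}
    (h : ∀ i, δ * (u i : ℝ) ^ 2 ≤ m) : |qv d u| ≤ (∑ i, ∑ j, |d s(i, j)|) / δ * m := by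
  rw [qv, Finset.sum_div, Finset.sum_mul]
  refine (Finset.abs_sum_le_sum_abs _ _).trans (Finset.sum_le_sum fun i _ => ?_)
  rw [Finset.sum_div, Finset.sum_mul]
  refine (Finset.abs_sum_le_sum_abs _ _).trans (Finset.sum_le_sum fun j _ => ?_)
  rw [abs_mul, div_mul_eq_mul_div, mul_div_assoc]
  refine mul_le_mul_of_nonneg_left ?_ (abs_nonneg _)
  rw [le_div_iff₀ hδ, abs_mul]
  have h1 := h i
  have h2 := h j
  rw [← sq_abs] at h1 h2
  nlinarith [sq_nonneg (|(u i : ℝ)| - |(u j : ℝ)|), mul_nonneg hδ.le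
    (sq_nonneg (|(u i : ℝ)| - |(u j : ℝ)|))]

/-- Forms of minimum greater than `a` can be moved slightly in any direction. -/
theorem exists_small_move [NeZero n] {q d : Form n} {a : ℝ} (hq : q ∈ X1 n) (hd : tr d = 0)
    (ha : 0 < a) (hqa : a < mu q) : ∃ η : ℝ, 0 < η ∧ q + η • d ∈ GE n a := by
  obtain ⟨δ, hδ, h⟩ := exists_pos_lower_bound n (mu_pos hq)
  set C : ℝ := (∑ i, ∑ j, |d s(i, j)|) / δ with hC
  have hC0 : 0 ≤ C := div_nonneg (Finset.sum_nonneg fun i _ => Finset.sum_nonneg fun j _ =>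
    abs_nonneg _) hδ.le
  have hm := mu_pos hq
  have h1 : 0 < 1 - a / mu q := by rw [sub_pos, div_lt_one hm]; exact hqa
  set η : ℝ := (1 - a / mu q) / (C + 1) with hη
  have hη0 : 0 < η := by positivity
  have hηC : η * C ≤ 1 - a / mu q := by
    rw [hη, div_mul_eq_mul_div, div_le_iff₀ (by positivity)]
    nlinarith
  refine ⟨η, hη0, ?_, fun u hu => ?_⟩
  · rw [tr_add, tr_smul, hd, mul_zero, add_zero]; exact (mem_GE_mu hq).1
  · rw [qv_add, qv_smul]
    have h2 := abs_qv_le d hδ fun i => h q (mem_GE_mu hq) u i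
    rw [← hC] at h2
    have h3 := (abs_le.1 h2).1
    have h4 := mu_le hq hu
    have h5 : η * -(C * qv q u) ≤ η * qv d u := mul_le_mul_of_nonneg_left h3 hη0.le
    have h6 : a / mu q * mu q ≤ a / mu q * qv q u := mul_le_mul_of_nonneg_left h4 (by positivity)
    rw [div_mul_cancel₀ _ hm.ne'] at h6
    have h7 : η * C * qv q u ≤ (1 - a / mu q) * qv q u :=
      mul_le_mul_of_nonneg_right hηC (hm.le.trans h4)
    linarith

/-- Every ray from the round form passes through every level of the minimum. -/
theorem exists_ray_level [NeZero n] {d : Form n} (hd : tr d = 0) (hd0 : d ≠ 0) {a : ℝ}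
    (ha : 0 < a) (han : a < 1 / n) :
    ∃ t : ℝ, 0 < t ∧ cF n + t • d ∈ X1 n ∧ mu (cF n + t • d) = a := by
  set S : Set ℝ := {t | 0 ≤ t ∧ cF n + t • d ∈ GE n a} with hS
  have hcl : IsClosed S := by
    refine isClosed_Ici.inter ((isClosed_GE a).preimage ?_)
    fun_prop
  obtain ⟨z, hz⟩ : ∃ z, d z ≠ 0 := by
    by_contra hc
    push Not at hc
    exact hd0 (funext hc)
  have hbd : BddAbove S := by
    refine ⟨(1 + |cF n z|) / |d z|, fun t ht => ?_⟩
    rw [le_div_iff₀ (abs_pos.2 hz)]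
    have h1 := X1.entry_le (GE_subset_X1 ha ht.2) z
    have h2 : t * |d z| = |t * d z| := by rw [abs_mul, abs_of_nonneg ht.1]
    rw [h2]
    have h3 : t * d z = (cF n + t • d) z - cF n z := by simp
    rw [h3]
    exact (abs_sub _ _).trans (by linarith)
  have h0 : (0 : ℝ) ∈ S := ⟨le_rfl, by simpa using GE_anti han.le cF_mem⟩
  have hsup := hcl.csSup_mem ⟨0, h0⟩ hbd
  set t := sSup S with ht
  have hX := GE_subset_X1 ha hsup.2
  have hmu : mu (cF n + t • d) = a := by
    refine le_antisymm ?_ ((mem_GE_iff ha).1 hsup.2).2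
    by_contra hc
    push Not at hc
    obtain ⟨η, hη, h⟩ := exists_small_move hX hd ha hc
    have : t + η ∈ S := ⟨by have := hsup.1; linarith, by rwa [add_smul, ← add_assoc]⟩
    have := le_csSup hbd this
    linarith
  refine ⟨t, lt_of_le_of_ne hsup.1 fun h => ?_, hX, hmu⟩
  rw [← h, zero_smul, add_zero, mu_cF] at hmu
  linarith

/-- Forms of minimum between `a` and `b`. -/
def Zab (n : ℕ) (a b : ℝ) : Set (Form n) := {q | q ∈ GE n a ∧ mu q ≤ b}

theorem isCompact_Zab [NeZero n] {a : ℝ} (ha : 0 < a) (b : ℝ) : IsCompact (Zab n a b) := by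
  have := (continuousOn_mu (n := n) ha).preimage_isClosed_of_isClosed (isClosed_GE a)
    (isClosed_Iic (a := b))
  exact (isCompact_GE ha).of_isClosed_subset this fun q hq => hq.1

theorem mu_lt_of_ray [NeZero n] {q : Form n} (hq : q ∈ X1 n) (hqn : mu q < 1 / n) {t : ℝ}
    (ht0 : 0 ≤ t) (ht1 : t < 1) : mu q < mu (cF n + t • (q - cF n)) := by
  have h := mu_concave cF_mem_X1 hq (sub_nonneg.2 ht1.le) ht0
  have e : (1 - t) • cF n + t • q = cF n + t • (q - cF n) := by
    rw [smul_sub, sub_smul, one_smul]; abel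
  rw [e, mu_cF] at h
  nlinarith

/-- A closed convex cone of forms with apex the round form, with a positive functional. -/
structure SharpCone (P : Set (Form n)) (S : Form n →ₗ[ℝ] ℝ) : Prop where
  closed : IsClosed P
  convex : Convex ℝ P
  ray : ∀ q ∈ P, ∀ t : ℝ, 0 ≤ t → cF n + t • (q - cF n) ∈ P
  pos : ∀ q ∈ P, tr q = 1 → q ≠ cF n → 0 < S (q - cF n)

/-- Projective coordinates on a cone together with the minimum. -/
noncomputable def hcone (S : Form n →ₗ[ℝ] ℝ) : Option (Sym2 (Fin n)) → Form n → ℝ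
  | none, q => mu q
  | some z, q => (q z - cF n z) / S (q - cF n)

theorem SharpCone.scale [NeZero n] {P : Set (Form n)} {S : Form n →ₗ[ℝ] ℝ} (hP : SharpCone P S)
    {q : Form n} (hqP : q ∈ P) (hq : tr q = 1) (hqS : 0 < S (q - cF n)) {b : ℝ} (hb : 0 < b)
    (hbn : b < 1 / n) : ∃ q' ∈ P, q' ∈ X1 n ∧ mu q' = b ∧
      ∀ z, hcone S (some z) q' = hcone S (some z) q := by
  obtain ⟨t, ht, h1, h2⟩ := exists_ray_level (d := q - cF n)
    (by rw [sub_eq_add_neg, ← neg_one_smul ℝ (cF n), tr_add, tr_smul, hq, tr_cF]; ring)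
    (by intro h; rw [h, map_zero] at hqS; exact hqS.false) hb hbn
  refine ⟨_, hP.ray q hqP t ht.le, h1, h2, fun z => ?_⟩
  simp only [hcone, add_sub_cancel_left, map_smul, Pi.add_apply, Pi.smul_apply, smul_eq_mul,
    Pi.sub_apply]
  rw [mul_div_mul_left _ _ ht.ne']

theorem mem_GE_tr {q : Form n} (hq : q ∈ X1 n) : tr q = 1 := by
  obtain ⟨ε, _, h⟩ := hq
  exact h.1

theorem tr_convex {q q' : Form n} (h : tr q = 1) (h' : tr q' = 1) {a b : ℝ} (hab : a + b = 1) :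
    tr (a • q + b • q') = 1 := by
  rw [tr_add, tr_smul, tr_smul, h, h', mul_one, mul_one, hab]

theorem combo_sub (q q' : Form n) {a b : ℝ} (hab : a + b = 1) :
    a • q + b • q' - cF n = a • (q - cF n) + b • (q' - cF n) := by
  have : cF n = a • cF n + b • cF n := by rw [← add_smul, hab, one_smul]
  nth_rewrite 1 [this]
  rw [smul_sub, smul_sub]; abel

theorem hcone_some_mem {S : Form n →ₗ[ℝ] ℝ} {q : Form n} (hq : 0 < S (q - cF n))
    {z : Sym2 (Fin n)} {l u : ℝ} :
    (l ≤ hcone S (some z) q ∧ hcone S (some z) q ≤ u) ↔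
      (l * S (q - cF n) ≤ (q - cF n) z ∧ (q - cF n) z ≤ u * S (q - cF n)) := by
  rw [hcone, le_div_iff₀ hq, div_le_iff₀ hq]; rfl

theorem convex_cone_box (S : Form n →ₗ[ℝ] ℝ) (l u : Sym2 (Fin n) → ℝ) :
    Convex ℝ {q : Form n | tr q = 1 ∧ 0 < S (q - cF n) ∧
      ∀ z, l z ≤ hcone S (some z) q ∧ hcone S (some z) q ≤ u z} := by
  rintro q ⟨h1, h2, h3⟩ q' ⟨h1', h2', h3'⟩ a b ha hb hab
  have hS : S (a • q + b • q' - cF n) = a * S (q - cF n) + b * S (q' - cF n) := by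
    rw [combo_sub _ _ hab, map_add, map_smul, map_smul, smul_eq_mul, smul_eq_mul]
  have hpos : 0 < S (a • q + b • q' - cF n) := by
    rw [hS]
    rcases ha.eq_or_lt with rfl | ha
    · rw [zero_add] at hab; subst hab; linarith
    · have := mul_pos ha h2
      have := mul_nonneg hb h2'.le
      linarith
  refine ⟨tr_convex h1 h1' hab, hpos, fun z => (hcone_some_mem hpos).2 ?_⟩
  have e1 := (hcone_some_mem h2).1 (h3 z)
  have e2 := (hcone_some_mem h2').1 (h3' z)
  rw [hS, combo_sub _ _ hab]
  simp only [Pi.add_apply, Pi.smul_apply, smul_eq_mul]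
  constructor <;> nlinarith

theorem SharpCone.goodCover [NeZero n] {P : Set (Form n)} {S : Form n →ₗ[ℝ] ℝ}
    (hP : SharpCone P S) {a b : ℝ} (ha : 0 < a) (hb : b < 1 / n) :
    GoodCover (U (n := n)) (hcone S) (P ∩ Zab n a b) := by
  have hne : ∀ q ∈ Zab n a b, q ≠ cF n := by
    rintro q hq rfl
    have := hq.2
    rw [mu_cF] at this
    linarith
  have hX : ∀ q ∈ Zab n a b, q ∈ X1 n := fun q hq => GE_subset_X1 ha hq.1
  have hpos : ∀ q ∈ P ∩ Zab n a b, 0 < S (q - cF n) := fun q hq =>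
    hP.pos q hq.1 (mem_GE_tr (hX q hq.2)) (hne q hq.2)
  have hScont : Continuous S := S.continuous_of_finiteDimensional
  have hzcont : ∀ z, ContinuousOn (hcone S (some z)) {q | 0 < S (q - cF n)} := fun z =>
    ContinuousOn.div (by fun_prop) (hScont.comp (by fun_prop)).continuousOn fun q hq => ne_of_gt hq
  have hcont : ∀ i, ContinuousOn (hcone S i) (P ∩ Zab n a b) := by
    rintro (_ | z)
    · exact (continuousOn_mu ha).mono fun q hq => hq.2.1
    · exact (hzcont z).mono hpos
  have hmem : ∀ q, q ∈ P ∩ Zab n a b ↔ q ∈ P ∧ q ∈ X1 n ∧ a ≤ mu q ∧ mu q ≤ b := fun q => by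
    rw [Set.mem_inter_iff, Zab, Set.mem_ofPred_eq, mem_GE_iff ha]; tauto
  refine ⟨(isCompact_Zab ha b).inter_left hP.closed, hcont, ?_, fun v => isClosed_Um ⊤ v,
    (finite_Um_inter (L := ⊤) ha).subset fun v hv => hv.mono fun q hq => ⟨hq.1, hq.2.2.1⟩,
    fun q hq => exists_mem_U (hX q hq.2), ?_⟩
  · intro q hq q' hq' h
    wlog hle : S (q' - cF n) ≤ S (q - cF n) generalizing q q'
    · exact (this q' hq' q hq (fun i => (h i).symm) (le_of_not_ge hle)).symm
    have h1 := hpos q hq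
    have h2 := hpos q' hq'
    have e : q' = cF n + (S (q' - cF n) / S (q - cF n)) • (q - cF n) := by
      ext z
      have h3 := h (some z)
      simp only [hcone] at h3
      rw [div_eq_div_iff h1.ne' h2.ne'] at h3
      simp only [Pi.add_apply, Pi.smul_apply, smul_eq_mul, Pi.sub_apply]
      field_simp
      linarith
    rcases hle.eq_or_lt with hS | hS
    · rw [hS, div_self h1.ne', one_smul] at e
      rw [e]; abel
    · exfalso
      have h3 := mu_lt_of_ray (hX q hq.2) (hq.2.2.trans_lt hb) (div_nonneg h2.le h1.le)
        ((div_lt_one h1).2 hS)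
      rw [← e] at h3
      exact h3.ne (h none)
  · intro s x l u i c q₁ q₂ hq₁ hq₂ hx₁ hx₂ hb₁ hb₂ hc₁ hc₂
    have hbx : ∀ q, q ∈ hbox (hcone S) l u ↔ (l none ≤ mu q ∧ mu q ≤ u none) ∧
        ∀ z, l (some z) ≤ hcone S (some z) q ∧ hcone S (some z) q ≤ u (some z) := fun q => by
      rw [SLCoh.hbox, Set.mem_ofPred_eq, Option.forall]; rfl
    rcases s with _ | s
    · have main : ∀ q₀ ∈ P, tr q₀ = 1 → 0 < S (q₀ - cF n) →
          (∀ z, l (some z) ≤ hcone S (some z) q₀ ∧ hcone S (some z) q₀ ≤ u (some z)) →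
          ∀ m, a ≤ m → m ≤ b → l none ≤ m → m ≤ u none → ∃ q ∈ P ∩ Zab n a b,
            q ∈ hbox (hcone S) l u ∧ mu q = m ∧ ∀ z, hcone S (some z) q = hcone S (some z) q₀ := by
        intro q₀ h0 h1 h2 h3 m hm1 hm2 hm3 hm4
        obtain ⟨q, hqP, hqX, hqm, hqz⟩ := hP.scale h0 h1 h2 (ha.trans_le hm1) (hm2.trans_lt hb)
        refine ⟨q, (hmem q).2 ⟨hqP, hqX, hqm ▸ hm1, hqm ▸ hm2⟩, (hbx q).2 ⟨?_, fun z => ?_⟩, hqm,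
          hqz⟩
        · rw [hqm]; exact ⟨hm3, hm4⟩
        · rw [hqz]; exact h3 z
      have m1 := (hmem _).1 hq₁
      have m2 := (hmem _).1 hq₂
      have b1 := (hbx _).1 hb₁
      have b2 := (hbx _).1 hb₂
      rcases i with _ | z
      · obtain ⟨q, h1, h2, h3, _⟩ := main q₁ m1.1 (mem_GE_tr m1.2.1) (hpos _ hq₁) b1.2 c
          (m1.2.2.1.trans hc₁) (hc₂.trans m2.2.2.2) (b1.1.1.trans hc₁) (hc₂.trans b2.1.2)
        exact ⟨q, h1, fun j => j.elim0, h2, h3⟩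
      · obtain ⟨q₀, ⟨h0P, h0⟩, h0c⟩ := (hP.convex.inter (convex_cone_box S (fun z => l (some z))
          fun z => u (some z))).isPreconnected.intermediate_value
          (f := hcone S (some z)) ⟨m1.1, mem_GE_tr m1.2.1, hpos _ hq₁, b1.2⟩
          ⟨m2.1, mem_GE_tr m2.2.1, hpos _ hq₂, b2.2⟩ ((hzcont z).mono fun q hq => hq.2.2.1)
          ⟨hc₁, hc₂⟩
        obtain ⟨q, h1, h2, _, h3⟩ := main q₀ h0P h0.1 h0.2.1 h0.2.2 (mu q₁) m1.2.2.1 m1.2.2.2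
          b1.1.1 b1.1.2
        exact ⟨q, h1, fun j => j.elim0, h2, (h3 z).trans h0c⟩
    · set C : Set (Form n) := {q | q ∈ P ∩ Zab n a b ∧ (∀ j, q ∈ U (x j)) ∧ q ∈ hbox (hcone S) l u}
        with hC
      have hconv : Convex ℝ C := by
        rintro q ⟨h1, h2, h3⟩ q' ⟨h1', h2', h3'⟩ r t hr ht hrt
        have m1 := (hmem _).1 h1
        have m2 := (hmem _).1 h1'
        have b1 := (hbx _).1 h3
        have b2 := (hbx _).1 h3'
        have hmu := mu_combo (h2 0) (h2' 0) hr ht hrt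
        have lo : ∀ m, m ≤ mu q → m ≤ mu q' → m ≤ mu (r • q + t • q') := fun m hm hm' => by
          rw [hmu]
          calc m = r * m + t * m := by rw [← add_mul, hrt, one_mul]
            _ ≤ _ := by gcongr
        have hi : ∀ m, mu q ≤ m → mu q' ≤ m → mu (r • q + t • q') ≤ m := fun m hm hm' => by
          rw [hmu]
          calc _ ≤ r * m + t * m := by gcongr
            _ = m := by rw [← add_mul, hrt, one_mul]
        refine ⟨(hmem _).2 ⟨hP.convex m1.1 m2.1 hr ht hrt, convex_X1 m1.2.1 m2.2.1 hr ht hrt,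
          lo _ m1.2.2.1 m2.2.2.1, hi _ m1.2.2.2 m2.2.2.2⟩,
          fun j => convex_Um ⊤ _ (h2 j) (h2' j) hr ht hrt,
          (hbx _).2 ⟨⟨lo _ b1.1.1 b2.1.1, hi _ b1.1.2 b2.1.2⟩, ?_⟩⟩
        exact (convex_cone_box S (fun z => l (some z)) (fun z => u (some z))
          ⟨mem_GE_tr m1.2.1, hpos _ h1, b1.2⟩ ⟨mem_GE_tr m2.2.1, hpos _ h1', b2.2⟩ hr ht hrt).2.2
      obtain ⟨q, ⟨h1, h2, h3⟩, hq⟩ := hconv.isPreconnected.intermediate_value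
        (f := hcone S i) ⟨hq₁, hx₁, hb₁⟩ ⟨hq₂, hx₂, hb₂⟩ ((hcont i).mono fun q hq => hq.1)
        ⟨hc₁, hc₂⟩
      exact ⟨q, h1, h2, h3, hq⟩

/-- Forms of minimum at most `b`. -/
def Zb (n : ℕ) (b : ℝ) : Set (Form n) := {q | q ∈ X1 n ∧ mu q ≤ b}

theorem SharpCone.acyc [NeZero n] {P : Set (Form n)} {S : Form n →ₗ[ℝ] ℝ}
    (hP : SharpCone P S) {b : ℝ} (hb : b < 1 / n) (s : ℕ) :
    Acyc (nerve (U (n := n)) U_neg (P ∩ Zb n b)) s := by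
  refine acyc_iUnion (fun k => nerve (U (n := n)) U_neg (P ∩ Zab n (1 / (k + 1)) b)) (fun k => ?_)
    _ (fun s x => ?_) (fun k s => (hP.goodCover (by positivity) hb).acyc s) s
  · refine nerve_mono (Set.inter_subset_inter_right _ fun q hq => ⟨GE_anti ?_ hq.1, hq.2⟩)
    push_cast
    gcongr
    linarith
  · constructor
    · rintro ⟨q, ⟨hqP, ⟨ε, hε, hq⟩, hqb⟩, hx⟩
      obtain ⟨k, hk⟩ := exists_nat_one_div_lt hε
      exact ⟨k, q, ⟨hqP, GE_anti hk.le hq, hqb⟩, hx⟩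
    · rintro ⟨k, q, ⟨hqP, hq, hqb⟩, hx⟩
      exact ⟨q, ⟨hqP, GE_subset_X1 (by positivity) hq, hqb⟩, hx⟩

end Cone

section Sphere

variable {n : ℕ}

/-- Forms whose deviation from the round form has entries in prescribed sets. -/
def orth (σ : Sym2 (Fin n) → Set ℝ) : Set (Form n) := {q | ∀ z, q z - cF n z ∈ σ z}

/-- A convex cone in the line. -/
def IsLineCone (A : Set ℝ) : Prop :=
  A = Set.univ ∨ A = {0} ∨ A = Set.Ici 0 ∨ A = Set.Iic 0

theorem IsLineCone.convex {A : Set ℝ} (h : IsLineCone A) : Convex ℝ A := by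
  rcases h with rfl | rfl | rfl | rfl
  exacts [convex_univ, convex_singleton 0, convex_Ici 0, convex_Iic 0]

theorem IsLineCone.isClosed {A : Set ℝ} (h : IsLineCone A) : IsClosed A := by
  rcases h with rfl | rfl | rfl | rfl
  exacts [isClosed_univ, isClosed_singleton, isClosed_Ici, isClosed_Iic]

theorem IsLineCone.mul_mem {A : Set ℝ} (h : IsLineCone A) {t a : ℝ} (ht : 0 ≤ t) (ha : a ∈ A) :
    t * a ∈ A := by
  rcases h with rfl | rfl | rfl | rfl
  · trivial
  · rw [Set.mem_singleton_iff] at ha ⊢; rw [ha, mul_zero]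
  · exact mul_nonneg ht ha
  · exact mul_nonpos_of_nonneg_of_nonpos ht ha

theorem IsLineCone.zero_mem {A : Set ℝ} (h : IsLineCone A) : (0 : ℝ) ∈ A := by
  rcases h with rfl | rfl | rfl | rfl <;> simp

/-- The complex of low forms in an orthant, with the empty tuple adjoined. -/
def Nv (σ : Sym2 (Fin n) → Set ℝ) (b : ℝ) : Cpx (Vec n) :=
  withEmpty (nerve (U (n := n)) U_neg (orth σ ∩ Zb n b))

theorem mem_Nv {σ : Sym2 (Fin n) → Set ℝ} {b : ℝ} {s : ℕ} {x : Fin s → Vec n} :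
    x ∈ (Nv σ b).car s ↔ s = 0 ∨ ∃ q ∈ orth σ ∩ Zb n b, ∀ i, q ∈ U (x i) := Iff.rfl

theorem Nv_mono {σ : Sym2 (Fin n) → Set ℝ} {b b' : ℝ} (h : b' ≤ b) : Nv σ b' ≤ Nv σ b := by
  intro s x hx
  rcases hx with hx | ⟨q, hq, h'⟩
  · exact Or.inl hx
  · exact Or.inr ⟨q, ⟨hq.1, hq.2.1, hq.2.2.trans h⟩, h'⟩

open Classical in
theorem Nv_sup {σ : Sym2 (Fin n) → Set ℝ} {z : Sym2 (Fin n)} (hz : σ z = Set.univ) (b : ℝ) :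
    Nv σ b = Nv (Function.update σ z (Set.Ici 0)) b ⊔ Nv (Function.update σ z (Set.Iic 0)) b := by
  have key : orth σ = orth (Function.update σ z (Set.Ici 0)) ∪
      orth (Function.update σ z (Set.Iic 0)) := by
    ext q
    simp only [orth, Set.mem_union, Set.mem_ofPred_eq, Function.update_apply]
    constructor
    · intro h
      rcases le_total 0 (q z - cF n z) with h0 | h0
      · left; intro w; split_ifs with hw
        · subst hw; exact h0
        · exact h w
      · right; intro w; split_ifs with hw
        · subst hw; exact h0
        · exact h w
    · rintro (h | h) <;> intro w <;> have := h w <;> split_ifs at this with hw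
      all_goals first | exact this | (subst hw; rw [hz]; trivial)
  ext s x
  rw [Cpx.mem_sup, mem_Nv, mem_Nv, mem_Nv, key, Set.union_inter_distrib_right]
  simp only [Set.mem_union, or_and_right, exists_or]
  exact or_or_distrib_left

open Classical in
theorem Nv_inf {σ : Sym2 (Fin n) → Set ℝ} (hσ : ∀ z, IsLineCone (σ z)) (z : Sym2 (Fin n)) (b : ℝ) :
    Nv (Function.update σ z (Set.Ici 0)) b ⊓ Nv (Function.update σ z (Set.Iic 0)) b =
      Nv (Function.update σ z {0}) b := by
  ext s x
  rw [Cpx.mem_inf, mem_Nv, mem_Nv, mem_Nv]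
  rcases s with _ | s
  · simp
  simp only [Nat.add_eq_zero_iff, one_ne_zero, and_false, false_or]
  constructor
  · rintro ⟨⟨q, ⟨hq, hqX, hqb⟩, hqx⟩, q', ⟨hq', hqX', hqb'⟩, hqx'⟩
    have h1 : 0 ≤ q z - cF n z := by simpa [Function.update_self] using hq z
    have h2 : q' z - cF n z ≤ 0 := by simpa [Function.update_self] using hq' z
    obtain ⟨r, t, hr, ht, hrt, h0⟩ : ∃ r t : ℝ, 0 ≤ r ∧ 0 ≤ t ∧ r + t = 1 ∧
        r * (q z - cF n z) + t * (q' z - cF n z) = 0 := by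
      rcases h1.eq_or_lt with h | h
      · exact ⟨1, 0, by simp, by simp, by simp, by rw [← h]; ring⟩
      · have : 0 < (q z - cF n z) - (q' z - cF n z) := by linarith
        refine ⟨-(q' z - cF n z) / ((q z - cF n z) - (q' z - cF n z)),
          (q z - cF n z) / ((q z - cF n z) - (q' z - cF n z)), div_nonneg (by linarith) this.le,
          div_nonneg h1 this.le, ?_, ?_⟩
        · field_simp; ring
        · field_simp; ring
    have e : ∀ w, (r • q + t • q') w - cF n w = r * (q w - cF n w) + t * (q' w - cF n w) := by
      intro w
      simp only [Pi.add_apply, Pi.smul_apply, smul_eq_mul]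
      linear_combination cF n w * hrt
    refine ⟨r • q + t • q', ⟨fun w => ?_, convex_X1 hqX hqX' hr ht hrt, ?_⟩, fun i =>
      convex_Um ⊤ _ (hqx i) (hqx' i) hr ht hrt⟩
    · rw [e]
      have a1 := hq w
      have a2 := hq' w
      rw [Function.update_apply] at a1 a2 ⊢
      split_ifs at a1 a2 ⊢ with hw
      · subst hw; exact h0
      · exact (hσ w).convex a1 a2 hr ht hrt
    · rw [mu_combo (hqx 0) (hqx' 0) hr ht hrt]
      calc r * mu q + t * mu q' ≤ r * b + t * b := by gcongr
        _ = b := by rw [← add_mul, hrt, one_mul]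
  · rintro ⟨q, ⟨hq, hqX⟩, hqx⟩
    refine ⟨⟨q, ⟨fun w => ?_, hqX⟩, hqx⟩, q, ⟨fun w => ?_, hqX⟩, hqx⟩ <;>
    · have a := hq w
      rw [Function.update_apply] at a ⊢
      split_ifs at a ⊢ with hw
      · rw [Set.mem_singleton_iff] at a; rw [a]; simp
      · exact a

variable [NeZero n]

/-- The corner index. -/
def z00 (n : ℕ) [NeZero n] : Sym2 (Fin n) := s(0, 0)

open Classical in
theorem eq_cF_of_eq_off_corner {q : Form n} (hq : tr q = 1)
    (h : ∀ z, z ≠ z00 n → q z = cF n z) : q = cF n := by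
  have h1 : tr q = tr (cF n) := by rw [hq, tr_cF]
  have h2 : q (z00 n) = cF n (z00 n) := by
    rw [tr, tr, ← Finset.add_sum_erase _ _ (Finset.mem_univ (0 : Fin n)),
      ← Finset.add_sum_erase _ (fun i => cF n s(i, i)) (Finset.mem_univ (0 : Fin n))] at h1
    have h3 : ∑ i ∈ Finset.univ.erase (0 : Fin n), q s(i, i) =
        ∑ i ∈ Finset.univ.erase (0 : Fin n), cF n s(i, i) :=
      Finset.sum_congr rfl fun i hi => h _ (by
        intro he
        rw [z00, Sym2.eq_iff] at he
        exact Finset.ne_of_mem_erase hi (by tauto))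
    rw [h3] at h1
    exact add_right_cancel h1
  ext z
  by_cases hz : z = z00 n
  · rw [hz, h2]
  · exact h z hz

open Classical in
theorem exists_mem_Nv {σ : Sym2 (Fin n) → Set ℝ} {b : ℝ} (hσ : ∀ z, IsLineCone (σ z))
    (h0 : σ (z00 n) = Set.univ) {z : Sym2 (Fin n)} (hz : z ≠ z00 n) (hz0 : σ z ≠ {0})
    (hb : 0 < b) (hbn : b < 1 / n) : (orth σ ∩ Zb n b).Nonempty := by
  obtain ⟨a, ha, ha0⟩ : ∃ a ∈ σ z, a ≠ 0 := by
    by_contra hc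
    push Not at hc
    exact hz0 (Set.eq_singleton_iff_unique_mem.2 ⟨(hσ z).zero_mem, hc⟩)
  set d : Form n := fun w => if w = z then a else if w = z00 n ∧ z.IsDiag then -a else 0 with hd
  have hdz : d z = a := by simp [hd]
  have htr : tr d = 0 := by
    by_cases hdiag : z.IsDiag
    · obtain ⟨i, rfl⟩ : ∃ i, z = Sym2.diag i := by
        induction z using Sym2.ind with
        | _ i j => exact ⟨i, by rw [(Sym2.mk_isDiag_iff.1 hdiag : i = j)]; rfl⟩
      have hi : i ≠ 0 := by rintro rfl; exact hz rfl
      have e : ∀ j, d s(j, j) = (if j = i then a else 0) + (if j = 0 then -a else 0) := by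
        intro j
        have e1 : (s(j, j) = Sym2.diag i) ↔ j = i := by
          rw [Sym2.diag, Sym2.eq_iff]; tauto
        have e2 : (s(j, j) = z00 n) ↔ j = 0 := by
          rw [z00, Sym2.eq_iff]; tauto
        simp only [hd, e1, e2, hdiag, and_true]
        split_ifs with h1 h2 <;> simp_all
      rw [tr, Finset.sum_congr rfl fun j _ => e j, Finset.sum_add_distrib]
      simp
    · rw [tr]
      refine Finset.sum_eq_zero fun j _ => ?_
      have : s(j, j) ≠ z := by rintro rfl; exact hdiag rfl
      simp [hd, this, hdiag]
  obtain ⟨t, ht, h1, h2⟩ := exists_ray_level htr (fun h => ha0 (by rw [← hdz, h]; rfl)) hb hbn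
  refine ⟨_, fun w => ?_, h1, h2.le⟩
  rw [Pi.add_apply, Pi.smul_apply, add_sub_cancel_left, smul_eq_mul]
  refine (hσ w).mul_mem ht.le ?_
  simp only [hd]
  split_ifs with h3 h4
  · rw [h3]; exact ha
  · rw [h4.1, h0]; trivial
  · exact (hσ w).zero_mem

open Classical in
theorem sharpCone_orth {σ : Sym2 (Fin n) → Set ℝ} (hσ : ∀ z, IsLineCone (σ z))
    (h0 : σ (z00 n) = Set.univ) (h1 : ∀ z, z ≠ z00 n → σ z ≠ Set.univ) :
    ∃ S, SharpCone (orth σ) S := by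
  set e : Sym2 (Fin n) → ℝ := fun z => if σ z = Set.Iic 0 then -1 else 1 with he
  have hse : ∀ z, z ≠ z00 n → ∀ t ∈ σ z, 0 ≤ e z * t ∧ (e z * t = 0 → t = 0) := by
    intro z hz t ht
    have hez : e z = -1 ∨ e z = 1 := by simp only [he]; split_ifs <;> simp
    refine ⟨?_, fun h => ?_⟩
    · rcases hσ z with h | h | h | h
      · exact absurd h (h1 z hz)
      · rw [h, Set.mem_singleton_iff] at ht; rw [ht, mul_zero]
      · have : e z = 1 := by
          simp only [he]; rw [if_neg]
          rw [h]; intro hc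
          have : (1 : ℝ) ∈ Set.Iic (0 : ℝ) := hc ▸ (zero_le_one : (0 : ℝ) ≤ 1)
          exact absurd this (by norm_num)
        rw [this, one_mul]; rw [h] at ht; exact ht
      · have : e z = -1 := by simp only [he]; rw [if_pos h]
        rw [h] at ht
        have := ht.out
        simp_all
    · rcases hez with h' | h' <;> rw [h'] at h <;> linarith
  refine ⟨∑ z ∈ Finset.univ.erase (z00 n), e z • LinearMap.proj z, ?_, ?_, ?_, ?_⟩
  · rw [orth, Set.ofPred_forall]
    exact isClosed_iInter fun z => (hσ z).isClosed.preimage (by fun_prop)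
  · intro q hq q' hq' r t hr ht hrt z
    have : (r • q + t • q') z - cF n z = r • (q z - cF n z) + t • (q' z - cF n z) :=
      congrFun (combo_sub q q' hrt) z
    rw [this]
    exact (hσ z).convex (hq z) (hq' z) hr ht hrt
  · intro q hq t ht z
    rw [Pi.add_apply, Pi.smul_apply, add_sub_cancel_left, smul_eq_mul]
    exact (hσ z).mul_mem ht (hq z)
  · intro q hq htr hne
    simp only [LinearMap.sum_apply, LinearMap.smul_apply, LinearMap.proj_apply, smul_eq_mul]
    have hnn : ∀ z ∈ Finset.univ.erase (z00 n), 0 ≤ e z * (q - cF n) z := fun z hz =>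
      (hse z (Finset.ne_of_mem_erase hz) _ (hq z)).1
    refine lt_of_le_of_ne (Finset.sum_nonneg hnn) fun h => hne ?_
    refine eq_cF_of_eq_off_corner htr fun z hz => ?_
    have := (Finset.sum_eq_zero_iff_of_nonneg hnn).1 h.symm z
      (Finset.mem_erase.2 ⟨hz, Finset.mem_univ z⟩)
    exact sub_eq_zero.1 ((hse z hz _ (hq z)).2 this)

open Classical in
theorem acyc_Nv {b : ℝ} (hb : 0 < b) (hbn : b < 1 / n) (T : Finset (Sym2 (Fin n))) :
    ∀ σ : Sym2 (Fin n) → Set ℝ, (∀ z, IsLineCone (σ z)) → σ (z00 n) = Set.univ →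
      (∀ z, z ≠ z00 n → (σ z = Set.univ ↔ z ∈ T)) → z00 n ∉ T →
      (∃ z, σ z = Set.Ici 0 ∨ σ z = Set.Iic 0) → ∀ s, Acyc (Nv σ b) s := by
  have hI1 : (Set.Ici (0 : ℝ)) ≠ Set.univ := fun h => by
    have : (-1 : ℝ) ∈ Set.Ici (0 : ℝ) := h ▸ Set.mem_univ _
    exact absurd this (by norm_num)
  have hI2 : (Set.Iic (0 : ℝ)) ≠ Set.univ := fun h => by
    have : (1 : ℝ) ∈ Set.Iic (0 : ℝ) := h ▸ Set.mem_univ _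
    exact absurd this (by norm_num)
  have hI3 : ({0} : Set ℝ) ≠ Set.univ := fun h => by
    have : (1 : ℝ) ∈ ({0} : Set ℝ) := h ▸ Set.mem_univ _
    exact absurd this (by norm_num)
  induction T using Finset.induction_on with
  | empty =>
    rintro σ hσ h0 hT - ⟨z, hz⟩ s
    obtain ⟨S, hS⟩ := sharpCone_orth hσ h0 fun z hz h => by simpa using (hT z hz).1 h
    have hz0 : z ≠ z00 n := by rintro rfl; rcases hz with hz | hz <;> simp_all
    obtain ⟨q, hq⟩ := exists_mem_Nv hσ h0 hz0 (by
      rcases hz with hz | hz <;> rw [hz] <;> intro h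
      · have : (1 : ℝ) ∈ ({0} : Set ℝ) := h ▸ (zero_le_one : (0 : ℝ) ≤ 1)
        exact absurd this (by norm_num)
      · have : (-1 : ℝ) ∈ ({0} : Set ℝ) := h ▸ (by norm_num : (-1 : ℝ) ≤ 0)
        exact absurd this (by norm_num)) hb hbn
    rw [Nv, withEmpty_eq ⟨Fin.elim0, mem_nerve.2 ⟨q, hq, fun i => i.elim0⟩⟩]
    exact hS.acyc hbn s
  | insert z T hzT ih =>
    rintro σ hσ h0 hT h0T ⟨w, hw⟩ s
    have hz : z ≠ z00 n := fun h => h0T (h ▸ Finset.mem_insert_self _ _)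
    have hzu : σ z = Set.univ := (hT z hz).2 (Finset.mem_insert_self _ _)
    have hwz : w ≠ z := by rintro rfl; rcases hw with hw | hw <;> rw [hzu] at hw <;> simp_all
    have step : ∀ A : Set ℝ, IsLineCone A → A ≠ Set.univ → ∀ s,
        Acyc (Nv (Function.update σ z A) b) s := by
      intro A hA hAu s
      refine ih _ (fun y => ?_) ?_ (fun y hy => ?_) (fun h => h0T (Finset.mem_insert_of_mem h))
        ⟨w, ?_⟩ s
      · rw [Function.update_apply]; split_ifs
        exacts [hA, hσ y]
      · rw [Function.update_of_ne hz.symm, h0]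
      · rw [Function.update_apply]; split_ifs with hyz
        · subst hyz; simp [hAu, hzT]
        · rw [hT y hy, Finset.mem_insert]; tauto
      · rwa [Function.update_of_ne hwz]
    have s1 := step (Set.Ici 0) (by simp [IsLineCone]) hI1
    have s2 := step (Set.Iic 0) (by simp [IsLineCone]) hI2
    have s3 := step {0} (by simp [IsLineCone]) hI3
    rw [Nv_sup hzu]
    cases s with
    | zero => exact acyc_sup_zero (s1 0) (s2 0)
    | succ s => exact acyc_sup_succ (s1 _) (s2 _) (by rw [Nv_inf hσ]; exact s3 s)

open Classical in
/-- The cones constraining all the entries outside `F` and the corner. -/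
noncomputable def flat (F : Finset (Sym2 (Fin n))) : Sym2 (Fin n) → Set ℝ :=
  fun z => if z = z00 n ∨ z ∈ F then Set.univ else {0}

theorem flat_isLineCone (F : Finset (Sym2 (Fin n))) (z : Sym2 (Fin n)) : IsLineCone (flat F z) := by
  rw [flat]; split_ifs <;> simp [IsLineCone]

open Classical in
theorem flat_insert {F : Finset (Sym2 (Fin n))} {z : Sym2 (Fin n)} (hz : z ≠ z00 n) (hzF : z ∉ F) :
    Function.update (flat (insert z F)) z {0} = flat F := by
  ext1 w
  rw [Function.update_apply]
  split_ifs with h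
  · subst h; simp [flat, hz, hzF]
  · simp [flat, h]

theorem orth_flat_empty {b : ℝ} (hbn : b < 1 / n) : orth (flat ∅) ∩ Zb n b = ∅ := by
  rw [Set.eq_empty_iff_forall_notMem]
  rintro q ⟨hq, hqX, hqb⟩
  have : q = cF n := eq_cF_of_eq_off_corner (mem_GE_tr hqX) fun z hz => by
    have := hq z
    simp only [flat, hz, false_or, Finset.notMem_empty, if_false, Set.mem_singleton_iff] at this
    linarith
  rw [this, mu_cF] at hqb
  linarith

open Classical in
theorem acyc_flat_update {b : ℝ} (hb : 0 < b) (hbn : b < 1 / n) {F : Finset (Sym2 (Fin n))}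
    {z : Sym2 (Fin n)} (hz : z ≠ z00 n) (hF : z00 n ∉ F) (hzF : z ∉ F) {A : Set ℝ}
    (hA : A = Set.Ici 0 ∨ A = Set.Iic 0) (s : ℕ) :
    Acyc (Nv (Function.update (flat (insert z F)) z A) b) s := by
  have hAu : A ≠ Set.univ := by
    rintro rfl
    rcases hA with h | h
    · have : (-1 : ℝ) ∈ Set.Ici (0 : ℝ) := h ▸ Set.mem_univ _
      exact absurd this (by norm_num)
    · have : (1 : ℝ) ∈ Set.Iic (0 : ℝ) := h ▸ Set.mem_univ _
      exact absurd this (by norm_num)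
  have hu : ({0} : Set ℝ) ≠ Set.univ := fun h => by
    have : (1 : ℝ) ∈ ({0} : Set ℝ) := h ▸ Set.mem_univ _
    exact absurd this (by norm_num)
  refine acyc_Nv hb hbn F _ (fun w => ?_) ?_ (fun w hw => ?_) hF ⟨z, ?_⟩ s
  · rw [Function.update_apply]; split_ifs
    · rcases hA with rfl | rfl <;> simp [IsLineCone]
    · exact flat_isLineCone _ _
  · rw [Function.update_of_ne hz.symm]; simp [flat]
  · rw [Function.update_apply]; split_ifs with h
    · subst h; simp [hAu, hzF]
    · simp only [flat, hw, h, false_or, Finset.mem_insert]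
      split_ifs with h' <;> simp [h', hu]
  · rw [Function.update_self]; exact hA

open Classical in
theorem flat_sup {F : Finset (Sym2 (Fin n))} {z : Sym2 (Fin n)} (b : ℝ) :
    Nv (flat (insert z F)) b = Nv (Function.update (flat (insert z F)) z (Set.Ici 0)) b ⊔
      Nv (Function.update (flat (insert z F)) z (Set.Iic 0)) b :=
  Nv_sup (by simp [flat]) b

open Classical in
theorem flat_inf {F : Finset (Sym2 (Fin n))} {z : Sym2 (Fin n)} (hz : z ≠ z00 n) (hzF : z ∉ F)
    (b : ℝ) : Nv (Function.update (flat (insert z F)) z (Set.Ici 0)) b ⊓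
      Nv (Function.update (flat (insert z F)) z (Set.Iic 0)) b = Nv (flat F) b := by
  rw [Nv_inf (flat_isLineCone _), flat_insert hz hzF]

open Classical in
theorem acyc_flat {b : ℝ} (hb : 0 < b) (hbn : b < 1 / n) (F : Finset (Sym2 (Fin n)))
    (hF : z00 n ∉ F) : ∀ t, t ≠ F.card → Acyc (Nv (flat F) b) t := by
  induction F using Finset.induction_on with
  | empty =>
    intro t ht f _ _
    refine isCob_of_zero _ fun x hx => ?_
    rw [mem_Nv, orth_flat_empty hbn] at hx
    simp at hx
    simp at ht
    exact absurd hx ht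
  | insert z F hzF ih =>
    intro t ht
    have hz : z ≠ z00 n := fun h => hF (h ▸ Finset.mem_insert_self _ _)
    have hF' : z00 n ∉ F := fun h => hF (Finset.mem_insert_of_mem h)
    have s1 := acyc_flat_update hb hbn hz hF' hzF (Or.inl rfl)
    have s2 := acyc_flat_update hb hbn hz hF' hzF (Or.inr rfl)
    rw [flat_sup]
    rw [Finset.card_insert_of_notMem hzF] at ht
    cases t with
    | zero => exact acyc_sup_zero (s1 0) (s2 0)
    | succ t => exact acyc_sup_succ (s1 _) (s2 _) (by
        rw [flat_inf hz hzF]; exact ih hF' t (by omega))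

open Classical in
theorem gen_flat {b : ℝ} (hb : 0 < b) (hbn : b < 1 / n) (k : ℕ) :
    ∀ F : Finset (Sym2 (Fin n)), z00 n ∉ F → F.card = k → ∃ ω : (Fin k → Vec n) → ℚ,
      ∀ b', 0 < b' → b' ≤ b → Gen (Nv (flat F) b') ω := by
  induction k with
  | zero =>
    intro F hF hk
    obtain rfl := Finset.card_eq_zero.1 hk
    refine ⟨fun _ => 1, fun b' hb' hle => ⟨AE.of_size_zero _, fun x hx => ?_, fun h => ?_,
      fun f _ _ => ⟨f default, fun x _ => ?_⟩⟩⟩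
    · rw [mem_Nv, orth_flat_empty (hle.trans_lt hbn)] at hx
      simp at hx
    · exact absurd (h default (Or.inl rfl)) one_ne_zero
    · rw [Subsingleton.elim x default]; simp
  | succ k ih =>
    intro F hF hk
    obtain ⟨z, F, hzF, rfl, hFk⟩ := Finset.card_eq_succ.1 hk
    have hz : z ≠ z00 n := fun h => hF (h ▸ Finset.mem_insert_self _ _)
    have hF' : z00 n ∉ F := fun h => hF (Finset.mem_insert_of_mem h)
    obtain ⟨ω, hω⟩ := ih F hF' hFk
    set A : ℝ → Cpx (Vec n) := Nv (Function.update (flat (insert z F)) z (Set.Ici 0)) with hA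
    set B : ℝ → Cpx (Vec n) := Nv (Function.update (flat (insert z F)) z (Set.Iic 0)) with hB
    have hinf : ∀ b, A b ⊓ B b = Nv (flat F) b := flat_inf hz hzF
    have hω0 := hω b hb le_rfl
    set ω₁ := paste ((Nv (flat F) b).car k) ω 0 with hω₁
    have hAE : AE ω₁ := AE.paste _ hω0.ae AE.zero
    have e₁ : ∀ x ∈ (Nv (flat F) b).car k, ω₁ x = ω x := fun x hx => paste_of_mem hx
    refine ⟨paste ((A b).car (k + 1)) (del ω₁) 0, fun b' hb' hle => ?_⟩
    rw [flat_sup]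
    have hmA : A b' ≤ A b := Nv_mono hle
    have hmB : B b' ≤ B b := Nv_mono hle
    refine Gen.susp (ω := ω) (ω₁ := ω₁)
      (acyc_flat_update hb' (hle.trans_lt hbn) hz hF' hzF (Or.inl rfl))
      (acyc_flat_update hb' (hle.trans_lt hbn) hz hF' hzF (Or.inr rfl)) ?_ hAE (fun x hx => ?_)
      (AE.paste _ hAE.del AE.zero) (fun x hx => ?_) (fun x hx => ?_)
    · rw [flat_inf hz hzF]; exact hω b' hb' hle
    · refine e₁ x ?_
      rw [← hinf b]
      exact ⟨hmA _ hx.1, hmB _ hx.2⟩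
    · exact paste_of_mem (hmA _ hx)
    · by_cases hxA : x ∈ (A b).car (k + 1)
      · rw [paste_of_mem hxA, (Nv (flat F) b).del_congr e₁ (by
          rw [← hinf b]; exact ⟨hxA, hmB _ hx⟩), hω0.closed x (by
          rw [← hinf b]; exact ⟨hxA, hmB _ hx⟩)]
      · rw [paste_of_notMem hxA]; rfl

/-- The complex of tuples of simultaneous minimal vectors of forms of small minimum. -/
def Kb (n : ℕ) (b : ℝ) : Cpx (Vec n) := nerve (U (n := n)) U_neg (Zb n b)

/-- The Euler number of tuples of the small-minimum complex. -/
def M (n : ℕ) : ℕ := n * (n + 1) / 2 - 1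

open Classical in
/-- The complex of forms of small minimum has the cohomology of a sphere. -/
theorem sphere (hn : 2 ≤ n) {b : ℝ} (hb : 0 < b) (hbn : b < 1 / n) :
    ∃ ω : (Fin (M n) → Vec n) → ℚ, ∀ b', 0 < b' → b' ≤ b →
      Gen (Kb n b') ω ∧ ∀ t, t ≠ M n → Acyc (Kb n b') t := by
  set F : Finset (Sym2 (Fin n)) := Finset.univ.erase (z00 n) with hF
  have hzF : z00 n ∉ F := Finset.notMem_erase _ _
  have hcard : F.card = M n := by
    rw [hF, Finset.card_erase_of_mem (Finset.mem_univ _), Finset.card_univ, Sym2.card,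
      Fintype.card_fin, M, Nat.choose_two_right, Nat.add_sub_cancel, mul_comm]
  have huniv : ∀ z, flat F z = Set.univ := by
    intro z
    simp only [flat, hF, Finset.mem_erase, Finset.mem_univ, and_true]
    rw [if_pos (Classical.em _)]
  have hNv : ∀ b', 0 < b' → b' ≤ b → Nv (flat F) b' = Kb n b' := by
    intro b' hb' hle
    have ho : orth (flat F) = Set.univ := Set.eq_univ_of_forall fun q z => by
      rw [huniv]; trivial
    obtain ⟨q, hq⟩ := exists_mem_Nv (flat_isLineCone F) (huniv _)
      (z := s(⟨0, by omega⟩, ⟨1, by omega⟩))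
      (by
        rw [z00, Ne, Sym2.eq_iff]
        rintro (⟨_, h⟩ | ⟨_, h⟩) <;> simp [Fin.ext_iff] at h) (by
        rw [huniv]; intro h
        have : (1 : ℝ) ∈ ({0} : Set ℝ) := h ▸ Set.mem_univ _
        exact absurd this (by norm_num)) hb' (hle.trans_lt hbn)
    rw [ho, Set.univ_inter] at hq
    rw [Nv, ho, Set.univ_inter, withEmpty_eq ⟨Fin.elim0, mem_nerve.2 ⟨q, hq, fun i => i.elim0⟩⟩, Kb]
  obtain ⟨ω, hω⟩ := gen_flat hb hbn (M n) F hzF hcard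
  refine ⟨ω, fun b' hb' hle => ?_⟩
  rw [← hNv b' hb' hle]
  refine ⟨hω b' hb' hle, ?_⟩
  rw [← hcard]
  exact acyc_flat hb' (hle.trans_lt hbn) F hzF

end Sphere

section Chains

variable {n : ℕ}

/-- The complex of all tuples of simultaneous minimal vectors. -/
abbrev KK (n : ℕ) : Cpx (Vec n) := KL (⊤ : Submodule ℚ (Fin n → ℚ))

/-- Spanning tuples of simultaneous minimal vectors. -/
def KS (n s : ℕ) : Set (Fin s → Vec n) := {x | x ∈ (KK n).car s ∧ qspan x = ⊤}

/-- Alternating even finitely supported functions on spanning tuples. -/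
def D (n s : ℕ) : Submodule ℚ ((Fin s → Vec n) → ℚ) where
  carrier := {f | AE f ∧ f.support.Finite ∧ ∀ x, f x ≠ 0 → x ∈ KS n s}
  zero_mem' := ⟨AE.zero, by simp, fun x hx => absurd rfl hx⟩
  add_mem' := by
    rintro f g ⟨h1, h2, h3⟩ ⟨h1', h2', h3'⟩
    refine ⟨h1.add h1', (h2.union h2').subset (Function.support_add f g), fun x hx => ?_⟩
    by_cases h : f x = 0
    · exact h3' x fun h' => hx (by rw [Pi.add_apply, h, h', add_zero])
    · exact h3 x h
  smul_mem' := by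
    rintro c f ⟨h1, h2, h3⟩
    refine ⟨h1.smul c, h2.subset (Function.support_const_smul_subset c f), fun x hx => h3 x ?_⟩
    rintro h
    exact hx (by rw [Pi.smul_apply, h, smul_zero])

theorem D_zero {s : ℕ} {f : (Fin s → Vec n) → ℚ} (hf : f ∈ D n s) {x} (hx : x ∉ KS n s) :
    f x = 0 := by
  by_contra h
  exact hx (hf.2.2 x h)

variable [NeZero n]

theorem nonspanning_low (hn : 2 ≤ n) {s : ℕ} {x : Fin s → Vec n} (hx : x ∈ (KK n).car s)
    (hxS : qspan x ≠ ⊤) {ε : ℝ} (hε : 0 < ε) : x ∈ (Kb n ε).car s := by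
  obtain ⟨q, hq, h⟩ := hx
  rcases le_total (mu q) ε with h' | h'
  · exact ⟨q, ⟨hq, h'⟩, h⟩
  · obtain ⟨q', hq', h1, h2⟩ := exists_level_of_nonspanning hn hxS hq h hε h'
    exact ⟨q', ⟨hq', h2.le⟩, h1⟩

theorem Kb_le (ε : ℝ) : Kb n ε ≤ KK n := nerve_mono fun q hq => hq.1

theorem Kb_mono {ε ε' : ℝ} (h : ε ≤ ε') : Kb n ε ≤ Kb n ε' :=
  nerve_mono fun q hq => ⟨hq.1, hq.2.trans h⟩

theorem mem_D_of_low (hn : 2 ≤ n) {s : ℕ} {f : (Fin s → Vec n) → ℚ} (hf : AE f)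
    (h0 : ∀ x ∉ (KK n).car s, f x = 0) {ε : ℝ} (hε : 0 < ε)
    (h : ∀ x ∈ (Kb n ε).car s, f x = 0) : f ∈ D n s := by
  refine ⟨hf, ?_, fun x hx => ?_⟩
  · refine (Set.Finite.pi fun _ : Fin s => finite_Um_inter (n := n)
      (L := (⊤ : Submodule ℚ (Fin n → ℚ))) hε).subset fun x hx i _ => ?_
    have hxK : x ∈ (KK n).car s := by
      by_contra hc
      exact hx (h0 x hc)
    obtain ⟨q, hq, hqx⟩ := hxK
    refine ⟨q, hqx i, (mem_GE_iff hε).2 ⟨hq, ?_⟩⟩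
    by_contra hc
    push Not at hc
    exact hx (h x ⟨q, ⟨hq, hc.le⟩, hqx⟩)
  · have hxK : x ∈ (KK n).car s := by
      by_contra hc
      exact hx (h0 x hc)
    refine ⟨hxK, ?_⟩
    by_contra hc
    exact hx (h x (nonspanning_low hn hxK hc hε))

theorem D_low {s : ℕ} {f : (Fin s → Vec n) → ℚ} (hf : f ∈ D n s) {b : ℝ} (hb : 0 < b) :
    ∃ ε, 0 < ε ∧ ε ≤ b ∧ ∀ x ∈ (Kb n ε).car s, f x = 0 := by
  have key : ∀ T : Finset (Fin s → Vec n), (∀ x ∈ T, qspan x = ⊤) →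
      ∃ ε, 0 < ε ∧ ε ≤ b ∧ ∀ x ∈ T, x ∉ (Kb n ε).car s := by
    classical
    intro T
    induction T using Finset.induction_on with
    | empty => exact fun _ => ⟨b, hb, le_rfl, by simp⟩
    | insert x T _ ih =>
      intro hT
      obtain ⟨ε, h1, h2, h3⟩ := ih fun y hy => hT y (Finset.mem_insert_of_mem hy)
      obtain ⟨ε', h1', h'⟩ := exists_lower_bound_of_spanning (hT x (Finset.mem_insert_self _ _))
      refine ⟨min ε ε', lt_min h1 h1', (min_le_left _ _).trans h2, fun y hy hyK => ?_⟩
      rcases Finset.mem_insert.1 hy with rfl | hy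
      · obtain ⟨q, hq, hqy⟩ := hyK
        exact absurd (h' q hq.1 hqy) (not_lt.2 (hq.2.trans (min_le_right _ _)))
      · exact h3 y hy (Kb_mono (min_le_left _ _) _ hyK)
  obtain ⟨ε, h1, h2, h3⟩ := key hf.2.1.toFinset fun x hx => (hf.2.2 x (by simpa using hx)).2
  refine ⟨ε, h1, h2, fun x hx => ?_⟩
  by_contra hc
  exact h3 x (by simpa using hc) hx

theorem paste_mem_D (hn : 2 ≤ n) {s : ℕ} {f : (Fin s → Vec n) → ℚ} (hf : AE f) {ε : ℝ} (hε : 0 < ε)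
    (h : ∀ x ∈ (Kb n ε).car s, f x = 0) : paste ((KK n).car s) f 0 ∈ D n s :=
  mem_D_of_low hn (AE.paste _ hf AE.zero) (fun x hx => by rw [paste_of_notMem hx]; rfl) hε
    fun x hx => by rw [paste_of_mem (Kb_le ε _ hx), h x hx]

theorem paste_del_mem_D (hn : 2 ≤ n) {s : ℕ} {f : (Fin s → Vec n) → ℚ} (hf : f ∈ D n s) :
    paste ((KK n).car (s + 1)) (del f) 0 ∈ D n (s + 1) := by
  obtain ⟨ε, hε, _, h⟩ := D_low hf one_pos
  exact paste_mem_D hn hf.1.del hε fun x hx => (Kb n ε).del_eq_zero h hx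

theorem paste_add {V : Type*} [AddCommGroup V] {s : ℕ} (S : Set (Fin s → V))
    (f g : (Fin s → V) → ℚ) :
    paste S (f + g) 0 = paste S f 0 + paste S g 0 := by
  ext x
  by_cases hx : x ∈ S
  · simp [paste_of_mem hx]
  · simp [paste_of_notMem hx]

theorem paste_smul {V : Type*} [AddCommGroup V] {s : ℕ} (S : Set (Fin s → V)) (c : ℚ)
    (f : (Fin s → V) → ℚ) :
    paste S (c • f) 0 = c • paste S f 0 := by
  ext x
  by_cases hx : x ∈ S
  · simp [paste_of_mem hx]
  · simp [paste_of_notMem hx]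

/-- The coboundary of finitely supported functions. -/
noncomputable def dD (hn : 2 ≤ n) (s : ℕ) : D n s →ₗ[ℚ] D n (s + 1) where
  toFun f := ⟨paste ((KK n).car (s + 1)) (del f.1) 0, paste_del_mem_D hn f.2⟩
  map_add' f g := Subtype.ext (by
    change paste _ (del (f.1 + g.1)) 0 = _
    rw [map_add, paste_add]; rfl)
  map_smul' c f := Subtype.ext (by
    change paste _ (del (c • f.1)) 0 = _
    rw [map_smul, paste_smul]; rfl)

theorem dD_apply (hn : 2 ≤ n) {s : ℕ} (f : D n s) {x : Fin (s + 1) → Vec n}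
    (hx : x ∈ (KK n).car (s + 1)) : (dD hn s f).1 x = del f.1 x := paste_of_mem hx

theorem D_ext {s : ℕ} {f g : D n s} (h : ∀ x ∈ (KK n).car s, f.1 x = g.1 x) : f = g := by
  ext x
  by_cases hx : x ∈ (KK n).car s
  · exact h x hx
  · rw [D_zero f.2 fun h => hx h.1, D_zero g.2 fun h => hx h.1]

theorem dD_dD (hn : 2 ≤ n) {s : ℕ} (f : D n s) : dD hn (s + 1) (dD hn s f) = 0 :=
  D_ext fun x hx => by
    rw [dD_apply hn _ hx, (KK n).del_congr (fun y hy => dD_apply hn f hy) hx, del_del]; rfl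

theorem acyc_KK (s : ℕ) : Acyc (KK n) s := acyc_KL top_nontriv s

theorem dD_exact (hn : 2 ≤ n) {k : ℕ} {b : ℝ} (hb : 0 < b)
    (hK : ∀ b', 0 < b' → b' ≤ b → ∀ t, t ≠ k → Acyc (Kb n b') t) {t : ℕ} (ht : t ≠ k)
    {f : D n (t + 1)} (hf : dD hn (t + 1) f = 0) : ∃ g, dD hn t g = f := by
  obtain ⟨ε, h1, h2, h3⟩ := D_low f.2 hb
  obtain ⟨g, hg, hgB, hgf⟩ := rel_acyc (Kb_le ε) (acyc_KK (t + 1)) (hK ε h1 h2 t ht) f.2.1 h3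
    fun x hx => by rw [← dD_apply hn f hx, hf]; rfl
  refine ⟨⟨_, paste_mem_D hn hg h1 hgB⟩, D_ext fun x hx => ?_⟩
  rw [dD_apply hn _ hx, hgf x hx]
  exact (KK n).del_congr (fun y hy => paste_of_mem hy) hx

theorem top_class (hn : 2 ≤ n) {k : ℕ} {b : ℝ} (hb : 0 < b) {ω : (Fin (k + 1) → Vec n) → ℚ}
    (hω : ∀ b', 0 < b' → b' ≤ b → Gen (Kb n b') ω) :
    ∃ φ : D n (k + 2), dD hn (k + 2) φ = 0 ∧ (∀ g, dD hn (k + 1) g ≠ φ) ∧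
      ∀ f : D n (k + 2), dD hn (k + 2) f = 0 → ∃ c : ℚ, ∃ g, dD hn (k + 1) g = f - c • φ := by
  have G := hω b hb le_rfl
  set w := paste ((Kb n b).car (k + 1)) ω 0 with hw
  have hwAE : AE w := AE.paste _ G.ae AE.zero
  have hwω : ∀ x ∈ (Kb n b).car (k + 1), w x = ω x := fun x hx => paste_of_mem hx
  have hφm : paste ((KK n).car (k + 2)) (del w) 0 ∈ D n (k + 2) :=
    paste_mem_D hn hwAE.del hb fun x hx => by rw [(Kb n b).del_congr hwω hx, G.closed x hx]
  set φ : D n (k + 2) := ⟨_, hφm⟩ with hφ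
  have hφw : ∀ x ∈ (KK n).car (k + 2), φ.1 x = del w x := fun x hx => paste_of_mem hx
  refine ⟨φ, D_ext fun x hx => ?_, fun g hg => ?_, fun f hf => ?_⟩
  · rw [dD_apply hn _ hx, (KK n).del_congr hφw hx, del_del]; rfl
  · have hc : IsCob (KK n) (w - g.1) := acyc_KK _ _ (hwAE.sub g.2.1) fun x hx => by
      rw [map_sub, Pi.sub_apply, ← hφw x hx, ← hg, dD_apply hn g hx, sub_self]
    obtain ⟨ε, h1, h2, h3⟩ := D_low g.2 hb
    refine (hω ε h1 h2).not_cob (isCob_congr _ (fun x hx => ?_) (IsCob.mono (Kb_le ε _) hc))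
    rw [Pi.sub_apply, h3 x hx, sub_zero, hwω x (Kb_mono h2 _ hx)]
  · obtain ⟨ε, h1, h2, h3⟩ := D_low f.2 hb
    obtain ⟨g, hg, hgf⟩ := acyc_KK (k + 2) f.1 f.2.1 fun x hx => by
      rw [← dD_apply hn f hx, hf]; rfl
    obtain ⟨c, p, hp, hgp⟩ := (hω ε h1 h2).gen g hg fun x hx => by
      rw [← hgf x (Kb_le ε _ hx), h3 x hx]
    refine ⟨c, ⟨_, paste_mem_D hn ((hg.sub (hwAE.smul c)).sub hp.del) h1 fun x hx => ?_⟩,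
      D_ext fun x hx => ?_⟩
    · have := hgp x hx
      simp only [Pi.sub_apply, Pi.smul_apply] at this ⊢
      rw [hwω x (Kb_mono h2 _ hx), this, sub_self]
    · rw [dD_apply hn _ hx, (KK n).del_congr (fun y hy => paste_of_mem hy) hx, map_sub, map_sub,
        del_del, sub_zero, map_smul]
      change del g x - c • del w x = f.1 x - c • φ.1 x
      rw [hgf x hx, hφw x hx]

/-! ### The group action -/

/-- The action on functions. -/
def ρF (n s : ℕ) : Representation ℚ (Γ n) ((Fin s → Vec n) → ℚ) where
  toFun γ := LinearMap.funLeft ℚ ℚ (act γ⁻¹)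
  map_one' := by ext f x; simp [LinearMap.funLeft_apply, act_one]
  map_mul' γ δ := by
    ext f x
    simp [LinearMap.funLeft_apply, act_mul]

theorem ρF_apply {n s : ℕ} (γ : Γ n) (f : (Fin s → Vec n) → ℚ) (x) :
    ρF n s γ f x = f (act γ⁻¹ x) := rfl

theorem AE.act {s : ℕ} (γ : Γ n) {f : (Fin s → Vec n) → ℚ} (hf : AE f) : AE (ρF n s γ f) :=
  ⟨fun σ x => by rw [ρF_apply, ρF_apply, ← act_comp, hf.alt],
    fun x y h => hf.even _ _ (act_neg_of γ⁻¹ h)⟩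

theorem act_mem_KS {s : ℕ} (γ : Γ n) {x : Fin s → Vec n} : act γ x ∈ KS n s ↔ x ∈ KS n s :=
  and_congr (act_mem_KL_iff γ) (qspan_act_iff γ)

theorem ρF_mem_D {s : ℕ} (γ : Γ n) {f : (Fin s → Vec n) → ℚ} (hf : f ∈ D n s) :
    ρF n s γ f ∈ D n s := by
  refine ⟨hf.1.act γ, (hf.2.1.image (act γ)).subset fun x hx => ⟨act γ⁻¹ x, hx, act_act_inv γ x⟩,
    fun x hx => (act_mem_KS γ⁻¹).1 (hf.2.2 _ hx)⟩

theorem del_ρF {s : ℕ} (γ : Γ n) (f : (Fin s → Vec n) → ℚ) :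
    del (ρF n s γ f) = ρF n (s + 1) γ (del f) := by
  ext x
  simp only [ρF_apply, del_apply, act_removeNth]

/-- The action on finitely supported functions. -/
noncomputable def ρD (n s : ℕ) [NeZero n] : Representation ℚ (Γ n) (D n s) where
  toFun γ := (ρF n s γ).restrict fun f hf => ρF_mem_D γ hf
  map_one' := by ext f x; simp
  map_mul' γ δ := by ext f x; simp

theorem ρD_apply {s : ℕ} (γ : Γ n) (f : D n s) (x) : (ρD n s γ f).1 x = f.1 (act γ⁻¹ x) := rfl

theorem dD_ρD (hn : 2 ≤ n) {s : ℕ} (γ : Γ n) (f : D n s) :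
    dD hn s (ρD n s γ f) = ρD n (s + 1) γ (dD hn s f) := D_ext fun x hx => by
  rw [dD_apply hn _ hx, ρD_apply, dD_apply hn _ ((act_mem_KL_iff γ⁻¹).2 hx)]
  exact congrFun (del_ρF γ f.1) x

end Chains

section Determinants

variable {n : ℕ}

theorem dt_eq (x : Fin n → Vec n) : dt x = Matrix.detRowAlternating (R := ℤ) x := by
  rw [dt, ← Matrix.det_transpose]; rfl

theorem dt_comp (x : Fin n → Vec n) (σ : Perm (Fin n)) :
    dt (x ∘ σ) = (Perm.sign σ : ℤ) * dt x := by
  rw [dt_eq, dt_eq, AlternatingMap.map_perm]; simp [Units.smul_def]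

theorem abs_dt_comp (x : Fin n → Vec n) (σ : Perm (Fin n)) : |dt (x ∘ σ)| = |dt x| := by
  rw [dt_comp, abs_mul]
  rcases Int.units_eq_one_or (Perm.sign σ) with h | h <;> simp [h]

theorem dt_dup (x : Fin n → Vec n) {i j : Fin n} (h : x i = x j) (hij : i ≠ j) : dt x = 0 := by
  rw [dt_eq]; exact AlternatingMap.map_eq_zero_of_eq _ _ h hij

theorem dt_update_add (x : Fin n → Vec n) (k : Fin n) (v w : Vec n) :
    dt (Function.update x k (v + w)) = dt (Function.update x k v) + dt (Function.update x k w) := by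
  simp only [dt_eq]; exact AlternatingMap.map_update_add _ _ _ _ _

theorem dt_update_smul (x : Fin n → Vec n) (k : Fin n) (c : ℤ) (v : Vec n) :
    dt (Function.update x k (c • v)) = c * dt (Function.update x k v) := by
  simp only [dt_eq]; exact AlternatingMap.map_update_smul _ _ _ _ _

theorem dt_update_sum {ι : Type*} (A : Finset ι) (x : Fin n → Vec n) (k : Fin n) (v : ι → Vec n) :
    dt (Function.update x k (∑ a ∈ A, v a)) = ∑ a ∈ A, dt (Function.update x k (v a)) := by
  simp only [dt_eq]; exact AlternatingMap.map_update_sum _ _ _ _ _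

theorem dt_update_self (x : Fin n → Vec n) (j k : Fin n) :
    dt (Function.update x k (x j)) = if j = k then dt x else 0 := by
  split_ifs with h
  · subst h; rw [Function.update_eq_self]
  · exact dt_dup _ (i := k) (j := j) (by simp [h]) (Ne.symm h)

theorem dt_smul_eq (x : Fin n → Vec n) (w : Vec n) :
    dt x • w = ∑ k, dt (Function.update x k w) • x k := by
  have := Matrix.mulVec_cramer (Matrix.of fun i j => x j i) w
  rw [dt, ← this]
  ext i
  rw [Matrix.mulVec, dotProduct, Finset.sum_apply]
  refine Finset.sum_congr rfl fun k _ => ?_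
  rw [Matrix.cramer_apply, Pi.smul_apply, smul_eq_mul, mul_comm]
  congr 1
  rw [dt]
  congr 1
  ext a b
  by_cases h : b = k
  · subst h; simp
  · simp [h]

theorem dt_update_update (x : Fin n → Vec n) {j k : Fin n} (hjk : j ≠ k) (t w : Vec n) :
    dt x * dt (Function.update (Function.update x k t) j w) =
      dt (Function.update x k t) * dt (Function.update x j w) -
        dt (Function.update x j t) * dt (Function.update x k w) := by
  rw [← dt_update_smul, dt_smul_eq, dt_update_sum]
  simp only [dt_update_smul]
  rw [← Finset.add_sum_erase _ _ (Finset.mem_univ j),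
    ← Finset.add_sum_erase _ _ (Finset.mem_erase.2 ⟨hjk.symm, Finset.mem_univ k⟩),
    Finset.sum_eq_zero (s := (univ.erase j).erase k)]
  · have h1 : Function.update (Function.update x k t) j (x j) = Function.update x k t := by
      conv_rhs => rw [← Function.update_eq_self j (Function.update x k t)]
      rw [Function.update_of_ne hjk]
    have h2 : Function.update (Function.update x k t) j (x k) =
        Function.update x j t ∘ swap j k := by
      ext i : 1
      by_cases h : i = j
      · subst h; simp [Function.update_of_ne hjk.symm]
      · by_cases h' : i = k
        · subst h'; simp [h]
        · simp [h, h', Equiv.swap_apply_of_ne_of_ne h h']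
    rw [h1, h2, dt_comp, Perm.sign_swap hjk]
    push_cast
    ring
  · intro l hl
    simp only [Finset.mem_erase, Finset.mem_univ, and_true] at hl
    refine mul_eq_zero_of_right _ (dt_dup _ (i := j) (j := l) ?_ ?_)
    · simp [hl.1, hl.2]
    · exact hl.2.symm

theorem dt_ne_zero_iff_entries {x : Fin n → Vec n} (h : dt x ≠ 0) (i : Fin n) : x i ≠ 0 := by
  intro h0
  refine h ?_
  rw [← Function.update_eq_self i x, h0, ← zero_smul ℤ (0 : Vec n), dt_update_smul, zero_mul]

theorem exists_reduced {x : Fin n → Vec n} (h : 2 ≤ |dt x|) (P : Fin n → ℤ → Prop)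
    (hP : ∀ k r, ∃ q, P k (r - q * dt x)) :
    ∃ w : Vec n, w ≠ 0 ∧ ∀ k, P k (dt (Function.update x k w)) := by
  obtain ⟨v, k0, hv⟩ : ∃ (v : Vec n) (k : Fin n), ¬ dt x ∣ dt (Function.update x k v) := by
    by_contra! hall
    choose b hb using hall
    have h1 : (Matrix.of fun i j => x j i) * (Matrix.of fun k j => b (Pi.single j 1) k) = 1 := by
      ext i j
      have h2 := dt_smul_eq x (Pi.single j 1)
      simp only [hb, mul_smul, ← Finset.smul_sum] at h2
      have h3 := congrFun (smul_right_injective _ (show dt x ≠ 0 by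
        rintro h0; rw [h0] at h; norm_num at h) h2) i
      rw [Finset.sum_apply] at h3
      rw [Matrix.mul_apply, Matrix.one_apply]
      simp only [Pi.single_apply] at h3
      rw [h3]
      exact Finset.sum_congr rfl fun k _ => by simp [mul_comm]
    have h4 := congrArg Matrix.det h1
    rw [Matrix.det_mul, Matrix.det_one] at h4
    have h5 : IsUnit (dt x) := IsUnit.of_mul_eq_one _ h4
    rw [Int.isUnit_iff_abs_eq] at h5
    omega
  choose q hq using fun k => hP k (dt (Function.update x k v))
  have hc : ∀ k, dt (Function.update x k (v + ∑ l, (-q l) • x l)) =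
      dt (Function.update x k v) - q k * dt x := by
    intro k
    rw [dt_update_add, dt_update_sum]
    simp only [dt_update_smul, dt_update_self]
    simp [sub_eq_add_neg]
  refine ⟨v + ∑ l, (-q l) • x l, fun h0 => hv ?_, fun k => by rw [hc]; exact hq k⟩
  have := hc k0
  rw [h0, ← zero_smul ℤ (0 : Vec n), dt_update_smul, zero_mul] at this
  exact ⟨q k0, by linarith [mul_comm (q k0) (dt x)]⟩

theorem exists_small {x : Fin n → Vec n} (h : 2 ≤ |dt x|) :
    ∃ w : Vec n, w ≠ 0 ∧ ∀ k, 2 * |dt (Function.update x k w)| ≤ |dt x| := by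
  refine exists_reduced h (fun k r => 2 * |r| ≤ |dt x|) fun k r => ?_
  have hd : (0 : ℤ) < |dt x| := by omega
  have h1 := Int.emod_nonneg r hd.ne'
  have h2 := Int.emod_lt_of_pos r hd
  have h3 := Int.emod_add_mul_ediv r |dt x|
  generalize r / |dt x| = a at *
  generalize r % |dt x| = b at *
  subst h3
  have key : ∃ q : ℤ, 2 * |b + (|dt x|) * a - q * (|dt x|)| ≤ |dt x| := by
    by_cases hb : 2 * b ≤ |dt x|
    · exact ⟨a, by rw [show b + |dt x| * a - a * |dt x| = b by ring, abs_of_nonneg h1]; exact hb⟩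
    · refine ⟨a + 1, ?_⟩
      rw [show b + |dt x| * a - (a + 1) * |dt x| = -(|dt x| - b) by ring, abs_neg,
        abs_of_pos (by omega)]
      omega
  obtain ⟨q, hq⟩ := key
  rcases abs_choice (dt x) with h' | h'
  · exact ⟨q, by rw [← h'] at hq ⊢; simpa using hq⟩
  · refine ⟨-q, ?_⟩
    have : q * |dt x| = -q * dt x := by rw [h']; ring
    rwa [this] at hq

theorem exists_signed {x : Fin n → Vec n} (h : 2 ≤ |dt x|) (y : Fin n → ℤ) :
    ∃ w : Vec n, w ≠ 0 ∧ ∀ k, |dt (Function.update x k w)| < |dt x| ∧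
      0 ≤ y k * dt (Function.update x k w) := by
  refine exists_reduced h (fun k r => |r| < |dt x| ∧ 0 ≤ y k * r) fun k r => ?_
  have hd : (0 : ℤ) < |dt x| := by omega
  have h1 := Int.emod_nonneg r hd.ne'
  have h2 := Int.emod_lt_of_pos r hd
  have h3 := Int.emod_add_mul_ediv r |dt x|
  generalize r / |dt x| = a at *
  generalize r % |dt x| = b at *
  subst h3
  have key : ∃ q : ℤ, |b + (|dt x|) * a - q * (|dt x|)| < |dt x| ∧
      0 ≤ y k * (b + |dt x| * a - q * |dt x|) := by
    by_cases hy : 0 ≤ y k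
    · refine ⟨a, ?_⟩
      rw [show b + |dt x| * a - a * |dt x| = b by ring, abs_of_nonneg h1]
      exact ⟨h2, mul_nonneg hy h1⟩
    · rcases h1.eq_or_lt with h0 | h0
      · refine ⟨a, ?_⟩
        rw [show b + |dt x| * a - a * |dt x| = b by ring, ← h0]
        simpa using hd
      · refine ⟨a + 1, ?_⟩
        rw [show b + |dt x| * a - (a + 1) * |dt x| = -(|dt x| - b) by ring, abs_neg,
          abs_of_pos (by omega)]
        exact ⟨by omega, mul_nonneg_of_nonpos_of_nonpos (by omega) (by omega)⟩
  obtain ⟨q, hq⟩ := key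
  rcases abs_choice (dt x) with h' | h'
  · exact ⟨q, by rw [← h'] at hq ⊢; simpa using hq⟩
  · refine ⟨-q, ?_⟩
    have : q * |dt x| = -q * dt x := by rw [h']; ring
    rwa [this] at hq

theorem dt_update_neg (x : Fin n → Vec n) (k : Fin n) (v : Vec n) :
    dt (Function.update x k (-v)) = -dt (Function.update x k v) := by
  rw [← neg_one_smul ℤ v, dt_update_smul]; ring

theorem abs_dt_sign (x y : Fin n → Vec n) (h : ∀ i, y i = x i ∨ y i = -x i) :
    |dt y| = |dt x| := by
  choose e he using fun i => show ∃ e : ℤ, |e| = 1 ∧ y i = e • x i from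
    (h i).elim (fun h => ⟨1, by simp [h]⟩) fun h => ⟨-1, by simp [h]⟩
  rw [show y = fun i => e i • x i from funext fun i => (he i).2, dt_eq, dt_eq]
  have := MultilinearMap.map_smul_univ
    (Matrix.detRowAlternating (n := Fin n) (R := ℤ)).toMultilinearMap e x
  simp only [AlternatingMap.coe_multilinearMap] at this
  rw [this]
  simp [abs_mul, Finset.abs_prod, (he _).1]

end Determinants

section Faces

variable {m : ℕ}

/-- The permutation moving `k` to the front. -/
noncomputable def front (k : Fin (m + 1)) : Perm (Fin (m + 1)) :=
  Equiv.ofBijective (Fin.cons k k.succAbove : Fin (m + 1) → Fin (m + 1)) <| by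
    rw [← Finite.injective_iff_bijective, Fin.cons_injective_iff]
    exact ⟨fun ⟨j, hj⟩ => k.succAbove_ne j hj, Fin.succAbove_right_injective⟩

theorem front_zero (k : Fin (m + 1)) : front k 0 = k := rfl

theorem front_succ (k : Fin (m + 1)) (j : Fin m) : front k j.succ = k.succAbove j := rfl

theorem cons_removeNth {V : Type*} (k : Fin (m + 1)) (x : Fin (m + 1) → V) (t : V) :
    (Fin.cons t (k.removeNth x) : Fin (m + 1) → V) = Function.update x k t ∘ front k := by
  ext j : 1
  refine Fin.cases ?_ (fun j => ?_) j
  · simp [front_zero]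
  · simp [front_succ, Fin.removeNth, Fin.succAbove_ne]

theorem cons_removeNth_self {V : Type*} (k : Fin (m + 1)) (x : Fin (m + 1) → V) :
    (Fin.cons (x k) (k.removeNth x) : Fin (m + 1) → V) = x ∘ front k := by
  rw [cons_removeNth, Function.update_eq_self]

/-- All maximal minors are at most `N` in absolute value. -/
def Bd (T : Fin (m + 2) → Vec (m + 1)) (N : ℤ) : Prop :=
  ∀ i : Fin (m + 2), |dt (i.removeNth T)| ≤ N

theorem Bd_cons {w : Vec (m + 1)} {x : Fin (m + 1) → Vec (m + 1)} {N : ℤ} :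
    Bd (Fin.cons w x) N ↔ |dt x| ≤ N ∧ ∀ k, |dt (Function.update x k w)| ≤ N := by
  rw [Bd, Fin.forall_fin_succ]
  refine and_congr (by rw [removeNth_zero_cons]) (forall_congr' fun k => ?_)
  rw [removeNth_succ_cons, cons_removeNth, abs_dt_comp]

theorem Bd_comp {T : Fin (m + 2) → Vec (m + 1)} {N : ℤ} (h : Bd T N) (i : Fin (m + 2)) :
    Bd (T ∘ front i) N := by
  rw [← cons_removeNth_self]
  refine Bd_cons.2 ⟨h i, fun k => ?_⟩
  have e : Function.update (i.removeNth T) k (T i) ∘ front k =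
      (k.succ).removeNth (T ∘ front i) := by
    rw [← cons_removeNth, ← cons_removeNth_self, removeNth_succ_cons]
  rw [← abs_dt_comp _ (front k), e]
  obtain ⟨σ, j, hσ⟩ : ∃ (σ : Perm (Fin (m + 1))) (j : Fin (m + 2)),
      (k.succ).removeNth (T ∘ front i) = j.removeNth T ∘ σ := by
    refine ⟨(finSuccAboveEquiv k.succ).trans (((front i).subtypeEquiv
      (q := fun b => b ≠ front i k.succ)
      fun a => by simp).trans (finSuccAboveEquiv (front i k.succ)).symm), front i k.succ, ?_⟩
    ext a : 1
    simp only [Fin.removeNth, Function.comp_apply]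
    congr 1
    have := (finSuccAboveEquiv (front i k.succ)).apply_symm_apply
      ⟨front i (k.succ.succAbove a), by simp [Fin.succAbove_ne]⟩
    exact (congrArg Subtype.val this).symm
  rw [hσ, abs_dt_comp]
  exact h j

theorem AE.eq_zero_comp {V : Type*} [AddCommGroup V] {s : ℕ} {f : (Fin s → V) → ℚ} (hf : AE f)
    {x : Fin s → V} (σ : Perm (Fin s)) : f (x ∘ σ) = 0 ↔ f x = 0 := by
  rw [hf.alt]
  rcases Int.units_eq_one_or (Perm.sign σ) with h | h <;> simp [h]

/-- Expanding a closed cochain by an additional vector. -/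
theorem eq_zero_of_cons {V : Type*} [AddCommGroup V] {E : (Fin (m + 2) → V) → ℚ} (hE : AE E)
    (w t : V) (x : Fin (m + 1) → V)
    (hd : del E (Fin.cons w (Fin.cons t x)) = 0) (h0 : E (Fin.cons w x) = 0)
    (h : ∀ k, E (Fin.cons w (Function.update x k t)) = 0) : E (Fin.cons t x) = 0 := by
  rw [del_cons, sub_eq_zero] at hd
  rw [hd, del_apply]
  refine Finset.sum_eq_zero fun i _ => ?_
  refine mul_eq_zero_of_right _ ?_
  refine Fin.cases ?_ (fun k => ?_) i
  · rw [removeNth_zero_cons]; exact h0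
  · rw [removeNth_succ_cons, cons_removeNth, (hE.link w).eq_zero_comp]; exact h k

theorem AE.swap_cons {V : Type*} [AddCommGroup V] {E : (Fin (m + 2) → V) → ℚ} (hE : AE E)
    (w t : V) (x : Fin (m + 1) → V) (k : Fin (m + 1)) :
    E (Fin.cons w (Function.update x k t)) = 0 ↔ E (Fin.cons t (Function.update x k w)) = 0 := by
  rw [← hE.eq_zero_comp (swap 0 k.succ)]
  suffices h : (Fin.cons w (Function.update x k t) : Fin (m + 2) → V) ∘ swap 0 k.succ =
    Fin.cons t (Function.update x k w) by rw [h]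
  ext i : 1
  refine Fin.cases ?_ (fun j => ?_) i
  · simp
  · by_cases h : j = k
    · subst h
      rw [Function.comp_apply, Equiv.swap_apply_right]; simp
    · have : swap 0 k.succ j.succ = j.succ :=
        Equiv.swap_apply_of_ne_of_ne (Fin.succ_ne_zero j) (by simpa using h)
      simp [this, h]

end Faces

section Reduction

variable {m : ℕ}

theorem cons_ne_zero {s : ℕ} {w : Vec m} (hw : w ≠ 0) {x : Fin s → Vec m} (hx : ∀ i, x i ≠ 0) :
    ∀ i, (Fin.cons w x : Fin (s + 1) → Vec m) i ≠ 0 := fun i => by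
  refine Fin.cases ?_ (fun j => ?_) i
  · simpa using hw
  · simpa using hx j

theorem update_ne_zero {s : ℕ} {w : Vec m} (hw : w ≠ 0) {x : Fin s → Vec m} (hx : ∀ i, x i ≠ 0)
    (k : Fin s) : ∀ i, Function.update x k w i ≠ 0 := fun i => by
  by_cases h : i = k
  · subst h; simpa using hw
  · simpa [h] using hx i

/-- Closed cochains vanish on tuples with exactly one minor of maximal size, as soon as they vanish
on tuples with smaller minors and on the reduced ones. -/
theorem eq_zero_of_one_minor {E : (Fin (m + 2) → Vec (m + 1)) → ℚ} (hE : AE E)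
    (hd : ∀ T : Fin (m + 3) → Vec (m + 1), (∀ i, T i ≠ 0) → del E T = 0) {N : ℤ} (hN : 2 ≤ N)
    (h1 : ∀ T : Fin (m + 2) → Vec (m + 1), (∀ i, T i ≠ 0) → Bd T (N - 1) → E T = 0)
    (h2 : ∀ (x : Fin (m + 1) → Vec (m + 1)) (w : Vec (m + 1)), |dt x| = N → w ≠ 0 →
      (∀ k, 2 * |dt (Function.update x k w)| ≤ |dt x|) → E (Fin.cons w x) = 0)
    (x : Fin (m + 1) → Vec (m + 1)) {t : Vec (m + 1)} (ht : t ≠ 0) (hx : |dt x| = N)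
    (hy : ∀ k, |dt (Function.update x k t)| ≤ N - 1) : E (Fin.cons t x) = 0 := by
  have hx0 : dt x ≠ 0 := by rintro h; rw [h] at hx; simp at hx; omega
  have hxe := dt_ne_zero_iff_entries hx0
  obtain ⟨w, hw, hs⟩ := exists_small (x := x) (by omega)
  refine eq_zero_of_cons hE w t x (hd _ (cons_ne_zero hw (cons_ne_zero ht hxe))) (h2 x w hx hw hs)
    fun k => h1 _ (cons_ne_zero hw (update_ne_zero ht hxe k)) (Bd_cons.2 ⟨hy k, fun j => ?_⟩)
  by_cases hjk : j = k
  · subst hjk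
    rw [Function.update_idem]
    have := hs j
    omega
  · have h := congrArg abs (dt_update_update x hjk t w)
    rw [abs_mul, hx] at h
    have h3 := abs_sub (dt (Function.update x k t) * dt (Function.update x j w))
      (dt (Function.update x j t) * dt (Function.update x k w))
    rw [abs_mul, abs_mul] at h3
    have a1 := hs j
    have a2 := hs k
    rw [hx] at a1 a2
    have b1 := hy j
    have b2 := hy k
    have c1 := mul_le_mul b2 a1 (by positivity) (by omega)
    have c2 := mul_le_mul b1 a2 (by positivity) (by omega)
    have : N * |dt (Function.update (Function.update x k t) j w)| ≤ N * (N - 1) := by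
      rw [h]; linarith
    exact le_of_mul_le_mul_left this (by omega)

theorem eq_zero_of_reduced {E : (Fin (m + 2) → Vec (m + 1)) → ℚ} (hE : AE E)
    (hd : ∀ T : Fin (m + 3) → Vec (m + 1), (∀ i, T i ≠ 0) → del E T = 0) {N : ℤ} (hN : 2 ≤ N)
    (h1 : ∀ T : Fin (m + 2) → Vec (m + 1), (∀ i, T i ≠ 0) → Bd T (N - 1) → E T = 0)
    (h2 : ∀ (x : Fin (m + 1) → Vec (m + 1)) (w : Vec (m + 1)), |dt x| = N → w ≠ 0 →
      (∀ k, 2 * |dt (Function.update x k w)| ≤ |dt x|) → E (Fin.cons w x) = 0)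
    (T : Fin (m + 2) → Vec (m + 1)) (hT : ∀ i, T i ≠ 0) (hB : Bd T N) : E T = 0 := by
  by_cases hB' : Bd T (N - 1)
  · exact h1 T hT hB'
  obtain ⟨i0, hi0⟩ := not_forall.1 hB'
  rw [← hE.eq_zero_comp (front i0)]
  have hB2 := Bd_comp hB i0
  rw [← cons_removeNth_self] at hB2 ⊢
  have hx : |dt (i0.removeNth T)| = N := by have := hB i0; omega
  have ht := hT i0
  generalize i0.removeNth T = x at *
  generalize T i0 = t at *
  have hx0 : dt x ≠ 0 := by rintro h; rw [h] at hx; simp at hx; omega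
  have hxe := dt_ne_zero_iff_entries hx0
  have hy := (Bd_cons.1 hB2).2
  obtain ⟨w, hw, hs⟩ := exists_signed (x := x) (by omega) fun k => dt (Function.update x k t)
  rw [hx] at hs
  have one := eq_zero_of_one_minor hE hd hN h1 h2
  refine eq_zero_of_cons hE w t x (hd _ (cons_ne_zero hw (cons_ne_zero ht hxe)))
    (one x hw hx fun k => by have := (hs k).1; omega) fun k => ?_
  have key : ∀ j, |dt (Function.update (Function.update x k t) j w)| ≤ N - 1 := by
    intro j
    by_cases hjk : j = k
    · subst hjk
      rw [Function.update_idem]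
      have := (hs j).1
      omega
    · have h := congrArg abs (dt_update_update x hjk t w)
      rw [abs_mul, hx] at h
      have a1 := (hs j).1
      have a2 := (hs k).1
      have b1 := hy j
      have b2 := hy k
      have s1 := (hs j).2
      have s2 := (hs k).2
      generalize dt (Function.update x j w) = cj at *
      generalize dt (Function.update x k w) = ck at *
      generalize dt (Function.update x j t) = yj at *
      generalize dt (Function.update x k t) = yk at *
      have c1 : |yk * cj| < N * N := by
        rw [abs_mul]
        exact lt_of_le_of_lt (mul_le_mul_of_nonneg_right b2 (abs_nonneg _))
          (mul_lt_mul_of_pos_left a1 (by omega))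
      have c2 : |yj * ck| < N * N := by
        rw [abs_mul]
        exact lt_of_le_of_lt (mul_le_mul_of_nonneg_right b1 (abs_nonneg _))
          (mul_lt_mul_of_pos_left a2 (by omega))
      have c3 : 0 ≤ (yk * cj) * (yj * ck) := by
        have := mul_nonneg s1 s2
        calc (0 : ℤ) ≤ yj * cj * (yk * ck) := this
          _ = _ := by ring
      have c4 : |yk * cj - yj * ck| < N * N := by
        generalize yk * cj = A at *
        generalize yj * ck = B at *
        rw [abs_lt] at *
        rcases mul_nonneg_iff.1 c3 with h | h <;> constructor <;> omega
      have : N * |dt (Function.update (Function.update x k t) j w)| < N * N := by rw [h]; exact c4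
      have := lt_of_mul_lt_mul_left this (by omega)
      omega
  by_cases hk : |dt (Function.update x k t)| ≤ N - 1
  · exact h1 _ (cons_ne_zero hw (update_ne_zero ht hxe k)) (Bd_cons.2 ⟨hk, key⟩)
  · exact one _ hw (by have := hy k; omega) key

/-- The inductive definition of a primitive. -/
theorem exists_primitive_step {lam : (Fin (m + 2) → Vec (m + 1)) → ℚ} (hl : AE lam)
    (hd : ∀ T : Fin (m + 3) → Vec (m + 1), (∀ i, T i ≠ 0) → del lam T = 0) {N : ℤ} (hN : 2 ≤ N)
    {μ : (Fin (m + 1) → Vec (m + 1)) → ℚ} (hμ : AE μ)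
    (hμ1 : ∀ x, |dt x| ≤ 1 → μ x = 0)
    (h : ∀ T : Fin (m + 2) → Vec (m + 1), (∀ i, T i ≠ 0) → Bd T (N - 1) → del μ T = lam T) :
    ∃ μ' : (Fin (m + 1) → Vec (m + 1)) → ℚ, AE μ' ∧ (∀ x, |dt x| ≤ 1 → μ' x = 0) ∧
      ∀ T : Fin (m + 2) → Vec (m + 1), (∀ i, T i ≠ 0) → Bd T N → del μ' T = lam T := by
  classical
  let valid : Vec (m + 1) → (Fin (m + 1) → Vec (m + 1)) → Prop := fun w x =>
    w ≠ 0 ∧ ∀ k, 2 * |dt (Function.update x k w)| ≤ |dt x|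
  let g : Vec (m + 1) → (Fin (m + 1) → Vec (m + 1)) → ℚ := fun w => link w lam + del (link w μ)
  have hg : ∀ w, AE (g w) := fun w => (hl.link w).add (hμ.link w).del
  have hex : ∀ x : Fin (m + 1) → Vec (m + 1), 2 ≤ |dt x| → ∃ w, valid w x := fun x hx =>
    exists_small hx
  choose! W hW using hex
  have indep : ∀ w w' x, |dt x| = N → valid w x → valid w' x → g w x = g w' x := by
    intro w w' x hx hw hw'
    have hx0 : dt x ≠ 0 := by rintro h; rw [h] at hx; simp at hx; omega
    have hxe := dt_ne_zero_iff_entries hx0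
    let E := del μ - lam
    have hE : AE E := hμ.del.sub hl
    have hdE : del E (Fin.cons w (Fin.cons w' x)) = 0 := by
      rw [map_sub, del_del, Pi.sub_apply, hd _ (cons_ne_zero hw.1 (cons_ne_zero hw'.1 hxe))]
      simp
    have e : ∀ w, E (Fin.cons w x) = μ x - g w x := by
      intro w
      simp only [E, g, Pi.sub_apply, Pi.add_apply, del_cons, link]
      ring
    have h0 : ∀ k : Fin (m + 1), E (Fin.cons w (Fin.cons w' (k.removeNth x))) = 0 := by
      intro k
      rw [cons_removeNth]
      refine ((hE.link w).eq_zero_comp (front k)).2 ?_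
      refine sub_eq_zero.2 (h _ (cons_ne_zero hw.1 (update_ne_zero hw'.1 hxe k))
        (Bd_cons.2 ⟨?_, fun j => ?_⟩))
      · have := hw'.2 k; omega
      · by_cases hjk : j = k
        · subst hjk; rw [Function.update_idem]; have := hw.2 j; omega
        have h := congrArg abs (dt_update_update x hjk w' w)
        rw [abs_mul, hx] at h
        have h3 := abs_sub (dt (Function.update x k w') * dt (Function.update x j w))
          (dt (Function.update x j w') * dt (Function.update x k w))
        rw [abs_mul, abs_mul] at h3
        have a1 := hw.2 j
        have a2 := hw.2 k
        have b1 := hw'.2 j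
        have b2 := hw'.2 k
        rw [hx] at a1 a2 b1 b2
        have c1 := mul_le_mul b2 a1 (by positivity) (by omega)
        have c2 := mul_le_mul b1 a2 (by positivity) (by omega)
        have : N * (2 * |dt (Function.update (Function.update x k w') j w)|) ≤ N * N := by
          rw [show N * (2 * |dt (Function.update (Function.update x k w') j w)|) =
            2 * (N * |dt (Function.update (Function.update x k w') j w)|) by ring, h]
          linarith
        have := le_of_mul_le_mul_left this (by omega)
        omega
    rw [del_cons, del_apply, Fin.sum_univ_succ] at hdE
    rw [Finset.sum_eq_zero (fun k _ => by
      rw [removeNth_succ_cons]; exact mul_eq_zero_of_right _ (h0 k)), removeNth_zero_cons,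
      link, e, e] at hdE
    simp at hdE
    linarith
  let μ' : (Fin (m + 1) → Vec (m + 1)) → ℚ := fun x => if |dt x| = N then g (W x) x else μ x
  have hlow : ∀ x, |dt x| ≤ N - 1 → μ' x = μ x := fun x hx => if_neg (by omega)
  have hval : ∀ w x, |dt x| = N → valid w x → μ' x = g w x := fun w x hx hw => by
    simp only [μ']
    rw [if_pos hx]
    exact indep _ _ x hx (hW x (by omega)) hw
  have hμ' : AE μ' := by
    refine ⟨fun σ x => ?_, fun x y hxy => ?_⟩
    · by_cases hx : |dt x| = N
      · have hw := hW x (by omega)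
        rw [hval _ x hx hw, hval (W x) (x ∘ σ) (by rwa [abs_dt_comp]) ⟨hw.1, fun k => ?_⟩,
          (hg _).alt]
        have e : Function.update (x ∘ σ) k (W x) = Function.update x (σ k) (W x) ∘ σ :=
          (Function.update_comp_eq_of_injective x σ.injective k (W x)).symm
        rw [abs_dt_comp, e, abs_dt_comp]
        exact hw.2 _
      · simp only [μ']
        rw [if_neg hx, if_neg (by rwa [abs_dt_comp]), hμ.alt]
    · have hab : ∀ u v : Fin (m + 1) → Vec (m + 1), (∀ i, v i = u i ∨ v i = -u i) →
          |dt v| = |dt u| := abs_dt_sign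
      by_cases hx : |dt x| = N
      · have hw := hW x (by omega)
        rw [hval _ x hx hw, hval (W x) y (by rwa [hab x y hxy]) ⟨hw.1, fun k => ?_⟩,
          (hg _).even x y hxy]
        rw [hab x y hxy, hab (Function.update x k (W x)) (Function.update y k (W x))]
        · exact hw.2 k
        · intro i
          by_cases hi : i = k
          · subst hi; simp
          · simpa [hi] using hxy i
      · simp only [μ']
        rw [if_neg hx, if_neg (by rwa [hab x y hxy]), hμ.even x y hxy]
  refine ⟨μ', hμ', fun x hx => by rw [hlow x (by omega), hμ1 x hx], fun T hT hB => ?_⟩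
  refine sub_eq_zero.1 (eq_zero_of_reduced (E := del μ' - lam) (hμ'.del.sub hl) (fun T hT => ?_) hN
    (fun T hT hB => ?_) (fun x w hx hw hs => ?_) T hT hB)
  · rw [map_sub, del_del, Pi.sub_apply, hd T hT]; simp
  · refine sub_eq_zero.2 ?_
    rw [← h T hT hB, del_apply, del_apply]
    exact Finset.sum_congr rfl fun i _ => by rw [hlow _ (hB i)]
  · have h1 := hval w x hx ⟨hw, hs⟩
    have h2 : del (link w μ') x = del (link w μ) x := by
      rw [del_apply, del_apply]
      refine Finset.sum_congr rfl fun i _ => ?_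
      rw [link, link, hlow]
      rw [cons_removeNth, abs_dt_comp]
      have := hs i
      omega
    simp only [Pi.sub_apply, del_cons, h1, h2, g, Pi.add_apply, link]
    ring

end Reduction

section Primitive

variable {m : ℕ}

theorem exists_minor_ne_zero {T : Fin (m + 2) → Vec (m + 1)} (h : qspan T = ⊤) :
    ∃ i : Fin (m + 2), dt (i.removeNth T) ≠ 0 := by
  have hnl : ¬ LinearIndependent ℚ (fun i => toQ (T i)) := fun hli => by
    have := hli.fintype_card_le_finrank
    simp at this
  obtain ⟨g, hg, i, hi⟩ := Fintype.not_linearIndependent_iff.1 hnl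
  refine ⟨i, fun h0 => ?_⟩
  refine (qspan_eq_top_iff_dt.not.2 (not_not.2 h0)) (top_le_iff.1 (h.ge.trans ?_))
  rw [qspan_le_iff]
  intro j
  by_cases hj : j = i
  · subst hj
    rw [Fin.sum_univ_succAbove _ j] at hg
    have : toQ (T j) = ∑ k, (-(g j)⁻¹ * g (j.succAbove k)) • toQ (T (j.succAbove k)) := by
      simp only [mul_smul, ← Finset.smul_sum]
      rw [eq_neg_of_add_eq_zero_right hg, neg_smul, smul_neg, neg_neg, smul_smul,
        inv_mul_cancel₀ hi, one_smul]
    rw [this]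
    exact Submodule.sum_mem _ fun k _ => Submodule.smul_mem _ _ (mem_qspan (j.removeNth T) k)
  · obtain ⟨k, rfl⟩ := Fin.exists_succAbove_eq hj
    exact mem_qspan (i.removeNth T) k

theorem dt_update_sum_self (x : Fin m → Vec m) (A : Finset (Fin m)) (k : Fin m) :
    dt (Function.update x k (∑ a ∈ A, x a)) = if k ∈ A then dt x else 0 := by
  rw [dt_update_sum]
  simp only [dt_update_self]
  rw [Finset.sum_ite_eq' A k]

theorem update_zero_dt (x : Fin m → Vec m) (k : Fin m) : dt (Function.update x k 0) = 0 := by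
  rw [← zero_smul ℤ (0 : Vec m), dt_update_smul, zero_mul]

section Unimodular

variable {lam : (Fin (m + 2) → Vec (m + 1)) → ℚ}

theorem eq_zero_of_Bd_zero (hns : ∀ T, (∀ i, T i ≠ 0) → qspan T ≠ ⊤ → lam T = 0)
    {T : Fin (m + 2) → Vec (m + 1)} (hT : ∀ i, T i ≠ 0) (h : Bd T 0) :
    lam T = 0 :=
  hns T hT fun hs => by
    obtain ⟨i, hi⟩ := exists_minor_ne_zero hs
    exact hi (abs_nonpos_iff.1 (h i))

theorem eq_zero_pair (hm : 2 ≤ m) (hl : AE lam) (hinv : ∀ γ x, lam (act γ x) = lam x)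
    (x : Fin (m + 1) → Vec (m + 1)) (hx : |dt x| = 1) {p q : Fin (m + 1)}
    (hpq : p ≠ q) : lam (Fin.cons (x p + x q) x) = 0 := by
  obtain ⟨o, ho⟩ : ∃ o, o ∉ ({p, q} : Finset (Fin (m + 1))) := by
    by_contra! hall
    have := Finset.card_le_card (fun o _ => hall o : (Finset.univ : Finset (Fin (m + 1))) ⊆ {p, q})
    rw [Finset.card_univ, Fintype.card_fin] at this
    have := Finset.card_le_two (a := p) (b := q)
    omega
  simp only [Finset.mem_insert, Finset.mem_singleton, not_or] at ho
  have hx0 : dt x ≠ 0 := by rintro h; rw [h] at hx; simp at hx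
  obtain ⟨γ, hγ⟩ := exists_act_of_modEq (x := x)
    (y := Function.update x o (-x o) ∘ swap p q) hx0
    (by rw [dt_comp, Perm.sign_swap hpq, dt_update_neg, Function.update_eq_self]; simp)
    (fun i j => (Int.isUnit_iff_abs_eq.2 hx).dvd)
  have h1 := hinv γ (Fin.cons (x p + x q) x)
  have hp : (γ : Matrix (Fin (m + 1)) (Fin (m + 1)) ℤ).mulVec (x p) = x q := by
    have := congrFun hγ p
    simpa [act_apply, Ne.symm ho.2] using this
  have hq : (γ : Matrix (Fin (m + 1)) (Fin (m + 1)) ℤ).mulVec (x q) = x p := by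
    have := congrFun hγ q
    simpa [act_apply, Ne.symm ho.1] using this
  rw [act_cons, hγ, Matrix.mulVec_add, hp, hq, add_comm (x q)] at h1
  have h2 := (hl.link (x p + x q)).alt (swap p q) (Function.update x o (-x o))
  have h3 := (hl.link (x p + x q)).even x (Function.update x o (-x o)) fun i => by
    by_cases h : i = o
    · subst h; simp
    · simp [h]
  rw [Perm.sign_swap hpq, h3] at h2
  simp only [link] at h2
  rw [h1] at h2
  push_cast at h2
  linarith

theorem eq_zero_sum (hm : 2 ≤ m) (hl : AE lam) (hinv : ∀ γ x, lam (act γ x) = lam x)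
    (hns : ∀ T, (∀ i, T i ≠ 0) → qspan T ≠ ⊤ → lam T = 0)
    (hd : ∀ T : Fin (m + 3) → Vec (m + 1), (∀ i, T i ≠ 0) → del lam T = 0)
    (N : ℕ) : ∀ (A : Finset (Fin (m + 1))) (x : Fin (m + 1) → Vec (m + 1)),
    A.card = N + 1 → |dt x| = 1 → lam (Fin.cons (∑ k ∈ A, x k) x) = 0 := by
  induction N with
  | zero =>
    intro A x hA hx
    obtain ⟨k, rfl⟩ := Finset.card_eq_one.1 hA
    rw [Finset.sum_singleton]
    exact hl.eq_zero_of_dup (i := 0) (j := k.succ) (Fin.succ_ne_zero k).symm (by simp)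
  | succ N ih =>
    intro A x hA hx
    have hx0 : dt x ≠ 0 := by rintro h; rw [h] at hx; simp at hx
    have hxe := dt_ne_zero_iff_entries hx0
    obtain ⟨p, hp, q, hq, hpq⟩ := Finset.one_lt_card.1 (show 1 < A.card by omega)
    have ht : ∑ k ∈ A, x k ≠ 0 := fun h => by
      have := dt_update_sum_self x A p
      rw [h, update_zero_dt, if_pos hp] at this
      exact hx0 this.symm
    have hu' : x p + x q = ∑ k ∈ {p, q}, x k := (Finset.sum_pair hpq).symm
    have hu : x p + x q ≠ 0 := fun h => by
      have := dt_update_sum_self x {p, q} p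
      rw [← hu', h, update_zero_dt, if_pos (by simp)] at this
      exact hx0 this.symm
    have aux : ∀ p q, p ∈ A → q ∈ A → p ≠ q →
        lam (Fin.cons (x p + x q) (Function.update x p (∑ k ∈ A, x k))) = 0 := by
      intro p q hp hq hpq
      rw [hl.swap_cons]
      have e : ∑ k ∈ A, x k = ∑ k ∈ A.erase q, Function.update x p (x p + x q) k := by
        rw [← Finset.add_sum_erase _ _ hq, ← Finset.add_sum_erase (A.erase q) _
          (Finset.mem_erase.2 ⟨hpq, hp⟩), ← Finset.add_sum_erase (A.erase q) _
          (Finset.mem_erase.2 ⟨hpq, hp⟩), Function.update_self,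
          Finset.sum_congr rfl fun k hk => Function.update_of_ne (Finset.ne_of_mem_erase hk) _ _]
        abel
      rw [e]
      refine ih _ _ (by rw [Finset.card_erase_of_mem hq, hA]; rfl) ?_
      rw [dt_update_add, dt_update_self, dt_update_self, if_pos rfl, if_neg hpq.symm, add_zero, hx]
    refine eq_zero_of_cons hl (x p + x q) _ x (hd _ (cons_ne_zero hu (cons_ne_zero ht hxe)))
      (eq_zero_pair hm hl hinv x hx hpq) fun k => ?_
    by_cases hkp : k = p
    · subst hkp; exact aux k q hp hq hpq
    by_cases hkq : k = q
    · subst hkq; rw [add_comm (x p)]; exact aux k p hq hp hpq.symm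
    by_cases hkA : k ∈ A
    · have := eq_zero_pair hm hl hinv (Function.update x k (∑ k ∈ A, x k))
        (by rw [dt_update_sum_self, if_pos hkA, hx]) hpq
      rwa [Function.update_of_ne (Ne.symm hkp), Function.update_of_ne (Ne.symm hkq)] at this
    · refine eq_zero_of_Bd_zero hns (cons_ne_zero hu (update_ne_zero ht hxe k))
        (Bd_cons.2 ⟨by rw [dt_update_sum_self, if_neg hkA]; simp, fun j => ?_⟩)
      have hk0 : dt (Function.update x k (x p + x q)) = 0 := by
        rw [hu', dt_update_sum_self, if_neg (by simp [hkp, hkq])]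
      by_cases hjk : j = k
      · subst hjk; rw [Function.update_idem, hk0]; simp
      · have := dt_update_update x hjk (∑ k ∈ A, x k) (x p + x q)
        rw [hk0, dt_update_sum_self x A k, if_neg hkA, zero_mul, mul_zero, sub_zero] at this
        rw [(mul_eq_zero.1 this).resolve_left hx0]
        simp

theorem eq_zero_of_Bd_one (hm : 2 ≤ m) (hl : AE lam) (hinv : ∀ γ x, lam (act γ x) = lam x)
    (hns : ∀ T, (∀ i, T i ≠ 0) → qspan T ≠ ⊤ → lam T = 0)
    (hd : ∀ T : Fin (m + 3) → Vec (m + 1), (∀ i, T i ≠ 0) → del lam T = 0)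
    {T : Fin (m + 2) → Vec (m + 1)} (hT : ∀ i, T i ≠ 0) (hB : Bd T 1) :
    lam T = 0 := by
  by_cases hB' : Bd T 0
  · exact eq_zero_of_Bd_zero hns hT hB'
  obtain ⟨i0, hi0⟩ := not_forall.1 hB'
  rw [← hl.eq_zero_comp (front i0)]
  have hB2 := Bd_comp hB i0
  rw [← cons_removeNth_self] at hB2 ⊢
  have hx : |dt (i0.removeNth T)| = 1 := by have := hB i0; omega
  have ht := hT i0
  generalize i0.removeNth T = x at *
  generalize T i0 = t at *
  have hy := (Bd_cons.1 hB2).2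
  have hrel := dt_smul_eq x t
  have hsq : dt x * dt x = 1 := by rw [← abs_mul_abs_self, hx, one_mul]
  let e : Fin (m + 1) → ℤ := fun k => dt x * dt (Function.update x k t)
  have he : ∀ k, |e k| ≤ 1 := fun k => by simp only [e]; rw [abs_mul, hx, one_mul]; exact hy k
  have hte : t = ∑ k, e k • x k := by
    have := congrArg (dt x • ·) hrel
    simp only [smul_smul, hsq, one_smul, Finset.smul_sum] at this
    exact this
  let x' : Fin (m + 1) → Vec (m + 1) := fun k => if e k = -1 then -x k else x k
  have hx' : ∀ k, x' k = x k ∨ x' k = -x k := fun k => by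
    simp only [x']; split_ifs <;> simp
  let A : Finset (Fin (m + 1)) := {k | e k ≠ 0}
  have htA : t = ∑ k ∈ A, x' k := by
    rw [hte, Finset.sum_filter]
    refine Finset.sum_congr rfl fun k _ => ?_
    have := abs_le.1 (he k)
    simp only [x']
    rcases (by omega : e k = -1 ∨ e k = 0 ∨ e k = 1) with h | h | h <;> simp [h]
  have hA : A.Nonempty := by
    by_contra h
    rw [Finset.not_nonempty_iff_eq_empty.1 h] at htA
    exact ht (by simpa using htA)
  have h := eq_zero_sum hm hl hinv hns hd (A.card - 1) A x' (by have := hA.card_pos; omega)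
    (by rw [abs_dt_sign x x' hx', hx])
  rw [← htA] at h
  rw [← h]
  exact ((hl.link t).even x x' hx').symm

end Unimodular

theorem eq_zero_of_del_eq_zero {ν : (Fin (m + 1) → Vec (m + 1)) → ℚ} {N : ℤ}
    (h1 : ∀ x, |dt x| ≤ 1 → ν x = 0)
    (hd : ∀ T : Fin (m + 2) → Vec (m + 1), (∀ i, T i ≠ 0) → Bd T N → del ν T = 0) :
    ∀ (k : ℕ) (x : Fin (m + 1) → Vec (m + 1)), |dt x| ≤ k → |dt x| ≤ N → ν x = 0 := by
  intro k
  induction k with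
  | zero => exact fun x hx _ => h1 x (by push_cast at hx; omega)
  | succ k ih =>
    intro x hx hxN
    by_cases hx1 : |dt x| ≤ 1
    · exact h1 x hx1
    have hx0 : dt x ≠ 0 := by rintro h; rw [h] at hx1; simp at hx1
    obtain ⟨w, hw, hs⟩ := exists_small (x := x) (by omega)
    have h := hd (Fin.cons w x) (cons_ne_zero hw (dt_ne_zero_iff_entries hx0))
      (Bd_cons.2 ⟨hxN, fun j => by have := hs j; omega⟩)
    rw [del_cons, sub_eq_zero] at h
    rw [h, del_apply]
    refine Finset.sum_eq_zero fun i _ => mul_eq_zero_of_right _ ?_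
    have hi := hs i
    rw [link]
    push_cast at hx
    refine ih _ ?_ ?_ <;> rw [cons_removeNth, abs_dt_comp] <;> omega

/-- Invariant closed cochains supported on spanning tuples have invariant primitives. -/
theorem exists_invariant_primitive {lam : (Fin (m + 2) → Vec (m + 1)) → ℚ} (hm : 2 ≤ m)
    (hl : AE lam) (hinv : ∀ γ x, lam (act γ x) = lam x)
    (hns : ∀ T, (∀ i, T i ≠ 0) → qspan T ≠ ⊤ → lam T = 0)
    (hd : ∀ T : Fin (m + 3) → Vec (m + 1), (∀ i, T i ≠ 0) → del lam T = 0) :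
    ∃ μ : (Fin (m + 1) → Vec (m + 1)) → ℚ, AE μ ∧ (∀ γ x, μ (act γ x) = μ x) ∧
      (∀ x, dt x = 0 → μ x = 0) ∧
      ∀ T : Fin (m + 2) → Vec (m + 1), (∀ i, T i ≠ 0) → del μ T = lam T := by
  have hex : ∀ N : ℕ, ∃ μ : (Fin (m + 1) → Vec (m + 1)) → ℚ, AE μ ∧ (∀ x, |dt x| ≤ 1 → μ x = 0) ∧
      ∀ T : Fin (m + 2) → Vec (m + 1), (∀ i, T i ≠ 0) → Bd T ((N : ℤ) + 1) → del μ T = lam T := by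
    intro N
    induction N with
    | zero =>
      refine ⟨0, AE.zero, fun _ _ => rfl, fun T hT hB => ?_⟩
      rw [eq_zero_of_Bd_one hm hl hinv hns hd hT (by simpa using hB), map_zero]; rfl
    | succ N ih =>
      obtain ⟨μ, a, b, c⟩ := ih
      exact exists_primitive_step hl hd (by push_cast; omega) a b
        (by push_cast; rwa [add_sub_cancel_right])
  choose μ hμ h1 hdμ using hex
  have hagree : ∀ (N M : ℕ) (x : Fin (m + 1) → Vec (m + 1)), N ≤ M → |dt x| ≤ (N : ℤ) + 1 →
      μ N x = μ M x := by
    intro N M x hNM hx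
    refine sub_eq_zero.1 (eq_zero_of_del_eq_zero (ν := μ N - μ M) (N := (N : ℤ) + 1)
      (fun x hx => ?_) (fun T hT hB => ?_) (N + 1) x (by exact_mod_cast hx) hx)
    · simp [h1 _ x hx]
    · rw [map_sub, Pi.sub_apply, hdμ N T hT hB, hdμ M T hT fun i => (hB i).trans (by omega),
        sub_self]
  let μ' : (Fin (m + 1) → Vec (m + 1)) → ℚ := fun x => μ (dt x).natAbs x
  have heq : ∀ (N : ℕ) x, |dt x| ≤ N → μ' x = μ N x := fun N x hx =>
    hagree _ _ x (by rw [Int.abs_eq_natAbs] at hx; omega) (by rw [Int.abs_eq_natAbs]; omega)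
  have hd' : ∀ T : Fin (m + 2) → Vec (m + 1), (∀ i, T i ≠ 0) → del μ' T = lam T := by
    intro T hT
    let N : ℕ := ∑ i : Fin (m + 2), (dt (i.removeNth T)).natAbs
    have hN : ∀ i : Fin (m + 2), |dt (i.removeNth T)| ≤ (N : ℤ) := fun i => by
      rw [Int.abs_eq_natAbs]
      exact_mod_cast Finset.single_le_sum (f := fun i : Fin (m + 2) => (dt (i.removeNth T)).natAbs)
        (fun _ _ => Nat.zero_le _) (Finset.mem_univ i)
    rw [← hdμ N T hT fun i => (hN i).trans (by omega), del_apply, del_apply]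
    exact Finset.sum_congr rfl fun i _ => by rw [heq N _ (hN i)]
  refine ⟨μ', ⟨fun σ x => ?_, fun x y h => ?_⟩, fun γ x => ?_, fun x hx => ?_, hd'⟩
  · have := abs_dt_comp x σ
    rw [heq (dt x).natAbs (x ∘ σ) (by rw [this, Int.abs_eq_natAbs]), (hμ _).alt]
  · have := abs_dt_sign x y h
    rw [heq (dt x).natAbs y (by rw [this, Int.abs_eq_natAbs]), (hμ _).even x y h]
  · refine sub_eq_zero.1 (eq_zero_of_del_eq_zero (ν := fun x => μ' (act γ x) - μ' x) (N := |dt x|)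
      (fun x hx => ?_) (fun T hT hB => ?_) (dt x).natAbs x (by rw [Int.abs_eq_natAbs]) le_rfl)
    · simp only [μ', h1 _ x hx, h1 _ (act γ x) ((dt_act γ x).symm ▸ hx), sub_self]
    · have a1 := hd' (act γ T) (act_ne_zero γ hT)
      rw [hinv, ← hd' T hT, del_apply, del_apply] at a1
      rw [del_apply]
      simp only [mul_sub, Finset.sum_sub_distrib]
      exact sub_eq_zero.2 a1
  · exact h1 _ x (by rw [hx]; simp)

end Primitive

section Averaging

variable {V : Type*} [AddCommGroup V] {s : ℕ}

/-- The projection onto alternating even cochains. -/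
noncomputable def piAE (s : ℕ) : ((Fin s → V) → ℚ) →ₗ[ℚ] ((Fin s → V) → ℚ) where
  toFun f x := ((2 ^ s * s.factorial : ℕ) : ℚ)⁻¹ *
    ∑ σ : Perm (Fin s), ∑ e : Fin s → ℤˣ, ((Perm.sign σ : ℤ) : ℚ) * f fun i => e i • x (σ i)
  map_add' f g := by
    ext x
    simp [mul_add, Finset.sum_add_distrib]
  map_smul' c f := by
    ext x
    simp only [Pi.smul_apply, smul_eq_mul, RingHom.id_apply, Finset.mul_sum]
    exact Finset.sum_congr rfl fun σ _ => Finset.sum_congr rfl fun e _ => by ring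

theorem piAE_apply (f : (Fin s → V) → ℚ) (x : Fin s → V) :
    piAE s f x = ((2 ^ s * s.factorial : ℕ) : ℚ)⁻¹ * ∑ σ : Perm (Fin s), ∑ e : Fin s → ℤˣ,
      ((Perm.sign σ : ℤ) : ℚ) * f fun i => e i • x (σ i) := rfl

theorem units_smul_or (e : ℤˣ) (v : V) : e • v = v ∨ e • v = -v := by
  rcases Int.units_eq_one_or e with rfl | rfl <;> simp

theorem AE.piAE (f : (Fin s → V) → ℚ) : AE (piAE s f) := by
  refine ⟨fun τ x => ?_, fun x y h => ?_⟩
  · rw [piAE_apply, piAE_apply, mul_left_comm]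
    congr 1
    rw [Finset.mul_sum]
    refine Fintype.sum_equiv (Equiv.mulLeft τ) _ _ fun σ => ?_
    rw [Finset.mul_sum]
    refine Finset.sum_congr rfl fun e _ => ?_
    have : ((Perm.sign τ : ℤ) : ℚ) * ((Perm.sign τ : ℤ) : ℚ) = 1 := by
      rcases Int.units_eq_one_or (Perm.sign τ) with h | h <;> simp [h]
    rw [Equiv.coe_mulLeft, Perm.sign_mul]
    push_cast
    rw [← mul_assoc, ← mul_assoc, this, one_mul]
    rfl
  · have : ∀ i, ∃ d : ℤˣ, y i = d • x i := fun i =>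
      (h i).elim (fun h => ⟨1, by simp [h]⟩) fun h => ⟨-1, by simp [h]⟩
    choose d hd using this
    rw [piAE_apply, piAE_apply]
    congr 1
    refine Finset.sum_congr rfl fun σ _ => ?_
    refine Fintype.sum_equiv (Equiv.mulRight (d ∘ σ)) _ _ fun e => ?_
    simp [hd, mul_smul]

theorem AE.piAE_eq {f : (Fin s → V) → ℚ} (hf : AE f) : SLCoh.piAE s f = f := by
  ext x
  rw [piAE_apply]
  have : ∀ (σ : Perm (Fin s)) (e : Fin s → ℤˣ),
      ((Perm.sign σ : ℤ) : ℚ) * f (fun i => e i • x (σ i)) = f x := by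
    intro σ e
    rw [hf.even (x ∘ σ) (fun i => e i • x (σ i)) fun i => units_smul_or _ _, hf.alt, ← mul_assoc]
    rcases Int.units_eq_one_or (Perm.sign σ) with h | h <;> simp [h]
  simp only [this]
  simp only [Finset.sum_const, Finset.card_univ, Fintype.card_perm, Fintype.card_fin, nsmul_eq_mul,
    Fintype.card_pi, Finset.prod_const, Fintype.card_units_int]
  have : (s.factorial : ℚ) ≠ 0 := by exact_mod_cast s.factorial_ne_zero
  push_cast
  field_simp

theorem piAE_eq_zero {f : (Fin s → V) → ℚ} {S : Set (Fin s → V)}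
    (hS : ∀ x ∈ S, ∀ (σ : Perm (Fin s)) (e : Fin s → ℤˣ), (fun i => e i • x (σ i)) ∈ S)
    (hf : ∀ x ∈ S, f x = 0) {x : Fin s → V} (hx : x ∈ S) : piAE s f x = 0 := by
  rw [piAE_apply]
  refine mul_eq_zero_of_right _ (Finset.sum_eq_zero fun σ _ => Finset.sum_eq_zero fun e _ => ?_)
  rw [hf _ (hS x hx σ e), mul_zero]

end Averaging

section Orbits

variable {n : ℕ}

theorem piAE_ρF {s : ℕ} (γ : Γ n) (f : (Fin s → Vec n) → ℚ) :
    piAE s (ρF n s γ f) = ρF n s γ (piAE s f) := by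
  ext x
  rw [ρF_apply, piAE_apply, piAE_apply]
  congr 1
  refine Finset.sum_congr rfl fun σ _ => Finset.sum_congr rfl fun e _ => ?_
  rw [ρF_apply]
  congr 2
  ext i : 1
  simp only [act_apply]
  rcases Int.units_eq_one_or (e i) with h | h <;>
    simp only [h, one_smul, Units.neg_smul, Matrix.mulVec_neg]

theorem qspan_signed_perm {s : ℕ} (x : Fin s → Vec n) (σ : Perm (Fin s)) (e : Fin s → ℤˣ) :
    qspan (fun i => e i • x (σ i)) = qspan x := by
  rw [← qspan_perm x σ]
  exact qspan_sign fun i => units_smul_or _ _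

theorem Cpx.signed_perm {V : Type*} [AddCommGroup V] (Y : Cpx V) {s : ℕ} {x : Fin s → V}
    (hx : x ∈ Y.car s) (σ : Perm (Fin s)) (e : Fin s → ℤˣ) :
    (fun i => e i • x (σ i)) ∈ Y.car s :=
  Y.closed hx fun j => ⟨σ j, units_smul_or _ _⟩

theorem exists_orbit_section (n s : ℕ) : ∃ u : (Fin s → Vec n) → Γ n,
    (∀ γ x, act (u (act γ x)) (act γ x) = act (u x) x) ∧
      ∀ γ x, qspan x = ⊤ → u (act γ x) * γ = u x := by
  let S : Setoid (Fin s → Vec n) :=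
    { r := fun x y => ∃ γ : Γ n, act γ x = y
      iseqv := ⟨fun x => ⟨1, act_one x⟩, fun {x y} ⟨γ, h⟩ => ⟨γ⁻¹, by rw [← h, act_inv_act]⟩,
        fun {x y z} ⟨γ, h⟩ ⟨δ, h'⟩ => ⟨δ * γ, by rw [act_mul, h, h']⟩⟩ }
  have hu : ∀ x : Fin s → Vec n, ∃ γ : Γ n, act γ x = (Quotient.mk S x).out := fun x =>
    S.symm (Quotient.mk_out (s := S) x)
  choose u hu using hu
  have h1 : ∀ γ x, act (u (act γ x)) (act γ x) = act (u x) x := fun γ x => by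
    rw [hu, hu, show Quotient.mk S (act γ x) = Quotient.mk S x from
      Quotient.sound (S.symm ⟨γ, rfl⟩)]
  refine ⟨u, h1, fun γ x hx => ?_⟩
  have : (u x)⁻¹ * (u (act γ x) * γ) = 1 := act_free hx (by
    rw [act_mul, act_mul, h1, act_inv_act])
  exact (inv_mul_eq_one.1 this).symm

theorem ρF_comp {s : ℕ} (γ δ : Γ n) (f : (Fin s → Vec n) → ℚ) :
    ρF n s γ (ρF n s δ f) = ρF n s (γ * δ) f := by
  rw [map_mul]; rfl

end Orbits

section Extension

variable {m : ℕ}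

theorem nonspanning_small {n : ℕ} {s : ℕ} (h : s < n) (x : Fin s → Vec n) : qspan x ≠ ⊤ := by
  intro hx
  have h1 : Module.finrank ℚ (qspan x) ≤ s := by
    have := finrank_range_le_card (R := ℚ) fun i => toQ (x i)
    rw [Fintype.card_fin] at this
    exact this
  rw [hx, finrank_top, Module.finrank_fintype_fun_eq_card, Fintype.card_fin] at h1
  omega

/-- Alternating even functions on nonminimal spanning `n`-tuples. -/
def Cn (m : ℕ) : Submodule ℚ ((Fin (m + 1) → Vec (m + 1)) → ℚ) where
  carrier := {f | AE f ∧ (∀ x ∈ (KK (m + 1)).car (m + 1), f x = 0) ∧ ∀ x, qspan x ≠ ⊤ → f x = 0}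
  zero_mem' := ⟨AE.zero, fun _ _ => rfl, fun _ _ => rfl⟩
  add_mem' := fun h h' => ⟨h.1.add h'.1, fun x hx => by simp [h.2.1 x hx, h'.2.1 x hx],
    fun x hx => by simp [h.2.2 x hx, h'.2.2 x hx]⟩
  smul_mem' := fun c f h => ⟨h.1.smul c, fun x hx => by simp [h.2.1 x hx],
    fun x hx => by simp [h.2.2 x hx]⟩

theorem Cn_ρF (γ : Γ (m + 1)) {f} (hf : f ∈ Cn m) : ρF (m + 1) (m + 1) γ f ∈ Cn m :=
  ⟨hf.1.act γ, fun x hx => hf.2.1 _ ((act_mem_KL_iff γ⁻¹).2 hx),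
    fun x hx => hf.2.2 _ fun h => hx ((qspan_act_iff γ⁻¹).1 h)⟩

/-- Coboundary on nonminimal spanning tuples, evaluated on tuples of nonzero vectors. -/
noncomputable def dC (m : ℕ) : ((Fin (m + 1) → Vec (m + 1)) → ℚ) →ₗ[ℚ]
    ({T : Fin (m + 2) → Vec (m + 1) // ∀ i, T i ≠ 0} → ℚ) :=
  (LinearMap.funLeft ℚ ℚ Subtype.val).comp del

theorem qspan_ne_top_of_zero {x : Fin (m + 1) → Vec (m + 1)} (h : ¬ ∀ i, x i ≠ 0) :
    qspan x ≠ ⊤ := fun h' => h (dt_ne_zero_iff_entries (qspan_eq_top_iff_dt.1 h'))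

theorem dC_injective (m : ℕ) : Function.Injective ((dC m).domRestrict (Cn m)) := by
  rw [← LinearMap.ker_eq_bot, LinearMap.ker_eq_bot']
  rintro ⟨f, hf⟩ h
  have hd : ∀ x : Fin (m + 2) → Vec (m + 1), (∀ i, x i ≠ 0) → del f x = 0 := fun x hx =>
    congrFun h ⟨x, hx⟩
  obtain ⟨g, -, -, hgN, hg⟩ := rel_acyc_nonspanning hf.1 hf.2.1 (fun x _ hx => hf.2.2 x hx) hd
  refine Subtype.ext (funext fun x => ?_)
  by_cases hx : ∀ i, x i ≠ 0
  · change f x = 0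
    rw [hg x hx, del_apply]
    exact Finset.sum_eq_zero fun i _ => by
      rw [hgN (i.removeNth x) (fun j => hx _) (nonspanning_small (by omega) _), mul_zero]
  · exact hf.2.2 x (qspan_ne_top_of_zero hx)

theorem exists_retraction (m : ℕ) :
    ∃ R : ((Fin (m + 2) → Vec (m + 1)) → ℚ) →ₗ[ℚ] ((Fin (m + 1) → Vec (m + 1)) → ℚ),
      (∀ f, R f ∈ Cn m) ∧ (∀ γ f, R (ρF _ _ γ f) = ρF _ _ γ (R f)) ∧
      (∀ f g, (∀ T, (∀ i, T i ≠ 0) → f T = g T) → R f = R g) ∧ ∀ g ∈ Cn m, R (del g) = g := by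
  classical
  obtain ⟨L, hL⟩ := LinearMap.exists_leftInverse_of_injective _
    (LinearMap.ker_eq_bot.2 (dC_injective m))
  have hL' : ∀ g (hg : g ∈ Cn m), (L (dC m g)).1 = g := fun g hg =>
    congrArg Subtype.val (LinearMap.congr_fun hL ⟨g, hg⟩)
  obtain ⟨u, hu1, hu2⟩ := exists_orbit_section (m + 1) (m + 1)
  let res : ((Fin (m + 2) → Vec (m + 1)) → ℚ) →ₗ[ℚ]
    ({T : Fin (m + 2) → Vec (m + 1) // ∀ i, T i ≠ 0} → ℚ) := LinearMap.funLeft ℚ ℚ Subtype.val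
  let R0 : ((Fin (m + 2) → Vec (m + 1)) → ℚ) →ₗ[ℚ] ((Fin (m + 1) → Vec (m + 1)) → ℚ) :=
    LinearMap.pi fun x => (LinearMap.proj (act (u x) x)).comp
      ((Cn m).subtype.comp (L.comp (res.comp (ρF _ _ (u x)))))
  have hR0 : ∀ f x, R0 f x = (L (res (ρF _ _ (u x) f))).1 (act (u x) x) := fun _ _ => rfl
  have hK : ∀ f, ∀ x ∈ (KK (m + 1)).car (m + 1), R0 f x = 0 := fun f x hx => by
    rw [hR0]; exact (L _).2.2.1 _ ((act_mem_KL_iff _).2 hx)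
  have hN : ∀ f x, qspan x ≠ ⊤ → R0 f x = 0 := fun f x hx => by
    rw [hR0]; exact (L _).2.2.2 _ fun h => hx ((qspan_act_iff _).1 h)
  refine ⟨(piAE (m + 1)).comp R0, fun f => ⟨AE.piAE _, fun x hx => ?_, fun x hx => ?_⟩,
    fun γ f => ?_, fun f g h => ?_, fun g hg => ?_⟩
  · exact piAE_eq_zero (S := (KK (m + 1)).car (m + 1))
      (fun x hx σ e => (KK (m + 1)).signed_perm hx σ e) (hK f) hx
  · exact piAE_eq_zero (S := {x | qspan x ≠ ⊤})
      (fun x hx σ e => by rw [Set.mem_ofPred_eq, qspan_signed_perm]; exact hx) (hN f) hx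
  · rw [LinearMap.comp_apply, LinearMap.comp_apply, ← piAE_ρF]
    congr 1
    ext x
    rw [ρF_apply]
    by_cases hx : qspan x = ⊤
    · rw [hR0, hR0, hu1, ρF_comp]
      have := hu2 γ (act γ⁻¹ x) ((qspan_act_iff _).2 hx)
      rw [act_act_inv] at this
      rw [this]
    · rw [hN _ _ hx, hN _ _ fun h => hx ((qspan_act_iff _).1 h)]
  · rw [LinearMap.comp_apply, LinearMap.comp_apply]
    congr 1
    ext x
    rw [hR0, hR0]
    have : res (ρF _ _ (u x) f) = res (ρF _ _ (u x) g) :=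
      funext fun T => h _ (act_ne_zero _ T.2)
    rw [this]
  · rw [LinearMap.comp_apply]
    refine Eq.trans ?_ hg.1.piAE_eq
    congr 1
    ext x
    rw [hR0, ← del_ρF]
    have := hL' _ (Cn_ρF (u x) hg)
    change (L (dC m (ρF _ _ (u x) g))).1 _ = _
    rw [this, ρF_apply, act_inv_act]

/-- Invariant cocycles on minimal spanning tuples have invariant primitives. -/
theorem exists_invariant_primitive_KS (hm : 2 ≤ m) {lam : (Fin (m + 2) → Vec (m + 1)) → ℚ}
    (hl : AE lam) (hinv : ∀ γ x, lam (act γ x) = lam x)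
    (hS : ∀ x, x ∉ KS (m + 1) (m + 2) → lam x = 0)
    (hd : ∀ x ∈ KS (m + 1) (m + 3), del lam x = 0) :
    ∃ μ : (Fin (m + 1) → Vec (m + 1)) → ℚ, AE μ ∧ (∀ γ x, μ (act γ x) = μ x) ∧
      (∀ x, x ∉ KS (m + 1) (m + 1) → μ x = 0) ∧
      ∀ x ∈ KS (m + 1) (m + 2), del μ x = lam x := by
  have hdN : ∀ x : Fin (m + 3) → Vec (m + 1), qspan x ≠ ⊤ → del lam x = 0 := fun x hx => by
    rw [del_apply]
    exact Finset.sum_eq_zero fun i _ => by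
      rw [hS _ fun h => hx (top_le_iff.1 (h.2.ge.trans (qspan_removeNth_le x i))), mul_zero]
  obtain ⟨κ, hκ, hκK, hκN, hκd⟩ := rel_acyc_nonspanning hl.del
    (fun x hx => by
      by_cases h : qspan x = ⊤
      · exact hd x ⟨hx, h⟩
      · exact hdN x h)
    (fun x _ hx => hdN x hx) (fun x _ => by rw [del_del]; rfl)
  have hlinv : ∀ γ, ρF _ _ γ lam = lam := fun γ => funext fun x => hinv γ⁻¹ x
  obtain ⟨R, hRC, hRρ, hRcongr, hRd⟩ := exists_retraction m
  let κ' := κ - del (R κ)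
  have hκ'inv : ∀ γ (x : Fin (m + 2) → Vec (m + 1)), (∀ i, x i ≠ 0) → ρF _ _ γ κ' x = κ' x := by
    intro γ x hx
    obtain ⟨g0, hg0, hgK, hgN, hgd⟩ := rel_acyc_nonspanning (f := ρF _ _ γ κ - κ)
      ((hκ.act γ).sub hκ)
      (fun x hx => by
        rw [Pi.sub_apply, ρF_apply, hκK _ hx, hκK _ ((act_mem_KL_iff γ⁻¹).2 hx), sub_zero])
      (fun x hx hxN => by
        rw [Pi.sub_apply, ρF_apply, hκN _ hx hxN, hκN _ (act_ne_zero _ hx) fun h =>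
          hxN ((qspan_act_iff _).1 h), sub_zero])
      (fun x hx => by
        rw [map_sub, Pi.sub_apply, del_ρF, ρF_apply, ← hκd x hx, ← hκd _ (act_ne_zero _ hx),
          show del lam (act γ⁻¹ x) = del lam x from by
            rw [← ρF_apply (n := m + 1) γ (del lam) x, ← del_ρF, hlinv], sub_self])
    let Y := DL (⊤ : Submodule ℚ (Fin (m + 1) → ℚ))
    have hY : ∀ {s} {x : Fin s → Vec (m + 1)}, x ∈ Y.car s ↔ ∀ i, x i ≠ 0 := fun {s x} =>
      forall_congr' fun i => and_iff_left Submodule.mem_top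
    let g := paste (Y.car (m + 1)) g0 0
    have hg : g ∈ Cn m := by
      refine ⟨AE.paste Y hg0 AE.zero, fun x hx => ?_, fun x hx => ?_⟩
      · exact (paste_of_mem (KL_le_DL _ _ hx)).trans (hgK x hx)
      · by_cases h : x ∈ Y.car (m + 1)
        · exact (paste_of_mem h).trans (hgN x (hY.1 h) hx)
        · exact paste_of_notMem h
    have hgd' : ∀ T : Fin (m + 2) → Vec (m + 1), (∀ i, T i ≠ 0) →
        ρF _ _ γ κ T = (κ + del g) T := fun T hT => by
      have h1 := hgd T hT
      rw [Pi.sub_apply] at h1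
      rw [Pi.add_apply, Y.del_congr (fun y hy => paste_of_mem hy) (hY.2 hT), ← h1]
      ring
    have h2 := hRcongr _ _ hgd'
    rw [hRρ, map_add, hRd g hg] at h2
    simp only [κ', map_sub, Pi.sub_apply]
    rw [hgd' x hx, ← del_ρF, h2, map_add]
    simp
  let Y := DL (⊤ : Submodule ℚ (Fin (m + 1) → ℚ))
  have hY : ∀ {s} {x : Fin s → Vec (m + 1)}, x ∈ Y.car s ↔ ∀ i, x i ≠ 0 := fun {s x} =>
    forall_congr' fun i => and_iff_left Submodule.mem_top
  have hRKN : ∀ T : Fin (m + 2) → Vec (m + 1), qspan T ≠ ⊤ → del (R κ) T = 0 := fun T hT => by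
    rw [del_apply]
    exact Finset.sum_eq_zero fun i _ => by
      rw [(hRC κ).2.2 _ fun h => hT (top_le_iff.1 (h.ge.trans (qspan_removeNth_le T i))), mul_zero]
  obtain ⟨μ, hμ, hμinv, hμ0, hμd⟩ := exists_invariant_primitive
    (lam := paste (Y.car (m + 2)) (lam - κ') 0) hm
    (AE.paste Y (hl.sub (hκ.sub (hRC κ).1.del)) AE.zero)
    (fun γ x => by
      by_cases hx : ∀ i, x i ≠ 0
      · have := hκ'inv γ⁻¹ x hx
        rw [ρF_apply, inv_inv] at this
        rw [paste_of_mem (hY.2 hx), paste_of_mem (hY.2 (act_ne_zero γ hx)), Pi.sub_apply,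
          Pi.sub_apply, hinv, this]
      · rw [paste_of_notMem fun h => hx (hY.1 h), paste_of_notMem fun h => hx fun i => ?_]
        · rfl
        · have := act_ne_zero γ⁻¹ (hY.1 h) i
          rwa [act_inv_act] at this)
    (fun T hT hTN => by
      rw [paste_of_mem (hY.2 hT)]
      simp only [κ', Pi.sub_apply]
      rw [hS _ fun h => hTN h.2, hκN _ hT hTN, hRKN _ hTN]
      simp)
    (fun T hT => by
      rw [Y.del_congr (g := lam - κ') (fun y hy => paste_of_mem hy) (hY.2 hT)]
      simp only [κ', map_sub, Pi.sub_apply, del_del, Pi.zero_apply]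
      rw [hκd T hT]
      simp)
  let K := KK (m + 1)
  refine ⟨paste (K.car (m + 1)) μ 0, AE.paste K hμ AE.zero, fun γ x => ?_, fun x hx => ?_,
    fun x hx => ?_⟩
  · by_cases hx : x ∈ K.car (m + 1)
    · rw [paste_of_mem hx, paste_of_mem ((act_mem_KL_iff γ).2 hx), hμinv]
    · rw [paste_of_notMem hx, paste_of_notMem fun h => hx ((act_mem_KL_iff γ).1 h)]; rfl
  · by_cases h : x ∈ K.car (m + 1)
    · rw [paste_of_mem h, hμ0]
      by_contra h'
      exact hx ⟨h, qspan_eq_top_iff_dt.2 h'⟩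
    · exact paste_of_notMem h
  · have hx0 := hY.1 (KL_le_DL _ _ hx.1)
    rw [K.del_congr (fun y hy => paste_of_mem hy) hx.1, hμd x hx0, paste_of_mem (hY.2 hx0)]
    simp only [κ', Pi.sub_apply]
    rw [hκK x hx.1, K.del_eq_zero (fun y hy => (hRC κ).2.1 y hy) hx.1]
    simp

end Extension

section Basis

variable {n : ℕ} {s : ℕ}

theorem piAE_mem_D [NeZero n] {f : (Fin s → Vec n) → ℚ} (hf : f.support.Finite)
    (hS : ∀ x, f x ≠ 0 → x ∈ KS n s) : piAE s f ∈ D n s := by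
  refine ⟨AE.piAE f, ?_, fun x hx => ?_⟩
  · have : (⋃ (σ : Perm (Fin s)) (e : Fin s → ℤˣ),
        (fun (x : Fin s → Vec n) i => e i • x (σ i)) ⁻¹' f.support).Finite :=
      Set.finite_iUnion fun σ => Set.finite_iUnion fun e => hf.preimage fun x _ y _ h => by
        funext i
        have := congrFun h (σ.symm i)
        simpa using this
    refine this.subset fun x hx => ?_
    by_contra hc
    simp only [Set.mem_iUnion, Set.mem_preimage, Function.mem_support, not_exists, not_not] at hc
    refine hx ?_
    rw [piAE_apply]
    exact mul_eq_zero_of_right _ (Finset.sum_eq_zero fun σ _ => Finset.sum_eq_zero fun e _ => by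
      rw [hc σ e, mul_zero])
  · by_contra hc
    refine hx (piAE_eq_zero (S := (KS n s)ᶜ) (fun x hx σ e h => hx ?_) (fun x hx => ?_) hc)
    · refine ⟨?_, by rw [← qspan_signed_perm x σ e]; exact h.2⟩
      have := (KK n).signed_perm h.1 σ⁻¹ fun i => (e (σ⁻¹ i))⁻¹
      simpa [smul_smul, Int.units_mul_self] using this
    · by_contra h
      exact hx (hS x h)

open Classical in
/-- The alternating even function carried by the signed permutations of a tuple. -/
noncomputable def basisD (n s : ℕ) [NeZero n] (x : Fin s → Vec n) : D n s :=
  if h : x ∈ KS n s then ⟨piAE s (Pi.single x 1), piAE_mem_D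
    (Set.Finite.subset (Set.finite_singleton x) fun y hy => by
      by_contra hc
      exact hy (Pi.single_eq_of_ne hc _))
    fun y hy => by
      by_contra hc
      exact hy (Pi.single_eq_of_ne (show y ≠ x from fun h' => hc (by rw [h']; exact h)) _)⟩
  else 0

theorem basisD_val [NeZero n] {x : Fin s → Vec n} (h : x ∈ KS n s) :
    (basisD n s x).1 = piAE s (Pi.single x 1) := by
  rw [basisD, dif_pos h]

theorem basisD_zero [NeZero n] {x : Fin s → Vec n} (h : x ∉ KS n s) : basisD n s x = 0 := by
  rw [basisD, dif_neg h]

theorem basisD_act [NeZero n] (γ : Γ n) (x : Fin s → Vec n) :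
    basisD n s (act γ x) = ρD n s γ (basisD n s x) := by
  by_cases h : x ∈ KS n s
  · refine Subtype.ext ?_
    change _ = ρF n s γ (basisD n s x).1
    rw [basisD_val ((act_mem_KS γ).2 h), basisD_val h, ← piAE_ρF]
    congr 1
    ext y
    rw [ρF_apply]
    by_cases hy : act γ⁻¹ y = x
    · rw [hy, Pi.single_eq_same, ← hy, act_act_inv, Pi.single_eq_same]
    · rw [Pi.single_eq_of_ne hy, Pi.single_eq_of_ne fun h => hy (by rw [h, act_inv_act])]
  · rw [basisD_zero h, basisD_zero fun h' => h ((act_mem_KS γ).1 h'), map_zero]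

/-- Elements of `D n s` as finitely supported functions. -/
noncomputable def toFin (n s : ℕ) : D n s →ₗ[ℚ] ((Fin s → Vec n) →₀ ℚ) where
  toFun d := Finsupp.ofSupportFinite d.1 d.2.2.1
  map_add' d e := by ext; rfl
  map_smul' c d := by ext; rfl

theorem toFin_apply (d : D n s) (x) : toFin n s d x = d.1 x := rfl

theorem toFin_ρD [NeZero n] (γ : Γ n) (d : D n s) :
    toFin n s (ρD n s γ d) = Finsupp.mapDomain (act γ) (toFin n s d) := by
  ext y
  have hi : Function.Injective (act γ : (Fin s → Vec n) → _) := fun x y h => by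
    rw [← act_inv_act γ x, h, act_inv_act]
  conv_rhs => rw [← act_act_inv γ y]
  rw [Finsupp.mapDomain_apply hi]
  rfl

theorem linearCombination_basisD [NeZero n] (d : D n s) :
    Finsupp.linearCombination ℚ (basisD n s) (toFin n s d) = d := by
  refine Subtype.ext ?_
  rw [Finsupp.linearCombination_apply, Finsupp.sum, AddSubmonoidClass.coe_finsetSum]
  refine Eq.trans ?_ d.2.1.piAE_eq
  have : d.1 = ∑ x ∈ (toFin n s d).support, d.1 x • (Pi.single x 1 : (Fin s → Vec n) → ℚ) := by
    ext y
    rw [Finset.sum_apply, Finset.sum_eq_single y]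
    · simp
    · intro x _ hx
      rw [Pi.smul_apply, Pi.single_eq_of_ne hx.symm, smul_zero]
    · intro hy
      rw [Finsupp.notMem_support_iff, toFin_apply] at hy
      rw [hy, zero_smul]; rfl
  conv_rhs => rw [this]
  rw [map_sum]
  refine Finset.sum_congr rfl fun x hx => ?_
  rw [map_smul, ← basisD_val (d.2.2.2 x (Finsupp.mem_support_iff.1 hx))]
  rfl

theorem map_eq_linearCombination [NeZero n] {W : Type*} [AddCommGroup W] [Module ℚ W]
    (ψ : D n s →ₗ[ℚ] W) (d : D n s) :
    ψ d = Finsupp.linearCombination ℚ (fun x => ψ (basisD n s x)) (toFin n s d) := by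
  conv_lhs => rw [← linearCombination_basisD d]
  rw [Finsupp.apply_linearCombination]; rfl

end Basis

section Average

variable {n : ℕ}

/-- The sum over an orbit. -/
noncomputable def avg {s : ℕ} (f : (Fin s → Vec n) → ℚ) (x : Fin s → Vec n) : ℚ :=
  ∑ᶠ γ : Γ n, f (act γ x)

/-- Functions with finite support on orbits. -/
def OrbFin {s : ℕ} (f : (Fin s → Vec n) → ℚ) : Prop :=
  ∀ x, (Function.support fun γ : Γ n => f (act γ x)).Finite

theorem act_inj {s : ℕ} {x : Fin s → Vec n} (hx : qspan x = ⊤) :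
    Function.Injective fun γ : Γ n => act γ x := fun γ δ h =>
  (inv_mul_eq_one.1 (act_free (γ := δ⁻¹ * γ) hx (by
    rw [act_mul, show act γ x = act δ x from h, act_inv_act]))).symm

theorem orbFin_of_finite {s : ℕ} {f : (Fin s → Vec n) → ℚ} (hf : f.support.Finite)
    (hS : ∀ x, f x ≠ 0 → qspan x = ⊤) : OrbFin f := fun x => by
  by_cases hx : qspan x = ⊤
  · exact hf.preimage (act_inj hx).injOn
  · convert Set.finite_empty
    refine Set.eq_empty_of_forall_notMem fun γ hγ => hx ?_
    exact (qspan_act_iff γ).1 (hS _ hγ)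

theorem orbFin_D {s : ℕ} (f : D n s) : OrbFin f.1 :=
  orbFin_of_finite f.2.2.1 fun x hx => (f.2.2.2 x hx).2

theorem avg_comm {s t : ℕ} {J : Type*} [Fintype J] (c : J → ℚ)
    (h : J → (Fin t → Vec n) → (Fin s → Vec n)) (hh : ∀ j γ x, h j (act γ x) = act γ (h j x))
    {f : (Fin s → Vec n) → ℚ} (hf : OrbFin f) (x : Fin t → Vec n) :
    avg (fun y => ∑ j, c j * f (h j y)) x = ∑ j, c j * avg f (h j x) := by
  simp only [avg, hh]
  rw [finsum_sum_comm]
  · exact Finset.sum_congr rfl fun j _ => (mul_finsum _ _).symm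
  · exact fun j _ => (hf (h j x)).subset fun γ hγ h0 => hγ (by
      change c j * f _ = 0
      rw [show f (act γ (h j x)) = 0 from h0, mul_zero])

theorem avg_invariant {s : ℕ} (f : (Fin s → Vec n) → ℚ) (γ : Γ n) (x) :
    avg f (act γ x) = avg f x := by
  simp only [avg, ← act_mul]
  exact finsum_comp_equiv (Equiv.mulRight γ) (f := fun δ => f (act δ x))

theorem AE.avg {s : ℕ} {f : (Fin s → Vec n) → ℚ} (hf : AE f) : AE (avg f) := by
  refine ⟨fun σ x => ?_, fun x y h => ?_⟩
  · simp only [SLCoh.avg]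
    rw [mul_finsum]
    exact finsum_congr fun γ => by rw [← act_comp, hf.alt]
  · exact finsum_congr fun γ => hf.even _ _ (act_neg_of γ h)

theorem avg_del {s : ℕ} {f : (Fin s → Vec n) → ℚ} (hf : OrbFin f) :
    avg (del f) = del (avg f) := by
  ext x
  rw [del_apply, ← avg_comm (n := n) _ (fun (i : Fin (s + 1)) x => i.removeNth x)
    (fun _ _ _ => rfl) hf]
  refine finsum_congr fun γ => ?_
  rw [del_apply]

theorem avg_piAE {s : ℕ} {f : (Fin s → Vec n) → ℚ} (hf : OrbFin f) :
    avg (piAE s f) = piAE s (avg f) := by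
  ext x
  have h := avg_comm (n := n) (fun j : Perm (Fin s) × (Fin s → ℤˣ) =>
    ((2 ^ s * s.factorial : ℕ) : ℚ)⁻¹ * ((Perm.sign j.1 : ℤ) : ℚ))
    (fun j x i => j.2 i • x (j.1 i)) (fun j γ x => by
      ext i : 1
      simp only [act_apply]
      rcases Int.units_eq_one_or (j.2 i) with h | h <;>
        simp only [h, one_smul, Units.neg_smul, Matrix.mulVec_neg]) hf x
  have e : ∀ (g : (Fin s → Vec n) → ℚ) y, piAE s g y =
      ∑ j : Perm (Fin s) × (Fin s → ℤˣ), ((2 ^ s * s.factorial : ℕ) : ℚ)⁻¹ *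
        ((Perm.sign j.1 : ℤ) : ℚ) * g (fun i => j.2 i • y (j.1 i)) := fun g y => by
    rw [piAE_apply, Fintype.sum_prod_type, Finset.mul_sum]
    refine Finset.sum_congr rfl fun σ _ => ?_
    rw [Finset.mul_sum]
    exact Finset.sum_congr rfl fun e _ => (mul_assoc _ _ _).symm
  rw [e, ← h]
  exact finsum_congr fun γ => e f _

theorem avg_eq_zero {s : ℕ} {f : (Fin s → Vec n) → ℚ} {x : Fin s → Vec n}
    (h : ∀ γ : Γ n, f (act γ x) = 0) : avg f x = 0 := by
  simp [avg, h]

/-- Orbit sums of elements of `D n s`. -/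
noncomputable def avgD (n s : ℕ) : D n s →ₗ[ℚ] ((Fin s → Vec n) → ℚ) where
  toFun f := avg f.1
  map_add' f g := funext fun x => finsum_add_distrib (orbFin_D f x) (orbFin_D g x)
  map_smul' c f := funext fun x => (mul_finsum _ _).symm

theorem avgD_apply {s : ℕ} (f : D n s) (x) : avgD n s f x = avg f.1 x := rfl

variable [NeZero n]

theorem avgD_ρD {s : ℕ} (γ : Γ n) (f : D n s) : avgD n s (ρD n s γ f) = avgD n s f := by
  ext x
  rw [avgD_apply, avgD_apply]
  have : ∀ δ : Γ n, (ρD n s γ f).1 (act δ x) = f.1 (act (γ⁻¹ * δ) x) := fun δ => by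
    rw [act_mul]; rfl
  simp only [avg, this]
  exact finsum_comp_equiv (Equiv.mulLeft γ⁻¹) (f := fun δ => f.1 (act δ x))

theorem avgD_zero {s : ℕ} (f : D n s) {x} (hx : x ∉ KS n s) : avgD n s f x = 0 :=
  avg_eq_zero fun γ => D_zero f.2 fun h => hx ((act_mem_KS γ).1 h)

theorem avgD_dD (hn : 2 ≤ n) {s : ℕ} (f : D n s) {x} (hx : x ∈ (KK n).car (s + 1)) :
    avgD n (s + 1) (dD hn s f) x = del (avgD n s f) x := by
  change _ = del (avg f.1) x
  rw [← avg_del (orbFin_D f)]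
  exact finsum_congr fun γ => dD_apply hn f ((act_mem_KL_iff γ).2 hx)

theorem eq_zero_of_avgD {s : ℕ} {ψ : D n s →ₗ[ℚ] ℚ} (hψ : ∀ γ f, ψ (ρD n s γ f) = ψ f)
    {f : D n s} (hf : avgD n s f = 0) : ψ f = 0 := by
  classical
  obtain ⟨u, hu1, hu2⟩ := exists_orbit_section n s
  rw [map_eq_linearCombination, Finsupp.linearCombination_apply, Finsupp.sum,
    ← Finset.sum_fiberwise_of_maps_to (t := (toFin n s f).support.image fun x => act (u x) x)
      (g := fun x => act (u x) x) fun x hx => Finset.mem_image_of_mem _ hx]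
  refine Finset.sum_eq_zero fun r hr => ?_
  obtain ⟨x0, hx0, hr0⟩ := Finset.mem_image.1 hr
  have hx0S : qspan x0 = ⊤ := (f.2.2.2 x0 (Finsupp.mem_support_iff.1 hx0)).2
  have hrS : qspan r = ⊤ := by rw [← hr0]; exact (qspan_act_iff _).2 hx0S
  have h1 : ∀ x ∈ {x ∈ (toFin n s f).support | act (u x) x = r},
      toFin n s f x • ψ (basisD n s x) = f.1 x * ψ (basisD n s r) := fun x hx => by
    rw [← (Finset.mem_filter.1 hx).2, basisD_act, hψ]; rfl
  rw [Finset.sum_congr rfl h1, ← Finset.sum_mul]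
  refine mul_eq_zero_of_left ?_ _
  rw [← finsum_mem_eq_sum_of_inter_support_eq (s := Set.range fun γ : Γ n => act γ r),
    finsum_mem_range (act_inj hrS)]
  · exact congrFun hf r
  · ext x
    simp only [Set.mem_inter_iff, Set.mem_range, Function.mem_support, Finset.coe_filter,
      Finsupp.mem_support_iff, toFin_apply, Set.mem_ofPred_eq]
    refine and_congr_left fun hx => ?_
    constructor
    · rintro ⟨γ, rfl⟩
      refine ⟨hx, ?_⟩
      rw [← hr0, hu1, hu1]
    · rintro ⟨-, h⟩
      exact ⟨(u x)⁻¹, by rw [← h, act_inv_act]⟩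

theorem exists_avgD_eq {μ : (Fin n → Vec n) → ℚ} (hμ : AE μ) (hinv : ∀ γ x, μ (act γ x) = μ x)
    (hS : ∀ x, x ∉ KS n n → μ x = 0) : ∃ g : D n n, avgD n n g = μ := by
  classical
  obtain ⟨u, hu1, hu2⟩ := exists_orbit_section n n
  obtain ⟨R, hR, hRx⟩ := exists_finite_reps n
  let g : (Fin n → Vec n) → ℚ := fun x =>
    if x ∈ (fun x => act (u x) x) '' R then μ x else 0
  have hgS : ∀ x, g x ≠ 0 → x ∈ KS n n := fun x hx => by
    by_contra hc
    refine hx ?_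
    simp only [g, hS x hc, ite_self]
  have hgf : g.support.Finite := (hR.image fun x => act (u x) x).subset fun x hx => by
    by_contra hc
    exact hx (if_neg hc)
  refine ⟨⟨_, piAE_mem_D hgf hgS⟩, ?_⟩
  change avg (piAE n g) = μ
  rw [avg_piAE (orbFin_of_finite hgf fun x hx => (hgS x hx).2)]
  refine Eq.trans ?_ hμ.piAE_eq
  congr 1
  ext x
  by_cases hx : x ∈ KS n n
  · obtain ⟨γ, hγ⟩ := hRx x hx.1 hx.2
    rw [avg, finsum_eq_single _ (u x)]
    · have : act (u x) x ∈ (fun x => act (u x) x) '' R := ⟨_, hγ, hu1 γ x⟩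
      simp only [g, if_pos this, hinv]
    · intro δ hδ
      refine if_neg ?_
      rintro ⟨y, hy, h⟩
      have h : act (u y) y = act δ x := h
      refine hδ (act_inj hx.2 ?_)
      change act δ x = act (u x) x
      have h2 : y = act ((u y)⁻¹ * δ) x := by rw [act_mul, ← h, act_inv_act]
      rw [← h, h2, hu1]
  · rw [hS x hx]
    refine avg_eq_zero fun γ => ?_
    by_contra h
    exact hx ((act_mem_KS γ).1 (hgS _ h))

/-- Invariant functionals on the image of the coboundary extend. -/
theorem exists_invariant_extension {m : ℕ} (hm : 2 ≤ m) (hn : 2 ≤ m + 1)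
    {ψ : D (m + 1) (m + 2) →ₗ[ℚ] ℚ} (hψ : ∀ γ f, ψ (ρD _ _ γ f) = ψ f)
    (hker : ∀ f, dD hn (m + 2) f = 0 → ψ f = 0) :
    ∃ θ : D (m + 1) (m + 3) →ₗ[ℚ] ℚ, (∀ γ f, θ (ρD _ _ γ f) = θ f) ∧
      ∀ f, θ (dD hn (m + 2) f) = ψ f := by
  let A := (avgD (m + 1) (m + 3)).comp (dD hn (m + 2))
  have hA : LinearMap.ker A ≤ LinearMap.ker ψ := by
    intro f hf
    have hf : avgD (m + 1) (m + 3) (dD hn (m + 2) f) = 0 := hf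
    obtain ⟨μ, hμ, hμinv, hμS, hμd⟩ := exists_invariant_primitive_KS hm
      (lam := avgD _ _ f) f.2.1.avg (avg_invariant _) (fun x hx => avgD_zero f hx)
      (fun x hx => by rw [← avgD_dD hn f hx.1, hf]; rfl)
    obtain ⟨g, hg⟩ := exists_avgD_eq hμ hμinv hμS
    have h1 : avgD _ _ (f - dD hn (m + 1) g) = 0 := by
      ext x
      by_cases hx : x ∈ KS (m + 1) (m + 2)
      · rw [map_sub, Pi.sub_apply, avgD_dD hn g hx.1, hg, hμd x hx, sub_self]; rfl
      · exact avgD_zero _ hx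
    have h2 := eq_zero_of_avgD hψ h1
    rw [map_sub, hker _ (dD_dD hn g), sub_zero] at h2
    exact h2
  obtain ⟨θ, hθ⟩ : ∃ θ : ((Fin (m + 3) → Vec (m + 1)) → ℚ) →ₗ[ℚ] ℚ, θ.comp A = ψ := by
    have : ψ ∈ LinearMap.range A.dualMap := by
      rw [LinearMap.range_dualMap_eq_dualAnnihilator_ker, Submodule.mem_dualAnnihilator]
      exact fun f hf => hA hf
    exact this
  refine ⟨θ.comp (avgD _ _), fun γ f => ?_, fun f => ?_⟩
  · rw [LinearMap.comp_apply, LinearMap.comp_apply, avgD_ρD]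
  · exact LinearMap.congr_fun hθ f

end Average

open CategoryTheory

section Projective

variable {n : ℕ} [NeZero n]

/-- The representation on finitely supported functions on spanning tuples. -/
noncomputable abbrev DRep (n s : ℕ) [NeZero n] : Rep.{0} ℚ (Γ n) := Rep.of (ρD n s)

theorem exists_equivariant_lift {s : ℕ} {E X : Rep.{0} ℚ (Γ n)} (f : DRep n s ⟶ X) (e : E ⟶ X)
    (he : Function.Surjective e.hom) : ∃ g : DRep n s ⟶ E, g ≫ e = f := by
  classical
  obtain ⟨u, hu1, hu2⟩ := exists_orbit_section n s
  choose L0 hL0 using fun x => he (f.hom (basisD n s x))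
  let L : (Fin s → Vec n) → E := fun x =>
    if qspan x = ⊤ then E.ρ (u x)⁻¹ (L0 (act (u x) x)) else 0
  have hL : ∀ γ x, L (act γ x) = E.ρ γ (L x) := fun γ x => by
    by_cases hx : qspan x = ⊤
    · simp only [L, if_pos hx, if_pos ((qspan_act_iff γ).2 hx), hu1]
      rw [← Module.End.mul_apply, ← map_mul, ← hu2 γ x hx]
      simp
    · simp only [L, if_neg hx, if_neg fun h => hx ((qspan_act_iff γ).1 h), map_zero]
  have hLe : ∀ x, e.hom (L x) = f.hom (basisD n s x) := fun x => by
    by_cases hx : qspan x = ⊤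
    · simp only [L, if_pos hx]
      rw [Rep.hom_comm_apply, hL0, ← Rep.hom_comm_apply]
      congr 1
      change ρD n s _ _ = _
      rw [← basisD_act, act_inv_act]
    · simp only [L, if_neg hx]
      rw [basisD_zero fun h => hx h.2, map_zero, map_zero]
  let g : D n s →ₗ[ℚ] E := (Finsupp.linearCombination ℚ L).comp (toFin n s)
  have hg : ∀ γ d, g (ρD n s γ d) = E.ρ γ (g d) := fun γ d => by
    simp only [g, LinearMap.comp_apply, toFin_ρD, Finsupp.linearCombination_mapDomain]
    rw [show L ∘ act γ = (E.ρ γ) ∘ L from funext fun x => hL γ x,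
      Finsupp.linearCombination_linear_comp]
    rfl
  refine ⟨Rep.ofHom (LinearMap.intertwiningMap_of_isIntertwiningMap _ _ g hg), ?_⟩
  ext d
  change e.hom (g d) = f.hom d
  have h := map_eq_linearCombination f.hom.toLinearMap d
  refine Eq.trans ?_ h.symm
  change e.hom.toLinearMap (Finsupp.linearCombination ℚ L (toFin n s d)) = _
  rw [Finsupp.apply_linearCombination]
  congr 2
  exact funext hLe

instance projective_DRep (s : ℕ) : Projective (DRep n s) where
  factors f e _ := exists_equivariant_lift f e ((Rep.epi_iff_surjective e).1 inferInstance)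

end Projective

section Ext

variable {G : Type} [Group G]

instance hasExt_rep : HasExt.{0} (Rep.{0} ℚ G) := hasExt_of_enoughProjectives _

theorem subsingleton_groupCohomology_of_ext {A : Rep.{0} ℚ G} {q : ℕ}
    (h : Subsingleton (Abelian.Ext (Rep.trivial ℚ G ℚ) A (q + 1))) :
    Subsingleton (groupCohomology A (q + 1)) := by
  let P := Rep.barResolution ℚ G
  refine (groupCohomologyIso A (q + 1) P).toLinearEquiv.toEquiv.subsingleton_congr.2 ?_
  suffices (P.complex.linearYonedaObj ℚ A).ExactAt (q + 1) from
    ModuleCat.subsingleton_of_isZero this.isZero_homology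
  rw [HomologicalComplex.exactAt_iff' _ q (q + 1) (q + 2) (by simp) (by simp),
    ShortComplex.moduleCat_exact_iff]
  intro (f : P.complex.X (q + 1) ⟶ A) hf
  have hf : P.complex.d (q + 2) (q + 1) ≫ f = 0 := hf
  have h1 := (P.extMk_eq_zero_iff f (q + 2) rfl hf q rfl).1 (Subsingleton.elim _ _)
  exact h1

end Ext

section Perfect

open Matrix.SpecialLinearGroup (transvection)

variable {n : ℕ}

theorem transvection_mul_entry {i j : Fin n} (hij : i ≠ j) (b : ℤ) (γ : Γ n) (a c : Fin n) :
    (transvection hij b * γ).1 a c = γ.1 a c + if a = i then b * γ.1 j c else 0 := by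
  rw [Matrix.SpecialLinearGroup.coe_mul]
  change (Matrix.transvection i j b * γ.1) a c = _
  split_ifs with h
  · rw [h, Matrix.transvection_mul_apply_same]
  · rw [Matrix.transvection_mul_apply_of_ne _ _ _ _ h, add_zero]

/-- The first `k` columns are standard basis vectors. -/
def StdCols (k : ℕ) (γ : Γ n) : Prop := ∀ c : Fin n, c.1 < k → ∀ a, γ.1 a c = if a = c then 1 else 0

theorem StdCols.transvection_mul {k : ℕ} {γ : Γ n} (h : StdCols k γ) {i j : Fin n} (hij : i ≠ j)
    (hj : k ≤ j.1) (b : ℤ) : StdCols k (transvection hij b * γ) := fun c hc a => by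
  rw [transvection_mul_entry, h c hc, h c hc, if_neg (show j ≠ c from fun h => by
    rw [h] at hj; omega)]
  simp

theorem StdCols.inv {k : ℕ} {γ : Γ n} (h : StdCols k γ) : StdCols k γ⁻¹ := fun c hc a => by
  have h1 : (γ⁻¹ * γ).1 a c = if a = c then 1 else 0 := by
    rw [inv_mul_cancel]; exact Matrix.one_apply
  rw [Matrix.SpecialLinearGroup.coe_mul, Matrix.mul_apply, Finset.sum_eq_single c] at h1
  · rwa [h c hc, if_pos rfl, mul_one] at h1
  · intro b _ hb
    rw [h c hc, if_neg hb, mul_zero]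
  · simp

variable {H : Subgroup (Γ n)}

theorem mem_of_transvection_mul
    (hH : ∀ (i j : Fin n) (hij : i ≠ j) (b : ℤ), transvection hij b ∈ H)
    {i j : Fin n} (hij : i ≠ j) (b : ℤ) {γ : Γ n}
    (h : transvection hij b * γ ∈ H) : γ ∈ H := (H.mul_mem_cancel_left (hH i j hij b)).1 h

theorem mem_of_pivot_one
    (hH : ∀ (i j : Fin n) (hij : i ≠ j) (b : ℤ), transvection hij b ∈ H)
    {k : Fin n} (ih : ∀ γ : Γ n, StdCols (k + 1) γ → γ ∈ H) (N : ℕ) :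
    ∀ γ : Γ n, StdCols k γ → γ.1 k k = 1 →
      (Finset.univ.filter fun a => a ≠ k ∧ γ.1 a k ≠ 0).card ≤ N → γ ∈ H := by
  induction N with
  | zero =>
    intro γ h h1 h0
    refine ih γ fun c hc a => ?_
    rcases Nat.lt_succ_iff_lt_or_eq.1 hc with hc | hc
    · exact h c hc a
    · obtain rfl : c = k := Fin.ext hc
      split_ifs with hac
      · rw [hac, h1]
      · by_contra hne
        have := Finset.card_eq_zero.1 (Nat.le_zero.1 h0)
        exact Finset.notMem_empty a (this ▸ by simp [hac, hne])
  | succ N ihN =>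
    intro γ h h1 hN
    by_cases he : ∃ a, a ≠ k ∧ γ.1 a k ≠ 0
    · obtain ⟨a, hak, ha⟩ := he
      refine mem_of_transvection_mul hH hak (-γ.1 a k)
        (ihN _ (h.transvection_mul hak le_rfl _) ?_ ?_)
      · rw [transvection_mul_entry, if_neg hak.symm, h1, add_zero]
      · refine Nat.le_of_lt_succ (lt_of_lt_of_le (Finset.card_lt_card ?_) hN)
        refine (Finset.ssubset_iff_of_subset fun b hb => ?_).2 ⟨a, by simp [hak, ha], ?_⟩
        · simp only [Finset.mem_filter, Finset.mem_univ, true_and] at hb ⊢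
          refine ⟨hb.1, fun h0 => hb.2 ?_⟩
          rw [transvection_mul_entry, h1, h0]
          split_ifs with hba
          · rw [← hba, h0]; simp
          · rfl
        · simp only [Finset.mem_filter, Finset.mem_univ, true_and, not_and, not_not]
          intro _
          rw [transvection_mul_entry, if_pos rfl, h1]
          ring
    · refine ihN γ h h1 ?_
      push Not at he
      rw [Finset.filter_false_of_mem fun a _ h => h.2 (he a h.1)]
      simp

theorem mem_of_single_entry
    (hH : ∀ (i j : Fin n) (hij : i ≠ j) (b : ℤ), transvection hij b ∈ H)
    {k p : Fin n} (ih : ∀ γ : Γ n, StdCols (k + 1) γ → γ ∈ H) {γ : Γ n}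
    (h : StdCols k γ) (hp : k ≤ p) (hγ : ∀ i, k ≤ i → i ≠ p → γ.1 i k = 0) : γ ∈ H := by
  have h1 : (γ⁻¹ * γ).1 k k = 1 := by
    rw [inv_mul_cancel]; exact Matrix.one_apply_eq _
  have hunit : (γ⁻¹).1 k p * γ.1 p k = 1 := by
    rw [Matrix.SpecialLinearGroup.coe_mul, Matrix.mul_apply, Finset.sum_eq_single p] at h1
    · exact h1
    · intro b _ hb
      rcases lt_or_ge b k with hbk | hbk
      · rw [h.inv b hbk, if_neg hbk.ne', zero_mul]
      · rw [hγ b hbk hb, mul_zero]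
    · simp
  have hd : γ.1 p k * γ.1 p k = 1 := by
    rcases Int.isUnit_iff.1 (IsUnit.of_mul_eq_one_right _ hunit) with h | h <;> rw [h] <;> norm_num
  have fin : ∀ γ : Γ n, StdCols k γ → γ.1 k k = 1 → γ ∈ H := fun γ h h1 =>
    mem_of_pivot_one hH ih _ γ h h1 le_rfl
  by_cases hpk : p = k
  · subst hpk
    by_cases hl : ∃ j : Fin n, p < j
    · obtain ⟨j, hj⟩ := hl
      refine mem_of_transvection_mul hH hj.ne' (γ.1 p p)
        (mem_of_transvection_mul hH hj.ne (1 - γ.1 p p) (fin _ ?_ ?_))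
      · exact (h.transvection_mul _ le_rfl _).transvection_mul _ hj.le _
      · rw [transvection_mul_entry, if_pos rfl, transvection_mul_entry, transvection_mul_entry,
          if_neg hj.ne, if_pos rfl, hγ j hj.le hj.ne', hd]
        ring
    · push Not at hl
      refine fin γ h ?_
      have hdet := γ.2
      rw [Matrix.det_of_isUpperTriangular, Finset.prod_eq_single p] at hdet
      · exact hdet
      · intro b _ hb
        rw [h b (show b < p from lt_of_le_of_ne (hl b) hb), if_pos rfl]
      · simp
      · intro a b hab
        have hab : b < a := hab
        rw [h b (show b < p from lt_of_lt_of_le hab (hl a)), if_neg hab.ne']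
  · refine mem_of_transvection_mul hH (Ne.symm hpk) (γ.1 p k)
      (fin _ (h.transvection_mul _ hp _) ?_)
    rw [transvection_mul_entry, if_pos rfl, hγ k le_rfl (Ne.symm hpk), hd, zero_add]

theorem mem_of_stdCols
    (hH : ∀ (i j : Fin n) (hij : i ≠ j) (b : ℤ), transvection hij b ∈ H)
    {k : Fin n} (ih : ∀ γ : Γ n, StdCols (k + 1) γ → γ ∈ H) (N : ℕ) :
    ∀ γ : Γ n, StdCols k γ → ∑ i ∈ Finset.Ici k, (γ.1 i k).natAbs ≤ N → γ ∈ H := by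
  induction N using Nat.strong_induction_on with
  | _ N ihN =>
    intro γ h hN
    by_cases he : ∃ i j : Fin n, k ≤ i ∧ k ≤ j ∧ i ≠ j ∧ γ.1 j k ≠ 0 ∧
        (γ.1 j k).natAbs ≤ (γ.1 i k).natAbs
    · obtain ⟨i, j, hi, hj, hij, h0, hle⟩ := he
      obtain ⟨s, hs⟩ : ∃ s : ℤ, (γ.1 i k + s * γ.1 j k).natAbs < (γ.1 i k).natAbs := by
        rcases le_total 0 (γ.1 i k) with h1 | h1 <;> rcases le_total 0 (γ.1 j k) with h2 | h2
        · exact ⟨-1, by omega⟩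
        · exact ⟨1, by omega⟩
        · exact ⟨1, by omega⟩
        · exact ⟨-1, by omega⟩
      refine mem_of_transvection_mul hH hij s (ihN _ (lt_of_lt_of_le ?_ hN) _
        (h.transvection_mul hij hj s) le_rfl)
      refine Finset.sum_lt_sum (fun a _ => ?_) ⟨i, Finset.mem_Ici.2 hi, ?_⟩
      · rw [transvection_mul_entry]
        split_ifs with ha
        · rw [ha]; exact hs.le
        · rw [add_zero]
      · rw [transvection_mul_entry, if_pos rfl]; exact hs
    · push Not at he
      by_cases hz : ∃ p, k ≤ p ∧ γ.1 p k ≠ 0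
      · obtain ⟨p, hp, hp0⟩ := hz
        refine mem_of_single_entry hH ih h hp fun i hi hip => ?_
        by_contra hi0
        have h1 := he i p hi hp hip hp0
        have h2 := he p i hp hi hip.symm hi0
        omega
      · push Not at hz
        exact mem_of_single_entry hH ih h le_rfl fun i hi _ => hz i hi

/-- Transvections generate `SL_n(ℤ)`. -/
theorem eq_top_of_transvection_mem
    (hH : ∀ (i j : Fin n) (hij : i ≠ j) (b : ℤ), transvection hij b ∈ H)
    : H = ⊤ := by
  refine (Subgroup.eq_top_iff' H).2 ?_
  have key : ∀ j k : ℕ, j + k = n → ∀ γ : Γ n, StdCols k γ → γ ∈ H := by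
    intro j
    induction j with
    | zero =>
      intro k hk γ h
      have : γ = 1 := by
        ext a c
        exact (h c (by omega) a).trans Matrix.one_apply.symm
      rw [this]
      exact H.one_mem
    | succ j ihj =>
      intro k hk γ h
      exact mem_of_stdCols hH (k := ⟨k, by omega⟩) (ihj (k + 1) (by omega)) _ γ h le_rfl
  exact fun γ => key n 0 rfl γ fun c hc => absurd hc (by omega)

theorem transvection_comm {i j k : Fin n} (hij : i ≠ j) (hik : i ≠ k) (hkj : k ≠ j) (b : ℤ) :
    transvection hik b * transvection hkj 1 =
      transvection hij b * transvection hkj 1 * transvection hik b := by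
  apply Subtype.ext
  simp [Matrix.SpecialLinearGroup.transvection_coe, mul_add, add_mul,
    Matrix.single_mul_single_of_ne _ _ _ _ hij.symm,
    Matrix.single_mul_single_of_ne _ _ _ _ hkj.symm]
  abel

/-- For `n ≥ 3`, every homomorphism from `SL_n(ℤ)` to a commutative group is trivial. -/
theorem hom_trivial (hn : 3 ≤ n) {A : Type*} [CommGroup A] (χ : Γ n →* A) (γ : Γ n) : χ γ = 1 := by
  have : χ.ker = ⊤ := eq_top_of_transvection_mem fun i j hij b => by
    obtain ⟨k, hk⟩ : ∃ k : Fin n, k ∉ ({i, j} : Finset (Fin n)) := by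
      by_contra! hc
      have h1 := Finset.card_le_card (fun x _ => hc x : (Finset.univ : Finset (Fin n)) ⊆ {i, j})
      have h2 := Finset.card_le_two (a := i) (b := j)
      rw [Finset.card_univ, Fintype.card_fin] at h1
      omega
    simp only [Finset.mem_insert, Finset.mem_singleton, not_or] at hk
    have h := congrArg χ (transvection_comm hij (Ne.symm hk.1) hk.2 b)
    simp only [map_mul] at h
    rw [MonoidHom.mem_ker]
    rw [mul_assoc, mul_comm (χ (transvection hk.2 1))] at h
    exact (mul_eq_right.1 h.symm)
  exact MonoidHom.mem_ker.1 (this ▸ Subgroup.mem_top γ)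

end Perfect

section ExtAux

variable {G : Type} [Group G]

theorem shortExact_mk {X₁ X₂ X₃ : Rep.{0} ℚ G} (f : X₁ ⟶ X₂) (g : X₂ ⟶ X₃) (w : f ≫ g = 0)
    (hf : Function.Injective f.hom) (hg : Function.Surjective g.hom)
    (he : ∀ x, g.hom x = 0 → ∃ y, f.hom y = x) : (ShortComplex.mk f g w).ShortExact := by
  have h1 : (ShortComplex.mk f g w).Exact := by
    rw [← ShortComplex.exact_map_iff_of_faithful _ (forget₂ (Rep.{0} ℚ G) (ModuleCat ℚ)),
      ShortComplex.moduleCat_exact_iff]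
    exact he
  exact { exact := h1, mono_f := (Rep.mono_iff_injective f).2 hf
          epi_g := (Rep.epi_iff_surjective g).2 hg }

theorem projective_of_shortExact {S : ShortComplex (Rep.{0} ℚ G)} (hS : S.ShortExact)
    [Projective S.X₂] [Projective S.X₃] : Projective S.X₁ := by
  have s := hS.splittingOfProjective
  exact Retract.projective ⟨S.f, s.r, s.f_r⟩

theorem subsingleton_ext_succ {S : ShortComplex (Rep.{0} ℚ G)} (hS : S.ShortExact)
    {A : Rep.{0} ℚ G} {q : ℕ} [Projective S.X₂] (h : Subsingleton (Abelian.Ext S.X₁ A q)) :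
    Subsingleton (Abelian.Ext S.X₃ A (q + 1)) := by
  refine subsingleton_of_forall_eq 0 fun x => ?_
  obtain ⟨y, rfl⟩ := Abelian.Ext.contravariant_sequence_exact₃ hS A x
    (Abelian.Ext.eq_zero_of_projective _) (add_comm 1 q)
  rw [Subsingleton.elim y 0, Abelian.Ext.comp_zero]

theorem subsingleton_ext_one {S : ShortComplex (Rep.{0} ℚ G)} (hS : S.ShortExact)
    {A : Rep.{0} ℚ G} [Projective S.X₂] (h : ∀ f : S.X₁ ⟶ A, ∃ g : S.X₂ ⟶ A, S.f ≫ g = f) :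
    Subsingleton (Abelian.Ext S.X₃ A 1) := by
  refine subsingleton_of_forall_eq 0 fun x => ?_
  obtain ⟨y, rfl⟩ := Abelian.Ext.contravariant_sequence_exact₃ hS A x
    (Abelian.Ext.eq_zero_of_projective _) (add_comm 1 0)
  obtain ⟨f, rfl⟩ := Abelian.Ext.addEquiv₀.symm.surjective y
  obtain ⟨g, rfl⟩ := h f
  change hS.extClass.comp (Abelian.Ext.mk₀ (S.f ≫ g)) _ = 0
  rw [← Abelian.Ext.mk₀_comp_mk₀, hS.extClass_comp_assoc]

end ExtAux

section Boundaries

variable {n : ℕ} [NeZero n] (hn : 2 ≤ n) (s : ℕ)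

noncomputable def bdry : Rep.{0} ℚ (Γ n) :=
  Rep.subrepresentation (DRep n (s + 1)) (LinearMap.range (dD hn s)) fun γ x hx => by
    obtain ⟨f, rfl⟩ := hx
    exact ⟨ρD n s γ f, dD_ρD hn γ f⟩

noncomputable def bdryι : bdry hn s ⟶ DRep n (s + 1) := Rep.subtype _ _ _

noncomputable def bdryπ : DRep n s ⟶ bdry hn s :=
  Rep.ofHom (LinearMap.intertwiningMap_of_isIntertwiningMap _ _ (dD hn s).rangeRestrict
    fun γ f => Subtype.ext (dD_ρD hn γ f))

theorem bdryι_injective : Function.Injective (bdryι hn s).hom := Subtype.val_injective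

theorem bdryπ_surjective : Function.Surjective (bdryπ hn s).hom :=
  (dD hn s).surjective_rangeRestrict

theorem bdryι_π : bdryι hn s ≫ bdryπ hn (s + 1) = 0 := by
  ext x
  obtain ⟨f, rfl⟩ := bdryπ_surjective hn s x
  exact Subtype.ext (dD_dD hn f)

noncomputable abbrev bdrySeq : ShortComplex (Rep.{0} ℚ (Γ n)) := .mk _ _ (bdryι_π hn s)

theorem bdrySeq_shortExact (h : ∀ f, dD hn (s + 1) f = 0 → ∃ g, dD hn s g = f) :
    (bdrySeq hn s).ShortExact := by
  refine shortExact_mk _ _ _ (bdryι_injective hn s) (bdryπ_surjective hn _) fun x hx => ?_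
  obtain ⟨g, hg⟩ := h x (congrArg Subtype.val hx)
  exact ⟨(bdryπ hn s).hom g, hg⟩

theorem projective_bdry {k : ℕ} (h : ∀ t, k ≤ t → ∀ f, dD hn (t + 1) f = 0 → ∃ g, dD hn t g = f) :
    ∀ t, k ≤ t → Projective (bdry hn t) := by
  have key : ∀ j t, k ≤ t → 2 ^ n ≤ t + j → Projective (bdry hn t) := by
    intro j
    induction j with
    | zero =>
      intro t ht ht'
      have : Subsingleton (D n (t + 1)) := ⟨fun a b => D_ext fun x hx => by
        rw [AE.eq_zero_of_large (by omega) a.2.1 hx, AE.eq_zero_of_large (by omega) b.2.1 hx]⟩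
      have h0 : Limits.IsZero (bdry hn t) := by
        rw [Limits.IsZero.iff_id_eq_zero]
        ext x
        exact bdryι_injective hn t (Subsingleton.elim (α := D n (t + 1)) _ _)
      exact h0.projective
    | succ j ih =>
      intro t ht ht'
      have := ih (t + 1) (by omega) (by omega)
      exact projective_of_shortExact (bdrySeq_shortExact hn t (h t ht))
  exact fun t ht => key (2 ^ n) t ht (by omega)

noncomputable def cyc : Rep.{0} ℚ (Γ n) :=
  Rep.subrepresentation (DRep n s) (LinearMap.ker (dD hn s)) fun γ x hx => by
    have hx : dD hn s x = 0 := hx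
    change dD hn s (ρD n s γ x) = 0
    rw [dD_ρD, hx, map_zero]

noncomputable def cycι : cyc hn s ⟶ DRep n s := Rep.subtype _ _ _

theorem projective_cyc [Projective (bdry hn s)] : Projective (cyc hn s) := by
  have w : cycι hn s ≫ bdryπ hn s = 0 := by
    ext x
    exact Subtype.ext x.2
  have h : (ShortComplex.mk _ _ w).ShortExact :=
    shortExact_mk _ _ _ Subtype.val_injective (bdryπ_surjective hn s)
      fun x hx => ⟨⟨x, congrArg Subtype.val hx⟩, rfl⟩
  exact projective_of_shortExact h

noncomputable def bdryToCyc : bdry hn s ⟶ cyc hn (s + 1) :=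
  Rep.ofHom (LinearMap.intertwiningMap_of_isIntertwiningMap _ _
    (Submodule.inclusion (by rintro _ ⟨f, rfl⟩; exact dD_dD hn f)) fun γ f => rfl)

end Boundaries

section Final

theorem subsingleton_ext_bdry_one {m : ℕ} (hm : 2 ≤ m) (hn : 2 ≤ m + 1)
    (h : ∀ f, dD hn (m + 3) f = 0 → ∃ g, dD hn (m + 2) g = f) :
    Subsingleton (Abelian.Ext (bdry hn (m + 3)) (Rep.trivial ℚ (Γ (m + 1)) ℚ) 1) := by
  refine subsingleton_ext_one (bdrySeq_shortExact hn (m + 2) h) fun f => ?_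
  let ψ : D (m + 1) (m + 2) →ₗ[ℚ] ℚ := (bdryπ hn (m + 2) ≫ f).hom.toLinearMap
  have hψ : ∀ γ x, ψ (ρD _ _ γ x) = ψ x := fun γ x =>
    Rep.hom_comm_apply (bdryπ hn (m + 2) ≫ f) γ x
  have hker : ∀ x, dD hn (m + 2) x = 0 → ψ x = 0 := fun x hx => by
    have h0 : (bdryπ hn (m + 2)).hom x = 0 := Subtype.ext hx
    change f.hom ((bdryπ hn (m + 2)).hom x) = 0
    rw [h0, map_zero]
  obtain ⟨θ, hθ, hθψ⟩ := exists_invariant_extension hm hn hψ hker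
  refine ⟨Rep.ofHom (LinearMap.intertwiningMap_of_isIntertwiningMap _ _ θ hθ), ?_⟩
  ext x
  obtain ⟨y, rfl⟩ := bdryπ_surjective hn (m + 2) x
  exact hθψ y

theorem subsingleton_ext_bdry {n : ℕ} [NeZero n] (h3 : 3 ≤ n) (hn : 2 ≤ n)
    (h : ∀ t, t ≠ M n → ∀ f, dD hn (t + 1) f = 0 → ∃ g, dD hn t g = f) (hM : n + 1 < M n) (j : ℕ)
    (hj : n + 2 + j ≤ M n) :
    Subsingleton (Abelian.Ext (bdry hn (n + 2 + j)) (Rep.trivial ℚ (Γ n) ℚ) (j + 1)) := by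
  induction j with
  | zero =>
    obtain ⟨m, rfl⟩ : ∃ m, n = m + 1 := ⟨n - 1, by omega⟩
    exact subsingleton_ext_bdry_one (by omega) hn (h _ (by omega))
  | succ j ih =>
    exact subsingleton_ext_succ (bdrySeq_shortExact hn (n + 2 + j) (h _ (by omega)))
      (ih (by omega))

theorem exists_invariant_coeff {n : ℕ} (h3 : 3 ≤ n) {V : Type*} [AddCommGroup V] [Module ℚ V]
    (ρ : Representation ℚ (Γ n) V) (B : Submodule ℚ V) (hB : ∀ γ, ∀ v ∈ B, ρ γ v ∈ B) {φ : V}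
    (hφ : φ ∉ B) (h : ∀ v, ∃ c : ℚ, v - c • φ ∈ B) :
    ∃ c : V →ₗ[ℚ] ℚ, (∀ v, c v = 0 → v ∈ B) ∧ (∀ v ∈ B, c v = 0) ∧ c φ = 1 ∧
      ∀ γ v, c (ρ γ v) = c v := by
  choose c hc using h
  have hu : ∀ v a, v - a • φ ∈ B → c v = a := fun v a ha => by
    by_contra hne
    have h1 := B.smul_mem (a - c v)⁻¹ (B.sub_mem (hc v) ha)
    rw [sub_sub_sub_cancel_left, ← sub_smul, smul_smul,
      inv_mul_cancel₀ (sub_ne_zero.2 (Ne.symm hne)), one_smul] at h1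
    exact hφ h1
  have hφ1 : c φ = 1 := hu _ _ (by simp)
  have hadd : ∀ v w, c (v + w) = c v + c w := fun v w => hu _ _ (by
    have := B.add_mem (hc v) (hc w)
    rwa [show v + w - (c v + c w) • φ = v - c v • φ + (w - c w • φ) by module])
  have hsmul : ∀ (a : ℚ) v, c (a • v) = a * c v := fun a v => hu _ _ (by
    have := B.smul_mem a (hc v)
    rwa [show a • v - (a * c v) • φ = a • (v - c v • φ) by module])
  have hρ : ∀ γ v, c (ρ γ v) = c (ρ γ φ) * c v := fun γ v => hu _ _ (by
    have := B.add_mem (hB γ _ (hc v)) (B.smul_mem (c v) (hc (ρ γ φ)))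
    rw [map_sub, map_smul] at this
    rwa [show ρ γ v - (c (ρ γ φ) * c v) • φ =
      ρ γ v - c v • ρ γ φ + c v • (ρ γ φ - c (ρ γ φ) • φ) by module])
  let χ : Γ n →* ℚ :=
    { toFun := fun γ => c (ρ γ φ)
      map_one' := by simpa using hφ1
      map_mul' := fun γ δ => by rw [map_mul, Module.End.mul_apply, hρ] }
  have hχ : ∀ γ, c (ρ γ φ) = 1 := fun γ =>
    congrArg Units.val (hom_trivial h3 χ.toHomUnits γ)
  refine ⟨{ toFun := c, map_add' := hadd, map_smul' := hsmul }, fun v hv => ?_, fun v hv => ?_,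
    hφ1, fun γ v => ?_⟩
  · have := hc v
    rwa [show c v = 0 from hv, zero_smul, sub_zero] at this
  · exact hu _ _ (by simpa using hv)
  · exact (hρ γ v).trans (by rw [hχ, one_mul]; rfl)

theorem subsingleton_ext_trivial {n : ℕ} [NeZero n] (h3 : 3 ≤ n) (hn : 2 ≤ n) {k q : ℕ}
    (hproj : Projective (bdry hn (k + 1)))
    (hq : Subsingleton (Abelian.Ext (bdry hn k) (Rep.trivial ℚ (Γ n) ℚ) q))
    {φ : D n (k + 1)} (h0 : dD hn (k + 1) φ = 0) (h1 : ∀ g, dD hn k g ≠ φ)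
    (h2 : ∀ f, dD hn (k + 1) f = 0 → ∃ (c : ℚ) (g : _), dD hn k g = f - c • φ) :
    Subsingleton (Abelian.Ext (Rep.trivial ℚ (Γ n) ℚ) (Rep.trivial ℚ (Γ n) ℚ) (q + 1)) := by
  have := projective_cyc hn (k + 1)
  let φ' : cyc hn (k + 1) := (⟨φ, h0⟩ : LinearMap.ker (dD hn (k + 1)))
  obtain ⟨c, hc1, hc2, hc3, hc4⟩ := exists_invariant_coeff h3 (cyc hn (k + 1)).ρ
    (LinearMap.range (bdryToCyc hn k).hom.toLinearMap)
    (by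
      rintro γ _ ⟨b, rfl⟩
      exact ⟨(bdry hn k).ρ γ b, Rep.hom_comm_apply (bdryToCyc hn k) γ b⟩)
    (φ := φ')
    (by
      rintro ⟨b, hb⟩
      obtain ⟨g, rfl⟩ := bdryπ_surjective hn k b
      exact h1 g (congrArg Subtype.val hb))
    (by
      intro v
      obtain ⟨a, g, hg⟩ := h2 v.1 v.2
      exact ⟨a, (bdryπ hn k).hom g, Subtype.ext hg⟩)
  let C : cyc hn (k + 1) ⟶ Rep.trivial ℚ (Γ n) ℚ :=
    Rep.ofHom (LinearMap.intertwiningMap_of_isIntertwiningMap _ _ c hc4)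
  have w : bdryToCyc hn k ≫ C = 0 := by
    ext b
    exact hc2 _ ⟨b, rfl⟩
  have hS : (ShortComplex.mk _ _ w).ShortExact := by
    refine shortExact_mk _ _ _ (fun a b hab => Subtype.ext (congrArg (fun z => z.1) hab))
      (fun a => ⟨a • φ', ?_⟩) hc1
    change c (a • φ') = a
    rw [map_smul, hc3, smul_eq_mul, mul_one]
  exact subsingleton_ext_succ hS hq

end Final

end SLCoh

open SLCoh in
/-- **Church–Putman.** For every `n ≥ 3`, the rational group cohomology of `SL_n(ℤ)`
vanishes in codimension one below its virtual cohomological dimension `n(n-1)/2`. -/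
theorem sln_z_cohomology_vanishes_codim_one (n : ℕ) (hn : 3 ≤ n) :
    Subsingleton
      (groupCohomology (Rep.trivial ℚ (Matrix.SpecialLinearGroup (Fin n) ℤ) ℚ)
        (n * (n - 1) / 2 - 1)) := by
  have h3 := hn
  have : NeZero n := ⟨by omega⟩
  have hn : 2 ≤ n := by omega
  obtain ⟨d, rfl⟩ : ∃ d, n = d + 3 := ⟨n - 3, by omega⟩
  obtain ⟨e, he⟩ : ∃ e, (d + 3) * (d + 3 + 1) = 2 * e := (Nat.even_mul_succ_self (d + 3)).two_dvd
  have he' : (d + 3) * (d + 3 - 1) = 2 * (e - (d + 3)) := by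
    rw [show d + 3 - 1 = d + 2 from rfl]
    zify [show d + 3 ≤ e by nlinarith]
    zify at he
    linarith
  have hlarge : d + 6 ≤ e := by nlinarith
  have hM : M (d + 3) = e - 1 := by
    unfold M
    rw [he]
    omega
  obtain ⟨k, hk⟩ : ∃ k, M (d + 3) = k + 1 := ⟨e - 2, by omega⟩
  obtain ⟨b, hb0, hb1⟩ : ∃ b : ℝ, 0 < b ∧ b < 1 / ((d + 3 : ℕ) : ℝ) :=
    exists_between (by positivity)
  obtain ⟨ω, hω⟩ := sphere hn hb0 hb1
  have hex : ∀ t, t ≠ M (d + 3) → ∀ f, dD hn (t + 1) f = 0 → ∃ g, dD hn t g = f := fun t ht f hf =>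
    dD_exact hn hb0 (fun b' h0 h1 => (hω b' h0 h1).2) ht hf
  revert ω
  rw [hk]
  intro ω hω
  obtain ⟨φ, h0, h1, h2⟩ := top_class hn hb0 fun b' h0 h1 => (hω b' h0 h1).1
  have hproj : CategoryTheory.Projective (bdry hn (k + 2)) :=
    projective_bdry hn (k := k + 2) (fun t ht => hex t (by omega)) _ le_rfl
  have hq := subsingleton_ext_bdry h3 hn hex (by omega) (k + 1 - (d + 3 + 2)) (by omega)
  rw [show d + 3 + 2 + (k + 1 - (d + 3 + 2)) = k + 1 by omega] at hq
  have h := subsingleton_groupCohomology_of_ext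
    (subsingleton_ext_trivial h3 hn hproj hq h0 h1 h2)
  rwa [he', show 2 * (e - (d + 3)) / 2 - 1 = k + 1 - (d + 3 + 2) + 1 + 1 by omega]
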